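/- Let K be a closed connected subgroup of SO(5) with K ≠ SO(5). Then K is finitely covered by a product of at most two factors, each of which is the circle group or SU(2): there exist a compact topological group P isomorphic as a topological group to one of {1}, S¹, SU(2), S¹ × S¹, S¹ × SU(2), SU(2) × SU(2), and a continuous surjective group homomorphism P → K with finite kernel. -/

import Mathlib

/-- The special unitary group `SU(n, α)`: unitary `n × n` matrices of determinant `1`,
as a subgroup of the unitary group.  (Over `ℝ`, whose star operation is trivial, this
is the special orthogonal group `SO(n)`.) -/
def SUgrp (n : ℕ) (α : Type) [CommRing α] [StarRing α] :
    Subgroup (Matrix.unitaryGroup (Fin n) α) where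
  carrier := {A | (A : Matrix (Fin n) (Fin n) α).det = 1}
  one_mem' := by simp
  mul_mem' := by
    intro a b ha hb
    simp only [Set.mem_setOf_eq] at ha hb ⊢
    rw [Matrix.UnitaryGroup.mul_val, Matrix.det_mul, ha, hb, one_mul]
  inv_mem' := by
    intro a ha
    simp only [Set.mem_setOf_eq] at ha ⊢
    rw [Matrix.UnitaryGroup.inv_val, Matrix.star_eq_conjTranspose,
      Matrix.det_conjTranspose, ha, star_one]

/-- `P` finitely covers `H`: there is a continuous surjective group homomorphism
`P →* H` with finite kernel. -/
def FinitelyCovers (P H : Type*) [Group P] [TopologicalSpace P]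
    [Group H] [TopologicalSpace H] : Prop :=
  ∃ f : P →* H, Continuous f ∧ Function.Surjective f ∧ Finite (MonoidHom.ker f)

open Filter Topology

section LieTheory

variable {𝔸 : Type*} [NormedRing 𝔸] [NormedAlgebra ℝ 𝔸] [FiniteDimensional ℝ 𝔸]

theorem continuous_exp_real_algebra : Continuous (NormedSpace.exp : 𝔸 → 𝔸) := by
  let _ : NormedAlgebra ℚ 𝔸 := .restrictScalars ℚ ℝ 𝔸
  have _ : CompleteSpace 𝔸 := FiniteDimensional.complete ℝ 𝔸
  exact NormedSpace.exp_continuous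

theorem exp_add_smul (X : 𝔸) (s t : ℝ) :
    NormedSpace.exp ((s + t) • X) = NormedSpace.exp (s • X) * NormedSpace.exp (t • X) := by
  let _ : NormedAlgebra ℚ 𝔸 := .restrictScalars ℚ ℝ 𝔸
  have _ : CompleteSpace 𝔸 := FiniteDimensional.complete ℝ 𝔸
  rw [add_smul]
  exact NormedSpace.exp_add_of_commute (((Commute.refl X).smul_left s).smul_right t)

theorem exp_neg_smul_mul (X : 𝔸) (t : ℝ) :
    NormedSpace.exp (-t • X) * NormedSpace.exp (t • X) = 1 := by
  rw [← exp_add_smul]; simp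

theorem exp_mul_neg_smul (X : 𝔸) (t : ℝ) :
    NormedSpace.exp (t • X) * NormedSpace.exp (-t • X) = 1 := by
  rw [← exp_add_smul]; simp

theorem exp_smul_pow (X : 𝔸) (t : ℝ) (n : ℕ) :
    NormedSpace.exp (t • X) ^ n = NormedSpace.exp ((n * t) • X) := by
  induction n with
  | zero => simp
  | succ n ih => rw [pow_succ, ih, ← exp_add_smul]; push_cast; ring_nf

theorem hasDerivAt_exp_smul (X : 𝔸) (t : ℝ) :
    HasDerivAt (fun s : ℝ => NormedSpace.exp (s • X)) (NormedSpace.exp (t • X) * X) t := by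
  have _ : CompleteSpace 𝔸 := FiniteDimensional.complete ℝ 𝔸
  exact hasDerivAt_exp_smul_const X t

theorem hasDerivAt_exp_smul_zero (X : 𝔸) :
    HasDerivAt (fun s : ℝ => NormedSpace.exp (s • X)) X 0 := by
  simpa using hasDerivAt_exp_smul X 0

/-- A differentiable one-parameter group is the exponential of its velocity at `0`. -/
theorem oneParam_eq_exp {γ : ℝ → 𝔸} {X : 𝔸} (h0 : γ 0 = 1)
    (hadd : ∀ s t, γ (s + t) = γ s * γ t) (hd : HasDerivAt γ X 0) (t : ℝ) :
    γ t = NormedSpace.exp (t • X) := by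
  have h1 : ∀ t, HasDerivAt γ (γ t * X) t := by
    intro t
    have : HasDerivAt (fun s => γ t * γ (s - t)) (γ t * X) t := by
      have h2 : HasDerivAt (fun s => γ (s - t)) X t := by
        have := HasDerivAt.comp_sub_const (x := t) (a := t) (f := γ) (f' := X) (by simpa using hd)
        exact this
      exact h2.const_mul _
    refine this.congr_of_eventuallyEq (Eventually.of_forall fun s => ?_)
    simp only [← hadd]; ring_nf
  have h2 : ∀ t, HasDerivAt (fun s => γ s * NormedSpace.exp (-s • X)) 0 t := by
    intro t
    have h3 : HasDerivAt (fun s : ℝ => NormedSpace.exp (s • (-X)))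
        (-(X * NormedSpace.exp (-t • X))) t := by
      have _ : CompleteSpace 𝔸 := FiniteDimensional.complete ℝ 𝔸
      have := hasDerivAt_exp_smul_const' (-X) t
      simpa using this
    have h4 := (h1 t).mul h3
    have e : (fun s => γ s * NormedSpace.exp (-s • X)) =
        γ * fun s : ℝ => NormedSpace.exp (s • (-X)) := by
      funext s; simp
    rw [e]
    convert h4 using 1
    simp [mul_assoc]
  have h5 : γ t * NormedSpace.exp (-t • X) = γ 0 * NormedSpace.exp (-(0 : ℝ) • X) :=
    is_const_of_deriv_eq_zero (f := fun s => γ s * NormedSpace.exp (-s • X))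
      (fun t => (h2 t).differentiableAt) (fun t => (h2 t).deriv) t 0
  simp only [h0, neg_zero, zero_smul, NormedSpace.exp_zero, mul_one] at h5
  calc γ t = γ t * NormedSpace.exp (-t • X) * NormedSpace.exp (t • X) := by
        rw [mul_assoc, exp_neg_smul_mul, mul_one]
    _ = _ := by rw [h5, one_mul]

omit [NormedAlgebra ℝ 𝔸] [FiniteDimensional ℝ 𝔸] in
theorem norm_pow_sub_pow_le {C D : ℝ} (hC : 0 ≤ C) (a b : 𝔸) (n : ℕ)
    (ha : ∀ k ≤ n, ‖a ^ k‖ ≤ C) (hb : ∀ k ≤ n, ‖b ^ k‖ ≤ D) :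
    ‖a ^ n - b ^ n‖ ≤ n * (C * D * ‖a - b‖) := by
  have key : ∀ m ≤ n, ‖a ^ m * b ^ (n - m) - b ^ n‖ ≤ m * (C * D * ‖a - b‖) := by
    intro m
    induction m with
    | zero => intro _; simp
    | succ m ih =>
      intro hm
      have hm' := ih (by omega)
      have e : a ^ (m + 1) * b ^ (n - (m + 1)) - b ^ n
          = a ^ m * (a - b) * b ^ (n - (m + 1)) + (a ^ m * b ^ (n - m) - b ^ n) := by
        have : n - m = (n - (m + 1)) + 1 := by omega
        rw [this, pow_succ a, pow_succ' b]
        noncomm_ring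
      rw [e]
      refine (norm_add_le _ _).trans ?_
      have h1 : ‖a ^ m * (a - b) * b ^ (n - (m + 1))‖ ≤ C * ‖a - b‖ * D := by
        refine (norm_mul_le _ _).trans ?_
        refine mul_le_mul ((norm_mul_le _ _).trans ?_) (hb _ (by omega)) (norm_nonneg _)
          (by positivity)
        exact mul_le_mul_of_nonneg_right (ha _ (by omega)) (norm_nonneg _)
      push_cast
      nlinarith
  simpa using key n le_rfl

/-- A compact group of invertible elements, as a submonoid of the ambient algebra. -/
structure IsCompactGrp {𝔸 : Type*} [NormedRing 𝔸] (S : Submonoid 𝔸) : Prop where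
  compact : IsCompact (S : Set 𝔸)
  inv : ∀ x ∈ S, ∃ y ∈ S, x * y = 1 ∧ y * x = 1

omit [NormedAlgebra ℝ 𝔸] [FiniteDimensional ℝ 𝔸] in
theorem IsCompactGrp.inv_mem {S : Submonoid 𝔸} (hS : IsCompactGrp S) {x y : 𝔸} (hx : x ∈ S)
    (hxy : x * y = 1) : y ∈ S := by
  obtain ⟨z, hz, h1, h2⟩ := hS.inv x hx
  have : y = z := by
    calc y = z * x * y := by rw [h2, one_mul]
      _ = z := by rw [mul_assoc, hxy, mul_one]
  rwa [this]

theorem exp_smul_mem_of_tendsto {S : Submonoid 𝔸} (hS : IsCompactGrp S) {k : ℕ → 𝔸} {ε : ℕ → ℝ}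
    {X : 𝔸} (hk : ∀ n, k n ∈ S) (hε : ∀ n, 0 < ε n) (hε0 : Tendsto ε atTop (𝓝 0))
    (hX : Tendsto (fun n => (ε n)⁻¹ • (k n - 1)) atTop (𝓝 X)) (t : ℝ) :
    NormedSpace.exp (t • X) ∈ S := by
  have main : ∀ t : ℝ, 0 ≤ t → NormedSpace.exp (t • X) ∈ S := by
    intro t ht
    obtain ⟨C, hC⟩ := hS.compact.isBounded.exists_norm_le
    have hC0 : 0 ≤ C := (norm_nonneg _).trans (hC 1 S.one_mem)
    have hcpt : IsCompact ((fun s : ℝ => NormedSpace.exp (s • X)) '' Set.Icc 0 t) :=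
      isCompact_Icc.image (continuous_exp_real_algebra.comp (by fun_prop))
    obtain ⟨D, hD⟩ := hcpt.isBounded.exists_norm_le
    have hD0 : 0 ≤ D := (norm_nonneg _).trans (hD _ ⟨0, ⟨le_rfl, ht⟩, rfl⟩)
    set m : ℕ → ℕ := fun n => ⌊t / ε n⌋₊ with hm
    have hmle : ∀ n, (m n : ℝ) * ε n ≤ t := fun n => by
      have := Nat.floor_le (div_nonneg ht (hε n).le)
      rw [le_div_iff₀ (hε n)] at this; exact this
    have hmge : ∀ n, t - ε n ≤ (m n : ℝ) * ε n := fun n => by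
      have := Nat.lt_floor_add_one (t / ε n)
      rw [div_lt_iff₀ (hε n)] at this; simp only [hm]; linarith
    have hmt : Tendsto (fun n => (m n : ℝ) * ε n) atTop (𝓝 t) := by
      refine tendsto_of_tendsto_of_tendsto_of_le_of_le
        (by simpa using (tendsto_const_nhds (x := t)).sub hε0) tendsto_const_nhds hmge hmle
    have hd : Tendsto (fun n => (ε n)⁻¹ • (NormedSpace.exp (ε n • X) - 1)) atTop (𝓝 X) := by
      have h := (hasDerivAt_exp_smul_zero X).tendsto_slope_zero
      have h2 : Tendsto ε atTop (𝓝[≠] 0) :=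
        tendsto_nhdsWithin_iff.2 ⟨hε0, Eventually.of_forall fun n => (hε n).ne'⟩
      simpa [Function.comp_def] using h.comp h2
    have hdiff : Tendsto (fun n => (ε n)⁻¹ * ‖k n - NormedSpace.exp (ε n • X)‖) atTop (𝓝 0) := by
      have h := (hX.sub hd).norm
      simp only [sub_self, norm_zero] at h
      refine h.congr fun n => ?_
      rw [← smul_sub, norm_smul, sub_sub_sub_cancel_right, Real.norm_eq_abs,
        abs_of_pos (inv_pos.2 (hε n))]
    have hpow : Tendsto (fun n => k n ^ m n - NormedSpace.exp (ε n • X) ^ m n) atTop (𝓝 0) := by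
      rw [tendsto_zero_iff_norm_tendsto_zero]
      have hlim : Tendsto (fun n => t * (C * D) * ((ε n)⁻¹ * ‖k n - NormedSpace.exp (ε n • X)‖))
          atTop (𝓝 0) := by simpa using hdiff.const_mul (t * (C * D))
      refine squeeze_zero (fun n => norm_nonneg _) (fun n => ?_) hlim
      refine (norm_pow_sub_pow_le hC0 _ _ (m n) (fun j _ => hC _ (S.pow_mem (hk n) j))
        (D := D) fun j hj => ?_).trans ?_
      · rw [exp_smul_pow]
        refine hD _ ⟨_, ⟨by have := (hε n).le; positivity, ?_⟩, rfl⟩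
        refine le_trans ?_ (hmle n)
        exact mul_le_mul_of_nonneg_right (by exact_mod_cast hj) (hε n).le
      · have h1 : (m n : ℝ) ≤ t * (ε n)⁻¹ := by
          rw [← div_eq_mul_inv]; exact Nat.floor_le (div_nonneg ht (hε n).le)
        calc (m n : ℝ) * (C * D * ‖k n - NormedSpace.exp (ε n • X)‖)
            ≤ (t * (ε n)⁻¹) * (C * D * ‖k n - NormedSpace.exp (ε n • X)‖) :=
              mul_le_mul_of_nonneg_right h1 (by positivity)
          _ = _ := by ring
    have hexp : Tendsto (fun n => NormedSpace.exp (ε n • X) ^ m n) atTop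
        (𝓝 (NormedSpace.exp (t • X))) := by
      simp only [exp_smul_pow]
      exact (continuous_exp_real_algebra.tendsto _).comp (hmt.smul_const X)
    have := hpow.add hexp
    simp only [sub_add_cancel, zero_add] at this
    exact hS.compact.isClosed.mem_of_tendsto this (Eventually.of_forall fun n => S.pow_mem (hk n) _)
  rcases le_total 0 t with h | h
  · exact main t h
  · refine hS.inv_mem (main (-t) (by linarith)) ?_
    simpa using exp_mul_neg_smul X (-t)

theorem exp_smul_mem_of_hasDerivAt {S : Submonoid 𝔸} (hS : IsCompactGrp S) {γ : ℝ → 𝔸} {X : 𝔸}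
    (h0 : γ 0 = 1) (hγ : ∀ t, γ t ∈ S) (hd : HasDerivAt γ X 0) (t : ℝ) :
    NormedSpace.exp (t • X) ∈ S := by
  have hε : Tendsto (fun n : ℕ => ((n : ℝ) + 1)⁻¹) atTop (𝓝 0) := by
    simpa using tendsto_one_div_add_atTop_nhds_zero_nat (𝕜 := ℝ)
  have hpos : ∀ n : ℕ, (0 : ℝ) < ((n : ℝ) + 1)⁻¹ := fun n => by positivity
  refine exp_smul_mem_of_tendsto hS (k := fun n => γ ((n : ℝ) + 1)⁻¹) (fun n => hγ _) hpos hε ?_ t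
  have h := hd.tendsto_slope_zero.comp
    (tendsto_nhdsWithin_iff.2 ⟨hε, Eventually.of_forall fun n => (hpos n).ne'⟩)
  simpa [h0, Function.comp_def] using h

/-- The Lie algebra of a compact group. -/
def lieAlg {S : Submonoid 𝔸} (hS : IsCompactGrp S) : Submodule ℝ 𝔸 where
  carrier := {X | ∀ t : ℝ, NormedSpace.exp (t • X) ∈ S}
  zero_mem' := by intro t; simp
  add_mem' := by
    intro X Y hX hY
    refine exp_smul_mem_of_hasDerivAt hS
      (γ := fun t => NormedSpace.exp (t • X) * NormedSpace.exp (t • Y)) (by simp)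
      (fun t => S.mul_mem (hX t) (hY t)) ?_
    have := (hasDerivAt_exp_smul_zero X).mul (hasDerivAt_exp_smul_zero Y)
    simp only [zero_smul, NormedSpace.exp_zero, mul_one, one_mul] at this
    exact this
  smul_mem' := by
    intro c X hX t
    rw [smul_smul]; exact hX _

theorem commutator_mem_lieAlg {S : Submonoid 𝔸} (hS : IsCompactGrp S) {X Y : 𝔸}
    (hX : X ∈ lieAlg hS) (hY : Y ∈ lieAlg hS) : X * Y - Y * X ∈ lieAlg hS := by
  let _ : NormedAlgebra ℚ 𝔸 := .restrictScalars ℚ ℝ 𝔸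
  have _ : CompleteSpace 𝔸 := FiniteDimensional.complete ℝ 𝔸
  have hconj : ∀ s : ℝ, NormedSpace.exp (s • X) * Y * NormedSpace.exp (-s • X) ∈ lieAlg hS := by
    intro s t
    let u : 𝔸ˣ := ⟨NormedSpace.exp (s • X), NormedSpace.exp (-s • X), exp_mul_neg_smul X s,
      exp_neg_smul_mul X s⟩
    have h := NormedSpace.exp_units_conj u (t • Y)
    have e : t • (NormedSpace.exp (s • X) * Y * NormedSpace.exp (-s • X))
        = (u : 𝔸) * (t • Y) * ((u⁻¹ : 𝔸ˣ) : 𝔸) := by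
      change _ = NormedSpace.exp (s • X) * (t • Y) * NormedSpace.exp (-s • X)
      simp
    rw [e, h]
    exact S.mul_mem (S.mul_mem (hX s) (hY t)) (hX (-s))
  have hd : HasDerivAt (fun s : ℝ => NormedSpace.exp (s • X) * Y * NormedSpace.exp (-s • X))
      (X * Y - Y * X) 0 := by
    have h1 := (hasDerivAt_exp_smul_zero X).mul_const Y
    have h2 := hasDerivAt_exp_smul_zero (-X)
    have h3 := h1.mul h2
    simp only [zero_smul, NormedSpace.exp_zero, mul_one, one_mul, mul_neg, ← sub_eq_add_neg] at h3
    simp only [smul_neg, ← neg_smul] at h3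
    exact h3
  have hclosed : IsClosed (lieAlg hS : Set 𝔸) := (lieAlg hS).closed_of_finiteDimensional
  have h := hd.tendsto_slope_zero
  refine hclosed.mem_of_tendsto h (Eventually.of_forall fun s => ?_)
  refine (lieAlg hS).smul_mem _ ((lieAlg hS).sub_mem (hconj _) (hconj _))

/-- A compact subgroup containing all one-parameter subgroups of a connected compact group `S`
is equal to `S`. -/
theorem IsCompactGrp.le_of_exp_mem {S H : Submonoid 𝔸} (hS : IsCompactGrp S)
    (hH : IsCompactGrp H) (hconn : IsPreconnected (S : Set 𝔸))
    (hexp : ∀ X ∈ lieAlg hS, ∀ t : ℝ, NormedSpace.exp (t • X) ∈ H) (hHS : H ≤ S) : S ≤ H := by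
  -- A sequence of elements of `S` outside `H` cannot converge to `1`.
  have key : ∀ k : ℕ → 𝔸, (∀ n, k n ∈ S) → (∀ n, k n ∉ H) → ¬ Tendsto k atTop (𝓝 1) := by
    intro k hkS hkH hk
    have hex : ∀ n, ∃ h ∈ H, ∀ h' ∈ H, ‖h * k n - 1‖ ≤ ‖h' * k n - 1‖ := fun n => by
      obtain ⟨h, hh, hmin⟩ := hH.compact.exists_isMinOn ⟨1, H.one_mem⟩
        (f := fun h => ‖h * k n - 1‖) (by fun_prop)
      exact ⟨h, hh, fun h' hh' => hmin hh'⟩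
    choose h hhH hmin using hex
    set g : ℕ → 𝔸 := fun n => h n * k n with hg
    have hgS : ∀ n, g n ∈ S := fun n => S.mul_mem (hHS (hhH n)) (hkS n)
    have hgne : ∀ n, g n ≠ 1 := fun n he => by
      exact hkH n (hH.inv_mem (hhH n) he)
    have hgle : ∀ n, ‖g n - 1‖ ≤ ‖k n - 1‖ := fun n => by
      simpa using hmin n 1 H.one_mem
    set ε : ℕ → ℝ := fun n => ‖g n - 1‖ with hεdef
    have hε : ∀ n, 0 < ε n := fun n => norm_pos_iff.2 (sub_ne_zero.2 (hgne n))
    have hε0 : Tendsto ε atTop (𝓝 0) := by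
      refine squeeze_zero (fun n => norm_nonneg _) hgle ?_
      have := (hk.sub_const 1).norm
      simpa using this
    have hsphere : ∀ n, (ε n)⁻¹ • (g n - 1) ∈ Metric.sphere (0 : 𝔸) 1 := fun n => by
      rw [mem_sphere_zero_iff_norm, norm_smul, Real.norm_eq_abs, abs_of_pos (inv_pos.2 (hε n))]
      exact inv_mul_cancel₀ (hε n).ne'
    have _ : ProperSpace 𝔸 := FiniteDimensional.proper ℝ 𝔸
    obtain ⟨X, hX1, φ, hφ, hlim⟩ := (isCompact_sphere (0 : 𝔸) 1).tendsto_subseq hsphere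
    have hεφ := hε0.comp hφ.tendsto_atTop
    have hXL : X ∈ lieAlg hS := fun t =>
      exp_smul_mem_of_tendsto hS (k := g ∘ φ) (ε := ε ∘ φ) (fun n => hgS _) (fun n => hε _) hεφ
        hlim t
    have hd : Tendsto (fun n => (ε (φ n))⁻¹ • (NormedSpace.exp (ε (φ n) • X) - 1)) atTop
        (𝓝 X) := by
      have h := (hasDerivAt_exp_smul_zero X).tendsto_slope_zero
      have h2 : Tendsto (ε ∘ φ) atTop (𝓝[≠] 0) :=
        tendsto_nhdsWithin_iff.2 ⟨hεφ, Eventually.of_forall fun n => (hε _).ne'⟩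
      simpa [Function.comp_def] using h.comp h2
    have hdiff := hlim.sub hd
    rw [sub_self] at hdiff
    have hneg : Tendsto (fun n => NormedSpace.exp (-(ε (φ n)) • X)) atTop (𝓝 1) := by
      have h1 : Tendsto (fun n => -(ε (φ n)) • X) atTop (𝓝 0) := by
        simpa using (hεφ.neg).smul_const X
      simpa [Function.comp_def] using (continuous_exp_real_algebra.tendsto (0 : 𝔸)).comp h1
    have hprod := (hneg.mul hdiff).norm
    rw [mul_zero, norm_zero] at hprod
    have hge : ∀ n, 1 ≤ ‖NormedSpace.exp (-(ε (φ n)) • X) *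
        (((fun n => (ε n)⁻¹ • (g n - 1)) ∘ φ) n -
          (ε (φ n))⁻¹ • (NormedSpace.exp (ε (φ n) • X) - 1))‖ := by
      intro n
      have e : NormedSpace.exp (-(ε (φ n)) • X) *
        (((fun n => (ε n)⁻¹ • (g n - 1)) ∘ φ) n -
          (ε (φ n))⁻¹ • (NormedSpace.exp (ε (φ n) • X) - 1)) =
          (ε (φ n))⁻¹ • ((NormedSpace.exp (-(ε (φ n)) • X) * h (φ n)) * k (φ n) - 1) := by
        simp only [Function.comp, hg]
        rw [← smul_sub, sub_sub_sub_cancel_right, mul_smul_comm, mul_sub, exp_neg_smul_mul,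
          mul_assoc]
      rw [e, norm_smul, Real.norm_eq_abs, abs_of_pos (inv_pos.2 (hε _)), ← div_eq_inv_mul,
        le_div_iff₀ (hε _), one_mul]
      exact hmin _ _ (H.mul_mem (hexp X hXL _) (hhH _))
    have := ge_of_tendsto hprod (Eventually.of_forall hge)
    exact absurd this (by norm_num)
  have hdiff_closed : IsClosed ((S : Set 𝔸) \ H) := by
    refine IsSeqClosed.isClosed fun x p hx hp => ?_
    have hpS : p ∈ S := hS.compact.isClosed.mem_of_tendsto hp
      (Eventually.of_forall fun n => (hx n).1)
    refine ⟨hpS, fun hpH => ?_⟩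
    obtain ⟨q, hqH, hpq, hqp⟩ := hH.inv p hpH
    refine key (fun n => q * x n) (fun n => S.mul_mem (hHS hqH) (hx n).1) (fun n hn => ?_) ?_
    · refine (hx n).2 ?_
      have := H.mul_mem hpH hn
      rwa [← mul_assoc, hpq, one_mul] at this
    · simpa [hqp] using hp.const_mul q
  intro s hs
  by_contra hsH
  obtain ⟨x, -, hx1, hx2⟩ := isPreconnected_closed_iff.1 hconn H ((S : Set 𝔸) \ H)
    hH.compact.isClosed hdiff_closed (fun x hx => by by_cases h : x ∈ H <;> simp_all)
    ⟨1, S.one_mem, H.one_mem⟩ ⟨s, hs, hs, hsH⟩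
  exact hx2.2 hx1

end LieTheory

section SkewMatrices

open scoped Matrix.Norms.Operator

/-- The skew-symmetric `5 × 5` matrices in coordinates adapted to `ℝ⁵ = ℂ ⊕ ℂ ⊕ ℝ`:
`a, b` are the coordinates of the standard torus, and `w, z, p, q` are the coordinates of the
root planes of weights `a`, `b`, `a - b`, `a + b`. -/
def skewMat (a b w₁ w₂ z₁ z₂ p₁ p₂ q₁ q₂ : ℝ) : Matrix (Fin 5) (Fin 5) ℝ :=
  !![0, -a, p₁ + q₁, -p₂ + q₂, w₁;
     a, 0, p₂ + q₂, p₁ - q₁, w₂;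
     -(p₁ + q₁), -(p₂ + q₂), 0, -b, z₁;
     -(-p₂ + q₂), -(p₁ - q₁), b, 0, z₂;
     -w₁, -w₂, -z₁, -z₂, 0]

set_option maxHeartbeats 2000000 in
theorem skewMat_bracket (a b w₁ w₂ z₁ z₂ p₁ p₂ q₁ q₂ a' b' w₁' w₂' z₁' z₂' p₁' p₂' q₁' q₂' : ℝ) :
    skewMat a b w₁ w₂ z₁ z₂ p₁ p₂ q₁ q₂ * skewMat a' b' w₁' w₂' z₁' z₂' p₁' p₂' q₁' q₂' -
      skewMat a' b' w₁' w₂' z₁' z₂' p₁' p₂' q₁' q₂' * skewMat a b w₁ w₂ z₁ z₂ p₁ p₂ q₁ q₂ =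
    skewMat
      ((w₁ * w₂' - w₂ * w₁') + 2 * (p₁ * p₂' - p₂ * p₁') + 2 * (q₁ * q₂' - q₂ * q₁'))
      ((z₁ * z₂' - z₂ * z₁') - 2 * (p₁ * p₂' - p₂ * p₁') + 2 * (q₁ * q₂' - q₂ * q₁'))
      (-(a * w₂' - w₂ * a') - (z₁ * p₁' - p₁ * z₁') - (z₁ * q₁' - q₁ * z₁')
        + (z₂ * p₂' - p₂ * z₂') - (z₂ * q₂' - q₂ * z₂'))
      ((a * w₁' - w₁ * a') - (z₁ * p₂' - p₂ * z₁') - (z₁ * q₂' - q₂ * z₁')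
        - (z₂ * p₁' - p₁ * z₂') + (z₂ * q₁' - q₁ * z₂'))
      (-(b * z₂' - z₂ * b') + (w₁ * p₁' - p₁ * w₁') + (w₁ * q₁' - q₁ * w₁')
        + (w₂ * p₂' - p₂ * w₂') + (w₂ * q₂' - q₂ * w₂'))
      ((b * z₁' - z₁ * b') - (w₁ * p₂' - p₂ * w₁') + (w₁ * q₂' - q₂ * w₁')
        + (w₂ * p₁' - p₁ * w₂') - (w₂ * q₁' - q₁ * w₂'))
      (-(a * p₂' - p₂ * a') + (b * p₂' - p₂ * b') - 1 / 2 * (w₁ * z₁' - z₁ * w₁')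
        - 1 / 2 * (w₂ * z₂' - z₂ * w₂'))
      ((a * p₁' - p₁ * a') - (b * p₁' - p₁ * b') + 1 / 2 * (w₁ * z₂' - z₂ * w₁')
        - 1 / 2 * (w₂ * z₁' - z₁ * w₂'))
      (-(a * q₂' - q₂ * a') - (b * q₂' - q₂ * b') - 1 / 2 * (w₁ * z₁' - z₁ * w₁')
        + 1 / 2 * (w₂ * z₂' - z₂ * w₂'))
      ((a * q₁' - q₁ * a') + (b * q₁' - q₁ * b') - 1 / 2 * (w₁ * z₂' - z₂ * w₁')
        - 1 / 2 * (w₂ * z₁' - z₁ * w₂')) := by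
  ext i j
  fin_cases i <;> fin_cases j <;>
    simp [skewMat] <;> ring

theorem skewMat_add (a b w₁ w₂ z₁ z₂ p₁ p₂ q₁ q₂ a' b' w₁' w₂' z₁' z₂' p₁' p₂' q₁' q₂' : ℝ) :
    skewMat a b w₁ w₂ z₁ z₂ p₁ p₂ q₁ q₂ + skewMat a' b' w₁' w₂' z₁' z₂' p₁' p₂' q₁' q₂' =
      skewMat (a + a') (b + b') (w₁ + w₁') (w₂ + w₂') (z₁ + z₁') (z₂ + z₂') (p₁ + p₁') (p₂ + p₂')
        (q₁ + q₁') (q₂ + q₂') := by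
  ext i j
  fin_cases i <;> fin_cases j <;> simp [skewMat] <;> ring

theorem skewMat_smul (c a b w₁ w₂ z₁ z₂ p₁ p₂ q₁ q₂ : ℝ) :
    c • skewMat a b w₁ w₂ z₁ z₂ p₁ p₂ q₁ q₂ =
      skewMat (c * a) (c * b) (c * w₁) (c * w₂) (c * z₁) (c * z₂) (c * p₁) (c * p₂)
        (c * q₁) (c * q₂) := by
  ext i j
  fin_cases i <;> fin_cases j <;> simp [skewMat] <;> ring

theorem exists_skewMat {X : Matrix (Fin 5) (Fin 5) ℝ} (hX : X.transpose = -X) :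
    ∃ a b w₁ w₂ z₁ z₂ p₁ p₂ q₁ q₂, X = skewMat a b w₁ w₂ z₁ z₂ p₁ p₂ q₁ q₂ := by
  have h : ∀ i j, X j i = -X i j := fun i j => congrFun (congrFun hX i) j
  refine ⟨X 1 0, X 3 2, X 0 4, X 1 4, X 2 4, X 3 4, (X 0 2 + X 1 3) / 2, (X 1 2 - X 0 3) / 2,
    (X 0 2 - X 1 3) / 2, (X 0 3 + X 1 2) / 2, ?_⟩
  ext i j
  have := h i j
  have := h j i
  fin_cases i <;> fin_cases j <;> simp [skewMat] at * <;> linarith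

/-- A Lie algebra of skew-symmetric `5 × 5` matrices. -/
structure IsSkewLie (L : Submodule ℝ (Matrix (Fin 5) (Fin 5) ℝ)) : Prop where
  skew : ∀ X ∈ L, X.transpose = -X
  bracket : ∀ X ∈ L, ∀ Y ∈ L, X * Y - Y * X ∈ L

namespace IsSkewLie

variable {L : Submodule ℝ (Matrix (Fin 5) (Fin 5) ℝ)}


theorem smul_mem (c : ℝ) {a b w₁ w₂ z₁ z₂ p₁ p₂ q₁ q₂ : ℝ}
    (h : skewMat a b w₁ w₂ z₁ z₂ p₁ p₂ q₁ q₂ ∈ L) :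
    skewMat (c * a) (c * b) (c * w₁) (c * w₂) (c * z₁) (c * z₂) (c * p₁) (c * p₂)
        (c * q₁) (c * q₂) ∈ L := by
  rw [← skewMat_smul]; exact L.smul_mem c h

theorem add_mem {a b w₁ w₂ z₁ z₂ p₁ p₂ q₁ q₂ a' b' w₁' w₂' z₁' z₂' p₁' p₂' q₁' q₂' : ℝ}
    (h : skewMat a b w₁ w₂ z₁ z₂ p₁ p₂ q₁ q₂ ∈ L)
    (h' : skewMat a' b' w₁' w₂' z₁' z₂' p₁' p₂' q₁' q₂' ∈ L) :
    skewMat (a + a') (b + b') (w₁ + w₁') (w₂ + w₂') (z₁ + z₁') (z₂ + z₂') (p₁ + p₁') (p₂ + p₂')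
        (q₁ + q₁') (q₂ + q₂') ∈ L := by
  rw [← skewMat_add]; exact L.add_mem h h'

/-- Bracketing with an element of the standard torus. -/
theorem torus_bracket_mem (hL : IsSkewLie L) {a b w₁ w₂ z₁ z₂ p₁ p₂ q₁ q₂ s t : ℝ}
    (ht : skewMat s t 0 0 0 0 0 0 0 0 ∈ L)
    (h : skewMat a b w₁ w₂ z₁ z₂ p₁ p₂ q₁ q₂ ∈ L) :
    skewMat 0 0 (-(s * w₂)) (s * w₁) (-(t * z₂)) (t * z₁) (-((s - t) * p₂)) ((s - t) * p₁)
      (-((s + t) * q₂)) ((s + t) * q₁) ∈ L := by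
  have := hL.bracket _ ht _ h
  rw [skewMat_bracket] at this
  convert this using 1
  congr 1 <;> ring

section RankTwo

variable (hL : IsSkewLie L) (h₁ : skewMat 1 0 0 0 0 0 0 0 0 0 ∈ L)
  (h₂ : skewMat 0 1 0 0 0 0 0 0 0 0 ∈ L)

include hL h₁ h₂

theorem torus_mem (a b : ℝ) : skewMat a b 0 0 0 0 0 0 0 0 ∈ L := by
  simpa using add_mem (smul_mem a h₁) (smul_mem b h₂)

theorem p_mem {a b w₁ w₂ z₁ z₂ p₁ p₂ q₁ q₂ : ℝ}
    (h : skewMat a b w₁ w₂ z₁ z₂ p₁ p₂ q₁ q₂ ∈ L) (hp : p₁ ≠ 0 ∨ p₂ ≠ 0) (x y : ℝ) :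
    skewMat 0 0 0 0 0 0 x y 0 0 ∈ L := by
  have e := hL.torus_bracket_mem h₁ (hL.torus_bracket_mem h₂ h)
  have e' := hL.torus_bracket_mem h₁ (hL.torus_bracket_mem h₂ e)
  have f : skewMat 0 0 0 0 0 0 p₁ p₂ 0 0 ∈ L := by
    have := smul_mem (1 / 2) (add_mem e e')
    simpa [← two_mul] using this
  have g := hL.torus_bracket_mem h₁ f
  have hn : p₁ ^ 2 + p₂ ^ 2 ≠ 0 := by
    rcases hp with hp | hp <;> positivity
  have := add_mem (smul_mem ((x * p₁ + y * p₂) / (p₁ ^ 2 + p₂ ^ 2)) f)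
    (smul_mem ((y * p₁ - x * p₂) / (p₁ ^ 2 + p₂ ^ 2)) g)
  simp only [mul_zero, add_zero, neg_zero, sub_zero, one_mul] at this
  convert this using 1
  congr 1 <;> field_simp <;> ring

theorem q_mem {a b w₁ w₂ z₁ z₂ p₁ p₂ q₁ q₂ : ℝ}
    (h : skewMat a b w₁ w₂ z₁ z₂ p₁ p₂ q₁ q₂ ∈ L) (hq : q₁ ≠ 0 ∨ q₂ ≠ 0) (x y : ℝ) :
    skewMat 0 0 0 0 0 0 0 0 x y ∈ L := by
  have e := hL.torus_bracket_mem h₁ (hL.torus_bracket_mem h₂ h)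
  have e' := hL.torus_bracket_mem h₁ (hL.torus_bracket_mem h₂ e)
  have f : skewMat 0 0 0 0 0 0 0 0 q₁ q₂ ∈ L := by
    have := smul_mem (1 / 2) (add_mem (smul_mem (-1) e) e')
    simpa [← two_mul] using this
  have g := hL.torus_bracket_mem h₁ f
  have hn : q₁ ^ 2 + q₂ ^ 2 ≠ 0 := by
    rcases hq with hq | hq <;> positivity
  have := add_mem (smul_mem ((x * q₁ + y * q₂) / (q₁ ^ 2 + q₂ ^ 2)) f)
    (smul_mem ((y * q₁ - x * q₂) / (q₁ ^ 2 + q₂ ^ 2)) g)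
  simp only [mul_zero, add_zero, neg_zero, one_mul] at this
  convert this using 1
  congr 1 <;> field_simp <;> ring

theorem w_mem {a b w₁ w₂ z₁ z₂ p₁ p₂ q₁ q₂ : ℝ}
    (h : skewMat a b w₁ w₂ z₁ z₂ p₁ p₂ q₁ q₂ ∈ L) (hw : w₁ ≠ 0 ∨ w₂ ≠ 0) (x y : ℝ) :
    skewMat 0 0 x y 0 0 0 0 0 0 ∈ L := by
  have e := hL.torus_bracket_mem h₁ (hL.torus_bracket_mem h₁ h)
  have e' := hL.torus_bracket_mem h₂ (hL.torus_bracket_mem h₂ e)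
  have f : skewMat 0 0 w₁ w₂ 0 0 0 0 0 0 ∈ L := by
    have := smul_mem (-1) (add_mem e e')
    simpa using this
  have g := hL.torus_bracket_mem h₁ f
  have hn : w₁ ^ 2 + w₂ ^ 2 ≠ 0 := by
    rcases hw with hw | hw <;> positivity
  have := add_mem (smul_mem ((x * w₁ + y * w₂) / (w₁ ^ 2 + w₂ ^ 2)) f)
    (smul_mem ((y * w₁ - x * w₂) / (w₁ ^ 2 + w₂ ^ 2)) g)
  simp only [mul_zero, add_zero, neg_zero, one_mul] at this
  convert this using 1
  congr 1 <;> field_simp <;> ring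

theorem z_mem {a b w₁ w₂ z₁ z₂ p₁ p₂ q₁ q₂ : ℝ}
    (h : skewMat a b w₁ w₂ z₁ z₂ p₁ p₂ q₁ q₂ ∈ L) (hz : z₁ ≠ 0 ∨ z₂ ≠ 0) (x y : ℝ) :
    skewMat 0 0 0 0 x y 0 0 0 0 ∈ L := by
  have e := hL.torus_bracket_mem h₂ (hL.torus_bracket_mem h₂ h)
  have e' := hL.torus_bracket_mem h₁ (hL.torus_bracket_mem h₁ e)
  have f : skewMat 0 0 0 0 z₁ z₂ 0 0 0 0 ∈ L := by
    have := smul_mem (-1) (add_mem e e')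
    simpa using this
  have g := hL.torus_bracket_mem h₂ f
  have hn : z₁ ^ 2 + z₂ ^ 2 ≠ 0 := by
    rcases hz with hz | hz <;> positivity
  have := add_mem (smul_mem ((x * z₁ + y * z₂) / (z₁ ^ 2 + z₂ ^ 2)) f)
    (smul_mem ((y * z₁ - x * z₂) / (z₁ ^ 2 + z₂ ^ 2)) g)
  simp only [mul_zero, add_zero, neg_zero, one_mul] at this
  convert this using 1
  congr 1 <;> field_simp <;> ring

theorem skewMat_mem_of_w_z (hw : skewMat 0 0 1 0 0 0 0 0 0 0 ∈ L)
    (hz : skewMat 0 0 0 0 1 0 0 0 0 0 ∈ L) (a b w₁ w₂ z₁ z₂ p₁ p₂ q₁ q₂ : ℝ) :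
    skewMat a b w₁ w₂ z₁ z₂ p₁ p₂ q₁ q₂ ∈ L := by
  have h := hL.bracket _ hw _ hz
  rw [skewMat_bracket] at h
  have hp := hL.p_mem h₁ h₂ h (Or.inl (by norm_num)) p₁ p₂
  have hq := hL.q_mem h₁ h₂ h (Or.inl (by norm_num)) q₁ q₂
  have hw := hL.w_mem h₁ h₂ hw (Or.inl (by norm_num)) w₁ w₂
  have hz := hL.z_mem h₁ h₂ hz (Or.inl (by norm_num)) z₁ z₂
  simpa using add_mem (add_mem (add_mem (add_mem hp hq) hw) hz) (hL.torus_mem h₁ h₂ a b)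

/-- The Lie algebras of skew-symmetric matrices containing the standard torus. -/
theorem rank_two_classification :
    (∀ X ∈ L, ∃ a b, X = skewMat a b 0 0 0 0 0 0 0 0) ∨
    (skewMat 0 0 1 0 0 0 0 0 0 0 ∈ L ∧
      ∀ X ∈ L, ∃ a b w₁ w₂, X = skewMat a b w₁ w₂ 0 0 0 0 0 0) ∨
    (skewMat 0 0 0 0 1 0 0 0 0 0 ∈ L ∧
      ∀ X ∈ L, ∃ a b z₁ z₂, X = skewMat a b 0 0 z₁ z₂ 0 0 0 0) ∨
    (skewMat 0 0 0 0 0 0 1 0 0 0 ∈ L ∧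
      ∀ X ∈ L, ∃ a b p₁ p₂, X = skewMat a b 0 0 0 0 p₁ p₂ 0 0) ∨
    (skewMat 0 0 0 0 0 0 0 0 1 0 ∈ L ∧
      ∀ X ∈ L, ∃ a b q₁ q₂, X = skewMat a b 0 0 0 0 0 0 q₁ q₂) ∨
    (skewMat 0 0 0 0 0 0 1 0 0 0 ∈ L ∧ skewMat 0 0 0 0 0 0 0 0 1 0 ∈ L ∧
      ∀ X ∈ L, ∃ a b p₁ p₂ q₁ q₂, X = skewMat a b 0 0 0 0 p₁ p₂ q₁ q₂) ∨
    ∀ a b w₁ w₂ z₁ z₂ p₁ p₂ q₁ q₂, skewMat a b w₁ w₂ z₁ z₂ p₁ p₂ q₁ q₂ ∈ L := by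
  have hw : skewMat 0 0 1 0 0 0 0 0 0 0 ∈ L ∨ ∀ a b w₁ w₂ z₁ z₂ p₁ p₂ q₁ q₂,
      skewMat a b w₁ w₂ z₁ z₂ p₁ p₂ q₁ q₂ ∈ L → w₁ = 0 ∧ w₂ = 0 := by
    by_contra! hc
    obtain ⟨hc, a, b, w₁, w₂, z₁, z₂, p₁, p₂, q₁, q₂, h, hne⟩ := hc
    exact hc (hL.w_mem h₁ h₂ h (by tauto) 1 0)
  have hz : skewMat 0 0 0 0 1 0 0 0 0 0 ∈ L ∨ ∀ a b w₁ w₂ z₁ z₂ p₁ p₂ q₁ q₂,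
      skewMat a b w₁ w₂ z₁ z₂ p₁ p₂ q₁ q₂ ∈ L → z₁ = 0 ∧ z₂ = 0 := by
    by_contra! hc
    obtain ⟨hc, a, b, w₁, w₂, z₁, z₂, p₁, p₂, q₁, q₂, h, hne⟩ := hc
    exact hc (hL.z_mem h₁ h₂ h (by tauto) 1 0)
  have hp : skewMat 0 0 0 0 0 0 1 0 0 0 ∈ L ∨ ∀ a b w₁ w₂ z₁ z₂ p₁ p₂ q₁ q₂,
      skewMat a b w₁ w₂ z₁ z₂ p₁ p₂ q₁ q₂ ∈ L → p₁ = 0 ∧ p₂ = 0 := by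
    by_contra! hc
    obtain ⟨hc, a, b, w₁, w₂, z₁, z₂, p₁, p₂, q₁, q₂, h, hne⟩ := hc
    exact hc (hL.p_mem h₁ h₂ h (by tauto) 1 0)
  have hq : skewMat 0 0 0 0 0 0 0 0 1 0 ∈ L ∨ ∀ a b w₁ w₂ z₁ z₂ p₁ p₂ q₁ q₂,
      skewMat a b w₁ w₂ z₁ z₂ p₁ p₂ q₁ q₂ ∈ L → q₁ = 0 ∧ q₂ = 0 := by
    by_contra! hc
    obtain ⟨hc, a, b, w₁, w₂, z₁, z₂, p₁, p₂, q₁, q₂, h, hne⟩ := hc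
    exact hc (hL.q_mem h₁ h₂ h (by tauto) 1 0)
  have full : skewMat 0 0 1 0 0 0 0 0 0 0 ∈ L → skewMat 0 0 0 0 1 0 0 0 0 0 ∈ L →
      ∀ a b w₁ w₂ z₁ z₂ p₁ p₂ q₁ q₂, skewMat a b w₁ w₂ z₁ z₂ p₁ p₂ q₁ q₂ ∈ L :=
    fun hw hz => hL.skewMat_mem_of_w_z h₁ h₂ hw hz
  have wp : skewMat 0 0 1 0 0 0 0 0 0 0 ∈ L → skewMat 0 0 0 0 0 0 1 0 0 0 ∈ L →
      skewMat 0 0 0 0 1 0 0 0 0 0 ∈ L := fun hw hp => by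
    have h := hL.bracket _ hw _ hp
    rw [skewMat_bracket] at h
    exact hL.z_mem h₁ h₂ h (Or.inl (by norm_num)) 1 0
  have wq : skewMat 0 0 1 0 0 0 0 0 0 0 ∈ L → skewMat 0 0 0 0 0 0 0 0 1 0 ∈ L →
      skewMat 0 0 0 0 1 0 0 0 0 0 ∈ L := fun hw hp => by
    have h := hL.bracket _ hw _ hp
    rw [skewMat_bracket] at h
    exact hL.z_mem h₁ h₂ h (Or.inl (by norm_num)) 1 0
  have zp : skewMat 0 0 0 0 1 0 0 0 0 0 ∈ L → skewMat 0 0 0 0 0 0 1 0 0 0 ∈ L →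
      skewMat 0 0 1 0 0 0 0 0 0 0 ∈ L := fun hw hp => by
    have h := hL.bracket _ hw _ hp
    rw [skewMat_bracket] at h
    exact hL.w_mem h₁ h₂ h (Or.inl (by norm_num)) 1 0
  have zq : skewMat 0 0 0 0 1 0 0 0 0 0 ∈ L → skewMat 0 0 0 0 0 0 0 0 1 0 ∈ L →
      skewMat 0 0 1 0 0 0 0 0 0 0 ∈ L := fun hw hp => by
    have h := hL.bracket _ hw _ hp
    rw [skewMat_bracket] at h
    exact hL.w_mem h₁ h₂ h (Or.inl (by norm_num)) 1 0
  rcases hw with hw | hw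
  · by_cases hz' : skewMat 0 0 0 0 1 0 0 0 0 0 ∈ L
    · exact .inr <| .inr <| .inr <| .inr <| .inr <| .inr <| full hw hz'
    · have hz := hz.resolve_left hz'
      have hp := hp.resolve_left fun h => hz' (wp hw h)
      have hq := hq.resolve_left fun h => hz' (wq hw h)
      refine .inr <| .inl ⟨hw, fun X hX => ?_⟩
      obtain ⟨a, b, w₁, w₂, z₁, z₂, p₁, p₂, q₁, q₂, rfl⟩ := exists_skewMat (hL.skew X hX)
      obtain ⟨rfl, rfl⟩ := hz _ _ _ _ _ _ _ _ _ _ hX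
      obtain ⟨rfl, rfl⟩ := hp _ _ _ _ _ _ _ _ _ _ hX
      obtain ⟨rfl, rfl⟩ := hq _ _ _ _ _ _ _ _ _ _ hX
      exact ⟨_, _, _, _, rfl⟩
  rcases hz with hz | hz
  · have hw' : skewMat 0 0 1 0 0 0 0 0 0 0 ∉ L := fun h =>
      one_ne_zero (hw _ _ _ _ _ _ _ _ _ _ h).1
    have hp := hp.resolve_left fun h => hw' (zp hz h)
    have hq := hq.resolve_left fun h => hw' (zq hz h)
    refine .inr <| .inr <| .inl ⟨hz, fun X hX => ?_⟩
    obtain ⟨a, b, w₁, w₂, z₁, z₂, p₁, p₂, q₁, q₂, rfl⟩ := exists_skewMat (hL.skew X hX)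
    obtain ⟨rfl, rfl⟩ := hw _ _ _ _ _ _ _ _ _ _ hX
    obtain ⟨rfl, rfl⟩ := hp _ _ _ _ _ _ _ _ _ _ hX
    obtain ⟨rfl, rfl⟩ := hq _ _ _ _ _ _ _ _ _ _ hX
    exact ⟨_, _, _, _, rfl⟩
  have hX' : ∀ X ∈ L, ∃ a b p₁ p₂ q₁ q₂, X = skewMat a b 0 0 0 0 p₁ p₂ q₁ q₂ := fun X hX => by
    obtain ⟨a, b, w₁, w₂, z₁, z₂, p₁, p₂, q₁, q₂, rfl⟩ := exists_skewMat (hL.skew X hX)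
    obtain ⟨rfl, rfl⟩ := hw _ _ _ _ _ _ _ _ _ _ hX
    obtain ⟨rfl, rfl⟩ := hz _ _ _ _ _ _ _ _ _ _ hX
    exact ⟨_, _, _, _, _, _, rfl⟩
  rcases hp with hp | hp <;> rcases hq with hq | hq
  · exact .inr <| .inr <| .inr <| .inr <| .inr <| .inl ⟨hp, hq, hX'⟩
  · refine .inr <| .inr <| .inr <| .inl ⟨hp, fun X hX => ?_⟩
    obtain ⟨a, b, p₁, p₂, q₁, q₂, rfl⟩ := hX' X hX
    obtain ⟨rfl, rfl⟩ := hq _ _ _ _ _ _ _ _ _ _ hX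
    exact ⟨_, _, _, _, rfl⟩
  · refine .inr <| .inr <| .inr <| .inr <| .inl ⟨hq, fun X hX => ?_⟩
    obtain ⟨a, b, p₁, p₂, q₁, q₂, rfl⟩ := hX' X hX
    obtain ⟨rfl, rfl⟩ := hp _ _ _ _ _ _ _ _ _ _ hX
    exact ⟨_, _, _, _, rfl⟩
  · refine .inl fun X hX => ?_
    obtain ⟨a, b, p₁, p₂, q₁, q₂, rfl⟩ := hX' X hX
    obtain ⟨rfl, rfl⟩ := hp _ _ _ _ _ _ _ _ _ _ hX
    obtain ⟨rfl, rfl⟩ := hq _ _ _ _ _ _ _ _ _ _ hX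
    exact ⟨_, _, rfl⟩

end RankTwo

end IsSkewLie

end SkewMatrices

section CompactMatrixGroups

open Topology

theorem isCompact_unitaryGroup (n : ℕ) (𝕜 : Type) [RCLike 𝕜] :
    IsCompact (Matrix.unitaryGroup (Fin n) 𝕜 : Set (Matrix (Fin n) (Fin n) 𝕜)) := by
  have h : IsCompact (Set.univ.pi fun _ => Set.univ.pi fun _ => Metric.closedBall 0 1 :
      Set (Matrix (Fin n) (Fin n) 𝕜)) :=
    isCompact_univ_pi fun _ => isCompact_univ_pi fun _ => isCompact_closedBall _ _
  refine h.of_isClosed_subset ?_ fun U hU i _ j _ => ?_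
  · have : (Matrix.unitaryGroup (Fin n) 𝕜 : Set (Matrix (Fin n) (Fin n) 𝕜)) =
        {A | A * star A = 1} := by
      ext A; exact Matrix.mem_unitaryGroup_iff
    rw [this]
    exact isClosed_eq (by fun_prop) continuous_const
  · simpa using entry_norm_bound_of_unitary hU i j

theorem isClosed_SUgrp (n : ℕ) (𝕜 : Type) [RCLike 𝕜] :
    IsClosed (SUgrp n 𝕜 : Set (Matrix.unitaryGroup (Fin n) 𝕜)) := by
  have : (SUgrp n 𝕜 : Set (Matrix.unitaryGroup (Fin n) 𝕜)) =
      {A : Matrix.unitaryGroup (Fin n) 𝕜 | (A : Matrix (Fin n) (Fin n) 𝕜).det = 1} := rfl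
  rw [this]
  exact isClosed_eq (by fun_prop) continuous_const

instance compactSpace_SUgrp (n : ℕ) (𝕜 : Type) [RCLike 𝕜] : CompactSpace (SUgrp n 𝕜) := by
  have _ : CompactSpace (Matrix.unitaryGroup (Fin n) 𝕜) :=
    isCompact_iff_compactSpace.1 (isCompact_unitaryGroup n 𝕜)
  exact isCompact_iff_compactSpace.1 (isClosed_SUgrp n 𝕜).isCompact

end CompactMatrixGroups

section SU2

open ComplexConjugate

/-- The element of `SU(2)` with first row `(z, w)`. -/
def suMk (z w : ℂ) (h : z * conj z + w * conj w = 1) : SUgrp 2 ℂ :=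
  ⟨⟨!![z, w; -conj w, conj z], by
    rw [Matrix.mem_unitaryGroup_iff]
    ext i j
    fin_cases i <;> fin_cases j <;>
      simp [Matrix.mul_apply, Fin.sum_univ_two, Matrix.star_apply] <;>
      first | linear_combination h | ring⟩, by
    change Matrix.det _ = 1
    rw [Matrix.det_fin_two_of]; linear_combination h⟩

/-- The top left entry of an element of `SU(2)`. -/
def suZ (s : SUgrp 2 ℂ) : ℂ := s.1.1 0 0

/-- The top right entry of an element of `SU(2)`. -/
def suW (s : SUgrp 2 ℂ) : ℂ := s.1.1 0 1

@[fun_prop] theorem continuous_suZ : Continuous suZ :=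
  (continuous_subtype_val.comp continuous_subtype_val).matrix_elem 0 0

@[fun_prop] theorem continuous_suW : Continuous suW :=
  (continuous_subtype_val.comp continuous_subtype_val).matrix_elem 0 1

theorem su_eq (s : SUgrp 2 ℂ) : s.1.1 1 0 = -conj (suW s) ∧ s.1.1 1 1 = conj (suZ s) ∧
    suZ s * conj (suZ s) + suW s * conj (suW s) = 1 := by
  have h1 := Matrix.mem_unitaryGroup_iff.1 s.1.2
  have hd : s.1.1.det = 1 := s.2
  rw [Matrix.det_fin_two] at hd
  have e : ∀ i j, _ := fun i j => congrFun (congrFun h1 i) j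
  have e00 := e 0 0
  have e01 := e 0 1
  have e11 := e 1 1
  have e10 := e 1 0
  simp [Matrix.mul_apply, Fin.sum_univ_two, Matrix.star_apply] at e00 e01 e11 e10
  unfold suZ suW
  generalize s.1.1 0 0 = z at *
  generalize s.1.1 0 1 = w at *
  generalize s.1.1 1 0 = u at *
  generalize s.1.1 1 1 = v at *
  refine ⟨?_, ?_, e00⟩
  · linear_combination (-conj w) * hd + v * (e00 - 1 * e00) - u * e00 + z * e10 - 0 * e01
  · linear_combination conj z * hd - v * e00 + w * e10

theorem su_ext {s t : SUgrp 2 ℂ} (hz : suZ s = suZ t) (hw : suW s = suW t) : s = t := by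
  apply Subtype.ext
  apply Subtype.ext
  have hs := su_eq s
  have ht := su_eq t
  rw [Matrix.eta_fin_two s.1.1, Matrix.eta_fin_two t.1.1, hs.1, hs.2.1, ht.1, ht.2.1]
  change !![suZ s, suW s; _, _] = !![suZ t, suW t; _, _]
  rw [hz, hw]

@[simp] theorem suZ_mk (z w : ℂ) (h) : suZ (suMk z w h) = z := rfl

@[simp] theorem suW_mk (z w : ℂ) (h) : suW (suMk z w h) = w := rfl

@[simp] theorem suZ_one : suZ 1 = 1 := rfl

@[simp] theorem suW_one : suW 1 = 0 := rfl

theorem suZ_mul (s t : SUgrp 2 ℂ) : suZ (s * t) = suZ s * suZ t - suW s * conj (suW t) := by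
  have : suZ (s * t) = suZ s * suZ t + suW s * t.1.1 1 0 := by
    simp [suZ, suW, Matrix.mul_apply, Fin.sum_univ_two]
  rw [this, (su_eq t).1]; ring

theorem suW_mul (s t : SUgrp 2 ℂ) : suW (s * t) = suZ s * suW t + suW s * conj (suZ t) := by
  have : suW (s * t) = suZ s * suW t + suW s * t.1.1 1 1 := by
    simp [suZ, suW, Matrix.mul_apply, Fin.sum_univ_two]
  rw [this, (su_eq t).2.1]

theorem su_sq (s : SUgrp 2 ℂ) :
    (suZ s).re ^ 2 + (suZ s).im ^ 2 + (suW s).re ^ 2 + (suW s).im ^ 2 = 1 := by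
  have := congrArg Complex.re (su_eq s).2.2
  simp at this
  linear_combination this

theorem finite_su {F : Set ℂ} (hF : F.Finite) : {s : SUgrp 2 ℂ | suZ s ∈ F ∧ suW s = 0}.Finite := by
  refine Set.Finite.of_finite_image (f := suZ) (hF.subset ?_) ?_
  · rintro _ ⟨s, hs, rfl⟩; exact hs.1
  · intro s hs t ht h
    exact su_ext h (hs.2.trans ht.2.symm)

/-- The diagonal one-parameter subgroup of `SU(2)`. -/
noncomputable def suD (t : ℝ) : SUgrp 2 ℂ :=
  suMk ⟨Real.cos t, Real.sin t⟩ 0 (by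
    apply Complex.ext <;> simp <;> nlinarith [Real.sin_sq_add_cos_sq t])

/-- The real one-parameter subgroup of `SU(2)`. -/
noncomputable def suR (t : ℝ) : SUgrp 2 ℂ :=
  suMk ⟨Real.cos t, 0⟩ ⟨Real.sin t, 0⟩ (by
    apply Complex.ext <;> simp; nlinarith [Real.sin_sq_add_cos_sq t])

theorem suD_zero : suD 0 = 1 := su_ext (by simp [suD, Complex.ext_iff]) (by simp [suD])

theorem suR_zero : suR 0 = 1 := su_ext
  (by simp [suR, Complex.ext_iff]) (by simp [suR, Complex.ext_iff])

theorem suD_add (s t : ℝ) : suD (s + t) = suD s * suD t := by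
  apply su_ext
  · simp [suZ_mul, suD, Complex.ext_iff, Real.cos_add, Real.sin_add]; ring
  · simp [suW_mul, suD]

theorem suR_add (s t : ℝ) : suR (s + t) = suR s * suR t := by
  apply su_ext
  · simp [suZ_mul, suR, Complex.ext_iff, Real.cos_add]
  · simp [suW_mul, suR, Complex.ext_iff, Real.sin_add]; ring

theorem exists_suD_suR (s : SUgrp 2 ℂ) : ∃ α β γ, s = suD α * suR β * suD γ := by
  obtain ⟨β, hβ⟩ : ∃ β : ℝ, ‖suZ s‖ = Real.cos β ∧ ‖suW s‖ = Real.sin β := by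
    refine ⟨Real.arcsin ‖suW s‖, ?_, (Real.sin_arcsin ?_ ?_).symm⟩
    · rw [Real.cos_arcsin, ← Real.sqrt_sq (norm_nonneg (suZ s))]
      congr 1
      rw [← Complex.normSq_eq_norm_sq, ← Complex.normSq_eq_norm_sq, Complex.normSq_apply,
        Complex.normSq_apply]
      linear_combination su_sq s
    · linarith [norm_nonneg (suW s)]
    · rw [← abs_of_nonneg (norm_nonneg (suW s)), ← sq_le_one_iff_abs_le_one,
        ← Complex.normSq_eq_norm_sq, Complex.normSq_apply]
      nlinarith [su_sq s]
  set x := Complex.arg (suZ s)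
  set y := Complex.arg (suW s)
  have hz : suZ s = ⟨Real.cos β * Real.cos x, Real.cos β * Real.sin x⟩ := by
    rw [← hβ.1]
    apply Complex.ext <;> simp [x, Complex.norm_mul_cos_arg, Complex.norm_mul_sin_arg]
  have hw : suW s = ⟨Real.sin β * Real.cos y, Real.sin β * Real.sin y⟩ := by
    rw [← hβ.2]
    apply Complex.ext <;> simp [y, Complex.norm_mul_cos_arg, Complex.norm_mul_sin_arg]
  refine ⟨(x + y) / 2, β, (x - y) / 2, ?_⟩
  have ex : x = (x + y) / 2 + (x - y) / 2 := by ring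
  have ey : y = (x + y) / 2 - (x - y) / 2 := by ring
  apply su_ext
  · rw [hz, ex]
    simp [suZ_mul, suW_mul, suD, suR, Complex.ext_iff, Real.cos_add, Real.sin_add]
    constructor <;> ring_nf
  · rw [hw, ey]
    simp [suZ_mul, suW_mul, suD, suR, Complex.ext_iff, Real.cos_sub, Real.sin_sub]
    constructor <;> ring_nf

end SU2

section Covers

open scoped Matrix.Norms.Operator
open NormedSpace (exp)

/-- A continuous homomorphism with finite kernel from `P` to matrices, with range `S`. -/
def MapsOnto (P : Type) [Group P] [TopologicalSpace P]
    (S : Submonoid (Matrix (Fin 5) (Fin 5) ℝ)) : Prop :=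
  ∃ f : P →* Matrix (Fin 5) (Fin 5) ℝ, Continuous f ∧ (Set.range f = S) ∧ {p | f p = 1}.Finite

/-- `S` is the image of one of the six model groups. -/
def IsModelImage (S : Submonoid (Matrix (Fin 5) (Fin 5) ℝ)) : Prop :=
  MapsOnto PUnit S ∨ MapsOnto Circle S ∨ MapsOnto (SUgrp 2 ℂ) S ∨ MapsOnto (Circle × Circle) S ∨
    MapsOnto (Circle × SUgrp 2 ℂ) S ∨ MapsOnto (SUgrp 2 ℂ × SUgrp 2 ℂ) S

/-- The family of one-parameter subgroups `γ` generates `P`. -/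
def Generates {P : Type} [Monoid P] {ι : Type} (γ : ι → ℝ → P) : Prop :=
  ∀ T : Submonoid P, (∀ i t, γ i t ∈ T) → ∀ p, p ∈ T

/-- `f` maps the one-parameter subgroups `γ` to those generated by `E`. -/
def HasVelocity {P : Type} {ι : Type} (f : P → Matrix (Fin 5) (Fin 5) ℝ) (γ : ι → ℝ → P)
    (E : ι → Matrix (Fin 5) (Fin 5) ℝ) : Prop :=
  ∀ i t, f (γ i t) = exp (t • E i)

theorem mapsOnto_of_generates {P : Type} [Group P] [TopologicalSpace P] [CompactSpace P]
    {S : Submonoid (Matrix (Fin 5) (Fin 5) ℝ)} (hS : IsCompactGrp S)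
    (hconn : IsPreconnected (S : Set (Matrix (Fin 5) (Fin 5) ℝ)))
    (f : P →* Matrix (Fin 5) (Fin 5) ℝ) (hf : Continuous f) (hker : {p | f p = 1}.Finite)
    {ι : Type} {γ : ι → ℝ → P} {E : ι → Matrix (Fin 5) (Fin 5) ℝ} (hγ : HasVelocity f γ E)
    (hgen : Generates γ) (hE : ∀ i, E i ∈ lieAlg hS)
    (hL : ∀ L : Submodule ℝ (Matrix (Fin 5) (Fin 5) ℝ), (∀ i, E i ∈ L) →
      (∀ X ∈ L, ∀ Y ∈ L, X * Y - Y * X ∈ L) → lieAlg hS ≤ L) : MapsOnto P S := by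
  refine ⟨f, hf, ?_, hker⟩
  have hH : IsCompactGrp (MonoidHom.mrange f) := by
    refine ⟨?_, ?_⟩
    · rw [MonoidHom.coe_mrange]; exact isCompact_range hf
    · rintro _ ⟨p, rfl⟩
      exact ⟨f p⁻¹, ⟨p⁻¹, rfl⟩, by simp [← map_mul], by simp [← map_mul]⟩
  have hle : MonoidHom.mrange f ≤ S := by
    rintro _ ⟨p, rfl⟩
    refine hgen (S.comap f) (fun i t => ?_) p
    rw [Submonoid.mem_comap, hγ i t]
    exact hE i t
  have hge : S ≤ MonoidHom.mrange f := by
    refine hS.le_of_exp_mem hH hconn (fun X hX => ?_) hle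
    refine hL (lieAlg hH) (fun i t => ?_) (fun X hX Y hY => commutator_mem_lieAlg hH hX hY) hX
    exact ⟨_, hγ i t⟩
  rw [← MonoidHom.coe_mrange, le_antisymm hle hge]

theorem Generates.prod {P Q : Type} [Monoid P] [Monoid Q] {ι κ : Type} {γ : ι → ℝ → P}
    {δ : κ → ℝ → Q} (hγ : Generates γ) (hδ : Generates δ) :
    Generates (P := P × Q) (Sum.elim (fun i t => (γ i t, 1)) (fun i t => (1, δ i t))) := by
  intro T hT p
  have h1 := hγ (T.comap (MonoidHom.inl P Q)) (fun i t => hT (Sum.inl i) t) p.1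
  have h2 := hδ (T.comap (MonoidHom.inr P Q)) (fun i t => hT (Sum.inr i) t) p.2
  simpa using T.mul_mem h1 h2

theorem HasVelocity.prod {P Q : Type} [Monoid P] [Monoid Q] {ι κ : Type} {γ : ι → ℝ → P}
    {δ : κ → ℝ → Q} {E : ι → Matrix (Fin 5) (Fin 5) ℝ} {F : κ → Matrix (Fin 5) (Fin 5) ℝ}
    {f : P →* Matrix (Fin 5) (Fin 5) ℝ} {g : Q →* Matrix (Fin 5) (Fin 5) ℝ}
    (hf : HasVelocity f γ E) (hg : HasVelocity g δ F) (hc : ∀ p q, Commute (f p) (g q)) :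
    HasVelocity (f.noncommCoprod g hc)
      (Sum.elim (fun i t => (γ i t, 1)) (fun i t => (1, δ i t))) (Sum.elim E F) := by
  rintro (i | i) t
  · simpa using hf i t
  · simpa using hg i t

theorem continuous_noncommCoprod {P Q : Type} [Group P] [Group Q] [TopologicalSpace P]
    [TopologicalSpace Q] {f : P →* Matrix (Fin 5) (Fin 5) ℝ} {g : Q →* Matrix (Fin 5) (Fin 5) ℝ}
    (hf : Continuous f) (hg : Continuous g) (hc : ∀ p q, Commute (f p) (g q)) :
    Continuous (f.noncommCoprod g hc) := by
  change Continuous fun x : P × Q => f x.1 * g x.2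
  fun_prop

theorem generates_circle : Generates (fun (_ : Unit) t => Circle.exp t) := by
  intro T hT p
  obtain ⟨t, rfl⟩ := Circle.exp_surjective p
  exact hT () t

theorem generates_su : Generates (fun b : Bool => bif b then suR else suD) := by
  intro T hT p
  obtain ⟨α, β, γ, rfl⟩ := exists_suD_suR p
  exact T.mul_mem (T.mul_mem (hT false _) (hT true _)) (hT false _)

theorem hasVelocity_circle {f : Circle →* Matrix (Fin 5) (Fin 5) ℝ}
    {E : Matrix (Fin 5) (Fin 5) ℝ}
    (h : HasDerivAt (fun t : ℝ => f (Circle.exp t)) E 0) :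
    HasVelocity f (fun (_ : Unit) t => Circle.exp t) (fun _ => E) := fun _ t =>
  oneParam_eq_exp (γ := fun t => f (Circle.exp t)) (by simp) (by simp) h t

theorem hasVelocity_su {f : SUgrp 2 ℂ →* Matrix (Fin 5) (Fin 5) ℝ}
    {E F : Matrix (Fin 5) (Fin 5) ℝ} (hE : HasDerivAt (fun t => f (suD t)) E 0)
    (hF : HasDerivAt (fun t => f (suR t)) F 0) :
    HasVelocity f (fun b : Bool => bif b then suR else suD) (fun b => bif b then F else E) := by
  rintro (_ | _) t
  · exact oneParam_eq_exp (γ := fun t => f (suD t)) (by simp [suD_zero])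
      (by simp [suD_add]) hE t
  · exact oneParam_eq_exp (γ := fun t => f (suR t)) (by simp [suR_zero])
      (by simp [suR_add]) hF t

/-- A homomorphism out of `SU(2)` given by a function of the first row. -/
def suHom (G : ℝ → ℝ → ℝ → ℝ → Matrix (Fin 5) (Fin 5) ℝ) (h1 : G 1 0 0 0 = 1)
    (hmul : ∀ a b c d a' b' c' d', G a b c d * G a' b' c' d' =
      G (a * a' - b * b' - c * c' - d * d') (a * b' + b * a' - d * c' + c * d')
        (a * c' - b * d' + c * a' + d * b') (a * d' + b * c' + d * a' - c * b')) :
    SUgrp 2 ℂ →* Matrix (Fin 5) (Fin 5) ℝ where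
  toFun s := G (suZ s).re (suZ s).im (suW s).re (suW s).im
  map_one' := by simpa using h1
  map_mul' s t := by
    rw [suZ_mul, suW_mul, hmul]
    congr 1 <;> simp <;> ring

theorem suHom_apply {G : ℝ → ℝ → ℝ → ℝ → Matrix (Fin 5) (Fin 5) ℝ} (h1) (hmul) (s : SUgrp 2 ℂ) :
    suHom G h1 hmul s = G (suZ s).re (suZ s).im (suW s).re (suW s).im := rfl

theorem hasVelocity_suHom {G : ℝ → ℝ → ℝ → ℝ → Matrix (Fin 5) (Fin 5) ℝ} {h1} {hmul}
    {E F : Matrix (Fin 5) (Fin 5) ℝ}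
    (hE : ∀ i j, HasDerivAt (fun t => G (Real.cos t) (Real.sin t) 0 0 i j) (E i j) 0)
    (hF : ∀ i j, HasDerivAt (fun t => G (Real.cos t) 0 (Real.sin t) 0 i j) (F i j) 0) :
    HasVelocity (suHom G h1 hmul) (fun b : Bool => bif b then suR else suD)
      (fun b => bif b then F else E) :=
  hasVelocity_su (hasDerivAt_pi.2 fun i => hasDerivAt_pi.2 fun j => hE i j)
    (hasDerivAt_pi.2 fun i => hasDerivAt_pi.2 fun j => hF i j)

theorem continuous_suHom {G : ℝ → ℝ → ℝ → ℝ → Matrix (Fin 5) (Fin 5) ℝ} {h1} {hmul}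
    (h : ∀ i j, Continuous fun x : ℝ × ℝ × ℝ × ℝ => G x.1 x.2.1 x.2.2.1 x.2.2.2 i j) :
    Continuous (suHom G h1 hmul) := by
  refine continuous_matrix fun i j => ?_
  have : Continuous fun s : SUgrp 2 ℂ => ((suZ s).re, (suZ s).im, (suW s).re, (suW s).im) := by
    fun_prop
  exact (h i j).comp this

end Covers

section ModelHoms

open scoped Matrix.Norms.Operator

def quatQ (a b c d : ℝ) : Matrix (Fin 5) (Fin 5) ℝ :=
  !![a, -b, c, d, 0;
     b, a, d, -c, 0;
     -c, -d, a, -b, 0;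
     -d, c, b, a, 0;
     0, 0, 0, 0, 1]

def quatP (a b c d : ℝ) : Matrix (Fin 5) (Fin 5) ℝ :=
  !![a, -b, c, -d, 0;
     b, a, d, c, 0;
     -c, -d, a, b, 0;
     d, -c, -b, a, 0;
     0, 0, 0, 0, 1]

def quatW (a b c d : ℝ) : Matrix (Fin 5) (Fin 5) ℝ :=
  !![a ^ 2 - b ^ 2 + c ^ 2 - d ^ 2, -2 * a * b + 2 * c * d, 0, 0, 2 * (a * d + b * c);
     2 * a * b + 2 * c * d, a ^ 2 - b ^ 2 - c ^ 2 + d ^ 2, 0, 0, -2 * (a * c - b * d);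
     0, 0, 1, 0, 0;
     0, 0, 0, 1, 0;
     2 * (b * c - a * d), 2 * (a * c + b * d), 0, 0, a ^ 2 + b ^ 2 - c ^ 2 - d ^ 2]

set_option maxHeartbeats 2000000 in
theorem quatQ_mul (a b c d a' b' c' d' : ℝ) : quatQ a b c d * quatQ a' b' c' d' =
      quatQ (a * a' - b * b' - c * c' - d * d') (a * b' + b * a' - d * c' + c * d')
        (a * c' - b * d' + c * a' + d * b') (a * d' + b * c' + d * a' - c * b') := by
  ext i j
  fin_cases i <;> fin_cases j <;> simp [quatQ] <;> ring

set_option maxHeartbeats 2000000 in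
theorem quatP_mul (a b c d a' b' c' d' : ℝ) : quatP a b c d * quatP a' b' c' d' =
      quatP (a * a' - b * b' - c * c' - d * d') (a * b' + b * a' - d * c' + c * d')
        (a * c' - b * d' + c * a' + d * b') (a * d' + b * c' + d * a' - c * b') := by
  ext i j
  fin_cases i <;> fin_cases j <;> simp [quatP] <;> ring

set_option maxHeartbeats 2000000 in
theorem quatW_mul (a b c d a' b' c' d' : ℝ) : quatW a b c d * quatW a' b' c' d' =
      quatW (a * a' - b * b' - c * c' - d * d') (a * b' + b * a' - d * c' + c * d')
        (a * c' - b * d' + c * a' + d * b') (a * d' + b * c' + d * a' - c * b') := by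
  ext i j
  fin_cases i <;> fin_cases j <;> simp [quatW] <;> ring

def homQ : SUgrp 2 ℂ →* Matrix (Fin 5) (Fin 5) ℝ :=
  suHom quatQ (by ext i j; fin_cases i <;> fin_cases j <;> simp [quatQ]) quatQ_mul

def homP : SUgrp 2 ℂ →* Matrix (Fin 5) (Fin 5) ℝ :=
  suHom quatP (by ext i j; fin_cases i <;> fin_cases j <;> simp [quatP]) quatP_mul

def homW : SUgrp 2 ℂ →* Matrix (Fin 5) (Fin 5) ℝ :=
  suHom quatW (by ext i j; fin_cases i <;> fin_cases j <;> simp [quatW]) quatW_mul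

theorem hasDerivAt_of_deriv {f : ℝ → ℝ} {f' : ℝ} (hf : DifferentiableAt ℝ f 0)
    (h : deriv f 0 = f') : HasDerivAt f f' 0 := h ▸ hf.hasDerivAt

theorem continuous_homQ : Continuous homQ := continuous_suHom fun i j => by
  fin_cases i <;> fin_cases j <;> simp [quatQ] <;> fun_prop

theorem continuous_homP : Continuous homP := continuous_suHom fun i j => by
  fin_cases i <;> fin_cases j <;> simp [quatP] <;> fun_prop

theorem continuous_homW : Continuous homW := continuous_suHom fun i j => by
  fin_cases i <;> fin_cases j <;> simp [quatW] <;> fun_prop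

set_option maxHeartbeats 2000000 in
theorem hasVelocity_homQ : HasVelocity homQ (fun b : Bool => bif b then suR else suD)
    (fun b => bif b then skewMat 0 0 0 0 0 0 0 0 1 0 else skewMat 1 1 0 0 0 0 0 0 0 0) := by
  refine hasVelocity_suHom (fun i j => ?_) fun i j => ?_ <;>
  refine hasDerivAt_of_deriv ?_ ?_ <;> fin_cases i <;> fin_cases j <;>
  first | (simp [quatQ]; done) | simp [quatQ, skewMat]

set_option maxHeartbeats 2000000 in
theorem hasVelocity_homP : HasVelocity homP (fun b : Bool => bif b then suR else suD)
    (fun b => bif b then skewMat 0 0 0 0 0 0 1 0 0 0 else skewMat 1 (-1) 0 0 0 0 0 0 0 0) := by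
  refine hasVelocity_suHom (fun i j => ?_) fun i j => ?_ <;>
  refine hasDerivAt_of_deriv ?_ ?_ <;> fin_cases i <;> fin_cases j <;>
  first | (simp [quatP]; done) | simp [quatP, skewMat]

set_option maxHeartbeats 2000000 in
theorem hasVelocity_homW : HasVelocity homW (fun b : Bool => bif b then suR else suD)
    (fun b => bif b then skewMat 0 0 0 (-2) 0 0 0 0 0 0 else skewMat 2 0 0 0 0 0 0 0 0 0) := by
  refine hasVelocity_suHom (fun i j => ?_) fun i j => ?_ <;>
  refine hasDerivAt_of_deriv ?_ ?_ <;> fin_cases i <;> fin_cases j <;>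
  first | (simp [quatW]; done) |
    simp (disch := fun_prop) [quatW, skewMat, deriv_fun_mul, deriv_fun_add, deriv_fun_sub,
      deriv_fun_pow]

end ModelHoms

section

open scoped Matrix.Norms.Operator

/-- Auxiliary matrix for `quatV₀`, in terms of the products of pairs of the variables. -/
def quatVCore (A B C D U V S T n m : ℝ) : Matrix (Fin 5) (Fin 5) ℝ :=
  !![A ^ 2 - B ^ 2 + C ^ 2 - D ^ 2, -2 * A * B + 2 * C * D, 2 * (A * V + B * U + C * V + D * U),
      2 * (A * U - B * V - C * U + D * V), -2 * (A * C - B * D);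
     2 * A * B + 2 * C * D, A ^ 2 - B ^ 2 - C ^ 2 + D ^ 2, -2 * (A * U - B * V + C * U - D * V),
      2 * (A * V + B * U - C * V - D * U), -2 * (A * D + B * C);
     2 * (A * T + B * S - D * S + C * T), 2 * (A * S - B * T + C * S + D * T),
      A * (n - 3 * m) + C * (3 * n - m), -B * (n - 3 * m) + D * (3 * n - m), 2 * (n - m) * V;
     -2 * (A * S - B * T - C * S - D * T), 2 * (A * T + B * S + D * S - C * T),
      B * (n - 3 * m) + D * (3 * n - m), A * (n - 3 * m) - C * (3 * n - m), -2 * (n - m) * U;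
     -6 * (S ^ 2 - T ^ 2), 12 * S * T, 6 * (n - m) * T, 6 * (n - m) * S, (n - m) ^ 2 - 2 * n * m]

/-- The five-dimensional irreducible representation of `SU(2)`, in a non-normalized basis. -/
def quatV₀ (a b c d : ℝ) : Matrix (Fin 5) (Fin 5) ℝ :=
  quatVCore (a ^ 2 - b ^ 2) (2 * a * b) (c ^ 2 - d ^ 2) (2 * c * d) (a * c - b * d) (a * d + b * c)
    (a * c + b * d) (b * c - a * d) (a ^ 2 + b ^ 2) (c ^ 2 + d ^ 2)

set_option maxHeartbeats 20000000 in
theorem quatV₀_mul (a b c d a' b' c' d' : ℝ) : quatV₀ a b c d * quatV₀ a' b' c' d' =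
      quatV₀ (a * a' - b * b' - c * c' - d * d') (a * b' + b * a' - d * c' + c * d')
        (a * c' - b * d' + c * a' + d * b') (a * d' + b * c' + d * a' - c * b') := by
  ext i j
  fin_cases i <;> fin_cases j <;> simp [quatV₀, quatVCore] <;> ring

end

section ModelKernels

open scoped Matrix.Norms.Operator

/-- The five-dimensional irreducible representation of `SU(2)`, in an orthonormal basis. -/
noncomputable def quatV (a b c d : ℝ) : Matrix (Fin 5) (Fin 5) ℝ :=
  Matrix.diagonal ![1, 1, 1, 1, (√3)⁻¹] * quatV₀ a b c d * Matrix.diagonal ![1, 1, 1, 1, √3]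

theorem quatV_mul (a b c d a' b' c' d' : ℝ) : quatV a b c d * quatV a' b' c' d' =
      quatV (a * a' - b * b' - c * c' - d * d') (a * b' + b * a' - d * c' + c * d')
        (a * c' - b * d' + c * a' + d * b') (a * d' + b * c' + d * a' - c * b') := by
  have h : Matrix.diagonal ![1, 1, 1, 1, √3] * Matrix.diagonal ![1, 1, 1, 1, (√3)⁻¹] =
      (1 : Matrix (Fin 5) (Fin 5) ℝ) := by
    rw [Matrix.diagonal_mul_diagonal, ← Matrix.diagonal_one]
    congr 1
    ext i
    fin_cases i <;> simp
  rw [quatV, quatV, quatV, ← quatV₀_mul]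
  simp only [Matrix.mul_assoc]
  rw [← Matrix.mul_assoc (Matrix.diagonal ![1, 1, 1, 1, √3]), h, Matrix.one_mul]

noncomputable def homV : SUgrp 2 ℂ →* Matrix (Fin 5) (Fin 5) ℝ :=
  suHom quatV (by
    ext i j
    rw [quatV, Matrix.mul_diagonal, Matrix.diagonal_mul]
    fin_cases i <;> fin_cases j <;> simp [quatV₀, quatVCore]) quatV_mul

theorem continuous_homV : Continuous homV := continuous_suHom fun i j => by
  simp only [quatV, Matrix.mul_diagonal, Matrix.diagonal_mul]
  fin_cases i <;> fin_cases j <;> simp [quatV₀, quatVCore] <;> fun_prop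

set_option maxHeartbeats 4000000 in
theorem hasVelocity_homV : HasVelocity homV (fun b : Bool => bif b then suR else suD)
    (fun b => bif b then skewMat 0 0 0 0 0 (-2 * √3) 0 (-2) 0 0
      else skewMat 4 2 0 0 0 0 0 0 0 0) := by
  have h3 : (√3)⁻¹ * 6 = 2 * √3 := by
    rw [inv_mul_eq_iff_eq_mul₀ (by positivity)]
    linear_combination -2 * Real.mul_self_sqrt (show (0 : ℝ) ≤ 3 by norm_num)
  refine hasVelocity_suHom (fun i j => ?_) fun i j => ?_ <;>
  refine hasDerivAt_of_deriv ?_ ?_ <;>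
  simp only [quatV, Matrix.mul_diagonal, Matrix.diagonal_mul] <;> fin_cases i <;> fin_cases j <;>
  first | (simp [quatV₀, quatVCore]; done) | (simp [quatV₀, quatVCore]; fun_prop) |
    (simp (disch := fun_prop) [quatV₀, quatVCore, skewMat, deriv_fun_mul, deriv_fun_add,
      deriv_fun_sub, deriv_fun_pow]; done) |
    (simp (disch := fun_prop) [quatV₀, quatVCore, skewMat, deriv_fun_mul, deriv_fun_add,
      deriv_fun_sub, deriv_fun_pow]; first | linarith | (left; norm_num))

theorem finite_central :
    {s : SUgrp 2 ℂ | suZ s ∈ ({1, -1} : Set ℂ) ∧ suW s = 0}.Finite := finite_su (by simp)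

theorem mem_central {s : SUgrp 2 ℂ} (hb : (suZ s).im = 0) (hc : (suW s).re = 0)
    (hd : (suW s).im = 0) : suZ s ∈ ({1, -1} : Set ℂ) ∧ suW s = 0 := by
  have h := su_sq s
  rw [hb, hc, hd] at h
  have h2 : (suZ s).re ^ 2 = 1 := by linarith
  refine ⟨?_, Complex.ext hc hd⟩
  rcases sq_eq_one_iff.1 h2 with h | h
  · left; exact Complex.ext (by simp [h]) (by simp [hb])
  · right; exact Complex.ext (by simp [h]) (by simp [hb])

theorem finite_ker_homQ : {s | homQ s = 1}.Finite := by
  refine finite_central.subset fun s (hs : homQ s = 1) => ?_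
  have e : ∀ i j, _ := fun i j => congrFun (congrFun hs i) j
  simp only [homQ, suHom_apply] at e
  have e1 := e 1 0
  have e2 := e 0 2
  have e3 := e 0 3
  simp [quatQ] at e1 e2 e3
  exact mem_central e1 e2 e3

theorem finite_ker_homW : {s | homW s = 1}.Finite := by
  refine finite_central.subset fun s (hs : homW s = 1) => ?_
  have e : ∀ i j, _ := fun i j => congrFun (congrFun hs i) j
  simp only [homW, suHom_apply] at e
  have e1 := e 4 4
  have e2 := e 0 0
  have h := su_sq s
  simp [quatW] at e1 e2
  refine mem_central ?_ ?_ ?_ <;> nlinarith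

theorem finite_ker_homV : {s | homV s = 1}.Finite := by
  refine finite_central.subset fun s (hs : homV s = 1) => ?_
  have e : ∀ i j, _ := fun i j => congrFun (congrFun hs i) j
  simp only [homV, suHom_apply, quatV, Matrix.mul_diagonal, Matrix.diagonal_mul] at e
  have e1 := e 4 4
  have e2 := e 2 2
  have e3 := e 3 3
  have h := su_sq s
  simp [quatV₀, quatVCore] at e1 e2 e3
  rw [mul_assoc, mul_comm, mul_assoc, mul_inv_cancel₀ (by positivity), mul_one] at e1
  suffices key : ∀ a b c d : ℝ, a ^ 2 + b ^ 2 + c ^ 2 + d ^ 2 = 1 →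
      (a ^ 2 + b ^ 2 - (c ^ 2 + d ^ 2)) ^ 2 - 2 * (a ^ 2 + b ^ 2) * (c ^ 2 + d ^ 2) = 1 →
      (a ^ 2 - b ^ 2) * (a ^ 2 + b ^ 2 - 3 * (c ^ 2 + d ^ 2)) = 1 → b = 0 ∧ c = 0 ∧ d = 0 by
    obtain ⟨hb, hc, hd⟩ := key _ _ _ _ h e1 (by linarith)
    exact mem_central hb hc hd
  intro a b c d h h1 h2
  have hm : c ^ 2 + d ^ 2 = 1 - (a ^ 2 + b ^ 2) := by linarith
  rw [hm] at h1 h2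
  rcases eq_or_ne (a ^ 2 + b ^ 2) 0 with h0 | h0
  · have ha : a ^ 2 = 0 := by nlinarith
    have hb : b ^ 2 = 0 := by nlinarith
    rw [ha, hb] at h2
    norm_num at h2
  · have h3 : a ^ 2 + b ^ 2 = 1 := by
      have : (a ^ 2 + b ^ 2) * (a ^ 2 + b ^ 2 - 1) = 0 := by linear_combination h1 / 6
      rcases mul_eq_zero.1 this with h | h
      · exact absurd h h0
      · linarith
    rw [h3] at h2 hm
    refine ⟨?_, ?_, ?_⟩ <;> nlinarith

end ModelKernels

section ModelCircles

open scoped Matrix.Norms.Operator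

theorem finite_zpow_eq_one {p : ℤ} (hp : p ≠ 0) : {z : Circle | z ^ p = 1}.Finite := by
  have h : {z : ℂ | z ^ p.natAbs = 1}.Finite := by
    refine ((Polynomial.nthRoots p.natAbs (1 : ℂ)).toFinset.finite_toSet).subset fun z hz => ?_
    simpa [Polynomial.mem_nthRoots (Int.natAbs_pos.2 hp)] using hz
  refine (h.preimage (f := ((↑) : Circle → ℂ)) Subtype.val_injective.injOn).subset
    fun (z : Circle) hz => ?_
  have hz' : z ^ p.natAbs = 1 := by
    rcases Int.natAbs_eq p with h | h
    · have hp : z ^ p = 1 := hz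
      rw [h] at hp
      exact_mod_cast hp
    · have hp : z ^ p = 1 := hz
      rw [h, zpow_neg, inv_eq_one] at hp
      exact_mod_cast hp
  change (z : ℂ) ^ p.natAbs = 1
  rw [← Circle.coe_pow, hz', Circle.coe_one]

/-- Rotations of the first two coordinate planes. -/
def rotTwo (x y u v : ℝ) : Matrix (Fin 5) (Fin 5) ℝ :=
  !![x, -y, 0, 0, 0;
     y, x, 0, 0, 0;
     0, 0, u, -v, 0;
     0, 0, v, u, 0;
     0, 0, 0, 0, 1]

theorem rotTwo_mul (x y u v x' y' u' v' : ℝ) : rotTwo x y u v * rotTwo x' y' u' v' =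
    rotTwo (x * x' - y * y') (x * y' + y * x') (u * u' - v * v') (u * v' + v * u') := by
  ext i j
  fin_cases i <;> fin_cases j <;> simp [rotTwo] <;> ring

theorem rotTwo_one : rotTwo 1 0 1 0 = 1 := by
  ext i j; fin_cases i <;> fin_cases j <;> simp [rotTwo]

/-- The circle acting with weights `p` and `q` on the first two coordinate planes. -/
noncomputable def homC (p q : ℤ) : Circle →* Matrix (Fin 5) (Fin 5) ℝ where
  toFun z := rotTwo ((z ^ p : Circle) : ℂ).re ((z ^ p : Circle) : ℂ).im
    ((z ^ q : Circle) : ℂ).re ((z ^ q : Circle) : ℂ).im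
  map_one' := by simpa using rotTwo_one
  map_mul' z z' := by
    rw [rotTwo_mul, mul_zpow, mul_zpow, Circle.coe_mul, Circle.coe_mul, Complex.mul_re,
      Complex.mul_im, Complex.mul_re, Complex.mul_im]

theorem homC_apply (p q : ℤ) (z : Circle) : homC p q z =
    rotTwo ((z ^ p : Circle) : ℂ).re ((z ^ p : Circle) : ℂ).im
    ((z ^ q : Circle) : ℂ).re ((z ^ q : Circle) : ℂ).im := rfl

theorem homC_apply_eq_one {p q : ℤ} {z : Circle} (h : homC p q z = 1) :
    z ^ p = 1 ∧ z ^ q = 1 := by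
  rw [homC_apply] at h
  have e : ∀ i j, _ := fun i j => congrFun (congrFun h i) j
  have e1 := e 0 0
  have e2 := e 1 0
  have e3 := e 2 2
  have e4 := e 3 2
  simp [rotTwo] at e1 e2 e3 e4
  constructor
  · exact Circle.ext (Complex.ext (by simpa using e1) (by simpa using e2))
  · exact Circle.ext (Complex.ext (by simpa using e3) (by simpa using e4))

theorem continuous_homC (p q : ℤ) : Continuous (homC p q) := by
  have h : ∀ n : ℤ, Continuous fun z : Circle => ((z ^ n : Circle) : ℂ) := fun n =>
    continuous_subtype_val.comp (continuous_zpow n)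
  have hp := h p
  have hq := h q
  refine continuous_matrix fun i j => ?_
  simp only [homC_apply]
  fin_cases i <;> fin_cases j <;> simp [rotTwo, -Circle.coe_zpow] <;> fun_prop

theorem hasVelocity_homC (p q : ℤ) : HasVelocity (homC p q) (fun (_ : Unit) t => Circle.exp t)
    (fun _ => skewMat p q 0 0 0 0 0 0 0 0) := by
  refine hasVelocity_circle (hasDerivAt_pi.2 fun i => hasDerivAt_pi.2 fun j => ?_)
  have h : ∀ (n : ℤ) (t : ℝ), ((Circle.exp t ^ n : Circle) : ℂ) =
      ⟨Real.cos (n * t), Real.sin (n * t)⟩ := fun n t => by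
    rw [← Circle.exp_zsmul, zsmul_eq_mul, Circle.coe_exp]
    apply Complex.ext
    · rw [Complex.exp_ofReal_mul_I_re]
    · rw [Complex.exp_ofReal_mul_I_im]
  simp only [homC_apply, h]
  refine hasDerivAt_of_deriv ?_ ?_ <;> fin_cases i <;> fin_cases j <;>
  first | (simp [rotTwo]; done) | (simp [rotTwo]; fun_prop) |
    simp (disch := fun_prop) [rotTwo, skewMat, deriv_cos, deriv_sin]

theorem commute_homC (p q p' q' : ℤ) (z z' : Circle) : Commute (homC p q z) (homC p' q' z') := by
  rw [Commute, SemiconjBy, homC_apply, homC_apply, rotTwo_mul, rotTwo_mul]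
  congr 1 <;> ring

theorem commute_homC_homW (z : Circle) (s : SUgrp 2 ℂ) : Commute (homC 0 1 z) (homW s) := by
  rw [Commute, SemiconjBy, homC_apply, homW, suHom_apply]
  ext i j
  fin_cases i <;> fin_cases j <;> simp [rotTwo, quatW]

theorem commute_homC_homP (z : Circle) (s : SUgrp 2 ℂ) : Commute (homC 1 1 z) (homP s) := by
  rw [Commute, SemiconjBy, homC_apply, homP, suHom_apply]
  ext i j
  fin_cases i <;> fin_cases j <;> simp [rotTwo, quatP] <;> ring

set_option maxHeartbeats 4000000 in
theorem commute_homP_homQ (s t : SUgrp 2 ℂ) : Commute (homP s) (homQ t) := by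
  rw [Commute, SemiconjBy, homP, homQ, suHom_apply, suHom_apply]
  ext i j
  fin_cases i <;> fin_cases j <;> simp [quatQ, quatP] <;> ring

theorem finite_ker_homC {p q : ℤ} (h : p ≠ 0 ∨ q ≠ 0) : {z | homC p q z = 1}.Finite := by
  rcases h with h | h
  · exact (finite_zpow_eq_one h).subset fun z hz => (homC_apply_eq_one hz).1
  · exact (finite_zpow_eq_one h).subset fun z hz => (homC_apply_eq_one hz).2

theorem finite_ker_torus :
    {x | (homC 1 0).noncommCoprod (homC 0 1) (commute_homC 1 0 0 1) x = 1}.Finite := by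
  refine (Set.finite_singleton (1 : Circle × Circle)).subset fun x hx => ?_
  have h : homC 1 0 x.1 * homC 0 1 x.2 = 1 := hx
  rw [homC_apply, homC_apply, rotTwo_mul] at h
  have e : ∀ i j, _ := fun i j => congrFun (congrFun h i) j
  have e1 := e 0 0
  have e2 := e 1 0
  have e3 := e 2 2
  have e4 := e 3 2
  simp [rotTwo] at e1 e2 e3 e4
  refine Prod.ext ?_ ?_
  · exact Circle.ext (Complex.ext (by simpa using e1) (by simpa using e2))
  · exact Circle.ext (Complex.ext (by simpa using e3) (by simpa using e4))

theorem finite_ker_homC_homW :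
    {x | (homC 0 1).noncommCoprod homW commute_homC_homW x = 1}.Finite := by
  refine ((Set.finite_singleton (1 : Circle)).prod finite_central).subset fun x hx => ?_
  have h : homC 0 1 x.1 * homW x.2 = 1 := hx
  rw [homC_apply, homW, suHom_apply] at h
  have e : ∀ i j, _ := fun i j => congrFun (congrFun h i) j
  have e1 := e 0 0
  have e2 := e 4 4
  have e3 := e 2 2
  have e4 := e 3 2
  have h := su_sq x.2
  simp [rotTwo, quatW] at e1 e2 e3 e4
  refine ⟨?_, mem_central ?_ ?_ ?_⟩
  · exact Circle.ext (Complex.ext (by simpa using e3) (by simpa using e4))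
  all_goals nlinarith

theorem finite_ker_homC_homP :
    {x | (homC 1 1).noncommCoprod homP commute_homC_homP x = 1}.Finite := by
  refine ((finite_zpow_eq_one (p := 2) (by norm_num)).prod finite_central).subset fun x hx => ?_
  have h : homC 1 1 x.1 * homP x.2 = 1 := hx
  rw [homC_apply, homP, suHom_apply] at h
  have e : ∀ i j, _ := fun i j => congrFun (congrFun h i) j
  have e1 := e 0 0
  have e2 := e 1 0
  have e3 := e 2 2
  have e4 := e 3 2
  have h := su_sq x.2
  simp [rotTwo, quatP] at e1 e2 e3 e4
  have hxa : (x.1 : ℂ).re * (suZ x.2).re = 1 := by linarith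
  have hxb : (x.1 : ℂ).re * (suZ x.2).im = 0 := by linarith
  have hya : (x.1 : ℂ).im * (suZ x.2).re = 0 := by linarith
  have hx0 : (x.1 : ℂ).re ≠ 0 := fun h => by simp [h] at hxa
  have ha0 : (suZ x.2).re ≠ 0 := fun h => by simp [h] at hxa
  have hb : (suZ x.2).im = 0 := (mul_eq_zero.1 hxb).resolve_left hx0
  have hy : (x.1 : ℂ).im = 0 := (mul_eq_zero.1 hya).resolve_right ha0
  have hn : (x.1 : ℂ).re ^ 2 = 1 := by
    have := Circle.normSq_coe x.1
    rw [Complex.normSq_apply, hy] at this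
    linarith
  have ha : (suZ x.2).re ^ 2 = 1 := by
    have : ((x.1 : ℂ).re * (suZ x.2).re) ^ 2 = 1 := by rw [hxa]; norm_num
    rw [mul_pow, hn, one_mul] at this
    exact this
  refine ⟨Circle.ext (Complex.ext ?_ ?_), mem_central hb ?_ ?_⟩
  · simp [sq, hy]; linarith
  · simp [sq, hy]
  all_goals nlinarith

theorem finite_ker_homP_homQ :
    {x | homP.noncommCoprod homQ commute_homP_homQ x = 1}.Finite := by
  refine ((finite_central.preimage inv_injective.injOn).prod finite_central).subset fun x hx => ?_
  have h : homP x.1 * homQ x.2 = 1 := hx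
  have h' : homP x.1⁻¹ = homQ x.2 := by
    calc homP x.1⁻¹ = homP x.1⁻¹ * (homP x.1 * homQ x.2) := by rw [h, mul_one]
      _ = homQ x.2 := by rw [← mul_assoc, ← map_mul, inv_mul_cancel, map_one, one_mul]
  rw [homP, homQ, suHom_apply, suHom_apply] at h'
  have e : ∀ i j, _ := fun i j => congrFun (congrFun h' i) j
  have e1 := e 1 0
  have e2 := e 3 2
  have e3 := e 0 2
  have e4 := e 1 3
  have e5 := e 0 3
  have e6 := e 1 2
  simp [quatP, quatQ] at e1 e2 e3 e4 e5 e6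
  refine ⟨mem_central ?_ ?_ ?_, mem_central ?_ ?_ ?_⟩ <;> linarith

end ModelCircles

section RotGrp

open scoped Matrix.Norms.Operator
open NormedSpace (exp)

/-- A compact connected group of orthogonal matrices. -/
structure IsRotGrp (S : Submonoid (Matrix (Fin 5) (Fin 5) ℝ)) : Prop extends IsCompactGrp S where
  conn : IsPreconnected (S : Set (Matrix (Fin 5) (Fin 5) ℝ))
  orth : ∀ A ∈ S, A.transpose * A = 1

/-- The Lie algebra of a compact connected group of orthogonal matrices. -/
noncomputable def IsRotGrp.lie {S : Submonoid (Matrix (Fin 5) (Fin 5) ℝ)} (hS : IsRotGrp S) :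
    Submodule ℝ (Matrix (Fin 5) (Fin 5) ℝ) := lieAlg hS.toIsCompactGrp

theorem IsRotGrp.isSkewLie {S : Submonoid (Matrix (Fin 5) (Fin 5) ℝ)} (hS : IsRotGrp S) :
    IsSkewLie hS.lie := by
  refine ⟨fun X hX => ?_, fun X hX Y hY => commutator_mem_lieAlg hS.toIsCompactGrp hX hY⟩
  have h : ∀ t : ℝ, exp (t • X.transpose) = exp (t • -X) := fun t => by
    have h1 : exp ((t • X).transpose) * exp (t • X) = 1 := by
      rw [Matrix.exp_transpose]
      exact hS.orth _ (hX t)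
    rw [Matrix.transpose_smul] at h1
    have h2 : exp (t • X) * exp (-t • X) = 1 := exp_mul_neg_smul X t
    calc exp (t • X.transpose)
        = exp (t • X.transpose) * (exp (t • X) * exp (-t • X)) := by
          rw [h2, mul_one]
      _ = exp (t • -X) := by rw [← mul_assoc, h1, one_mul, smul_neg, neg_smul]
  have h2 : HasDerivAt (fun t : ℝ => exp (t • -X)) X.transpose 0 :=
    (funext h) ▸ hasDerivAt_exp_smul_zero X.transpose
  exact h2.unique (hasDerivAt_exp_smul_zero (-X))

/-- Either one of the six models, or everything. -/
def IsClassified (S : Submonoid (Matrix (Fin 5) (Fin 5) ℝ)) : Prop :=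
  IsModelImage S ∨ ∀ X : Matrix (Fin 5) (Fin 5) ℝ, X.transpose = -X → ∀ t : ℝ, exp (t • X) ∈ S

/-- Conjugation by a matrix with two-sided inverse. -/
def conjHom (O P : Matrix (Fin 5) (Fin 5) ℝ) (h : P * O = 1) :
    Matrix (Fin 5) (Fin 5) ℝ →* Matrix (Fin 5) (Fin 5) ℝ where
  toFun X := O * X * P
  map_one' := by rw [mul_one]; exact mul_eq_one_comm.1 h
  map_mul' X Y := by
    calc O * (X * Y) * P = O * X * (P * O) * Y * P := by rw [h]; simp only [mul_one, mul_assoc]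
      _ = O * X * P * (O * Y * P) := by simp only [mul_assoc]

theorem conjHom_apply {O P : Matrix (Fin 5) (Fin 5) ℝ} (h : P * O = 1) (X) :
    conjHom O P h X = O * X * P := rfl

theorem conjHom_conjHom {O P : Matrix (Fin 5) (Fin 5) ℝ} (h : P * O = 1) (h' : O * P = 1) (X) :
    conjHom O P h (conjHom P O h' X) = X := by
  rw [conjHom_apply, conjHom_apply]
  calc O * (P * X * O) * P = (O * P) * X * (O * P) := by simp only [mul_assoc]
    _ = X := by rw [h', one_mul, mul_one]

theorem continuous_conjHom {O P : Matrix (Fin 5) (Fin 5) ℝ} (h : P * O = 1) :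
    Continuous (conjHom O P h) := by
  change Continuous fun X => O * X * P
  fun_prop

theorem conjHom_exp {O P : Matrix (Fin 5) (Fin 5) ℝ} (h : P * O = 1) (X) (t : ℝ) :
    conjHom O P h (exp (t • X)) = exp (t • (O * X * P)) := by
  have h' : O * P = 1 := mul_eq_one_comm.1 h
  have := Matrix.exp_units_conj (⟨O, P, h', h⟩ : (Matrix (Fin 5) (Fin 5) ℝ)ˣ) (t • X)
  simp only [Matrix.mul_smul, Matrix.smul_mul] at this
  exact this.symm

theorem MapsOnto.conj {P' : Type} [Group P'] [TopologicalSpace P']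
    {S : Submonoid (Matrix (Fin 5) (Fin 5) ℝ)} {O P : Matrix (Fin 5) (Fin 5) ℝ} (h : P * O = 1)
    (hS : MapsOnto P' (S.map (conjHom O P h))) : MapsOnto P' S := by
  have h' : O * P = 1 := mul_eq_one_comm.1 h
  obtain ⟨f, hf, hr, hk⟩ := hS
  refine ⟨(conjHom P O h').comp f, (continuous_conjHom h').comp hf, ?_, ?_⟩
  · rw [MonoidHom.coe_comp, Set.range_comp, hr, Submonoid.coe_map, Set.image_image]
    simp [conjHom_conjHom h' h]
  · refine hk.subset fun p hp => ?_
    have hp' : conjHom P O h' (f p) = 1 := hp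
    have := congrArg (conjHom O P h) hp'
    rwa [conjHom_conjHom h h', map_one] at this

theorem IsModelImage.conj {S : Submonoid (Matrix (Fin 5) (Fin 5) ℝ)}
    {O P : Matrix (Fin 5) (Fin 5) ℝ} (h : P * O = 1)
    (hS : IsModelImage (S.map (conjHom O P h))) : IsModelImage S := by
  unfold IsModelImage at hS ⊢
  exact hS.imp (.conj h) <| .imp (.conj h) <| .imp (.conj h) <| .imp (.conj h) <|
    .imp (.conj h) (.conj h)

theorem IsClassified.conj {S : Submonoid (Matrix (Fin 5) (Fin 5) ℝ)}
    {O : Matrix (Fin 5) (Fin 5) ℝ} (h : O.transpose * O = 1)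
    (hS : IsClassified (S.map (conjHom O O.transpose h))) : IsClassified S := by
  have h' : O * O.transpose = 1 := mul_eq_one_comm.1 h
  refine hS.imp (.conj h) fun hS X hX t => ?_
  have hX' : (O * X * O.transpose).transpose = -(O * X * O.transpose) := by
    simp [Matrix.transpose_mul, hX, mul_assoc]
  obtain ⟨A, hA, hAX⟩ := hS _ hX' t
  have := congrArg (conjHom O.transpose O h') (hAX.trans (conjHom_exp h X t).symm)
  rw [conjHom_conjHom h' h, conjHom_conjHom h' h] at this
  rwa [← this]

theorem IsRotGrp.conj {S : Submonoid (Matrix (Fin 5) (Fin 5) ℝ)} (hS : IsRotGrp S)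
    {O : Matrix (Fin 5) (Fin 5) ℝ} (h : O.transpose * O = 1) :
    IsRotGrp (S.map (conjHom O O.transpose h)) where
  compact := by
    rw [Submonoid.coe_map]
    exact hS.compact.image (continuous_conjHom h)
  inv := by
    rintro _ ⟨A, hA, rfl⟩
    obtain ⟨B, hB, h1, h2⟩ := hS.inv A hA
    exact ⟨_, ⟨B, hB, rfl⟩, by rw [← map_mul, h1, map_one], by rw [← map_mul, h2, map_one]⟩
  conn := by
    rw [Submonoid.coe_map]
    exact hS.conn.image _ (continuous_conjHom h).continuousOn
  orth := by
    rintro _ ⟨A, hA, rfl⟩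
    have h' : O * O.transpose = 1 := mul_eq_one_comm.1 h
    rw [conjHom_apply, Matrix.transpose_mul, Matrix.transpose_mul, Matrix.transpose_transpose]
    calc O * (A.transpose * O.transpose) * (O * A * O.transpose)
        = O * (A.transpose * ((O.transpose * O) * A)) * O.transpose := by simp only [mul_assoc]
      _ = 1 := by rw [h, one_mul, hS.orth A hA, mul_one, h']

theorem IsRotGrp.conj_mem_lie {S : Submonoid (Matrix (Fin 5) (Fin 5) ℝ)} (hS : IsRotGrp S)
    {O : Matrix (Fin 5) (Fin 5) ℝ} (h : O.transpose * O = 1) {X : Matrix (Fin 5) (Fin 5) ℝ}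
    (hX : X ∈ hS.lie) : O * X * O.transpose ∈ (hS.conj h).lie :=
  fun t => ⟨_, hX t, conjHom_exp h X t⟩

theorem IsRotGrp.exists_of_mem_lie_conj {S : Submonoid (Matrix (Fin 5) (Fin 5) ℝ)}
    (hS : IsRotGrp S) {O : Matrix (Fin 5) (Fin 5) ℝ} (h : O.transpose * O = 1)
    {Y : Matrix (Fin 5) (Fin 5) ℝ} (hY : Y ∈ (hS.conj h).lie) :
    ∃ X ∈ hS.lie, Y = O * X * O.transpose := by
  have h' : O * O.transpose = 1 := mul_eq_one_comm.1 h
  refine ⟨O.transpose * Y * O, fun t => ?_, (conjHom_conjHom h h' Y).symm⟩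
  obtain ⟨A, hA, hAX⟩ := hY t
  have := (congrArg (conjHom O.transpose O h') hAX).trans (conjHom_exp h' Y t)
  rw [conjHom_conjHom h' h] at this
  exact this ▸ hA

end RotGrp

section ModelTheorems

open scoped Matrix.Norms.Operator

variable {S : Submonoid (Matrix (Fin 5) (Fin 5) ℝ)}

theorem IsRotGrp.mapsOnto (hS : IsRotGrp S) {P : Type} [Group P] [TopologicalSpace P]
    [CompactSpace P] {f : P →* Matrix (Fin 5) (Fin 5) ℝ} (hf : Continuous f)
    (hker : {p | f p = 1}.Finite) {ι : Type} {γ : ι → ℝ → P} {E : ι → Matrix (Fin 5) (Fin 5) ℝ}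
    (hγ : HasVelocity f γ E) (hgen : Generates γ) (hE : ∀ i, E i ∈ hS.lie)
    (hL : ∀ L : Submodule ℝ (Matrix (Fin 5) (Fin 5) ℝ), IsSkewLie L → (∀ i, E i ∈ L) →
      hS.lie ≤ L) : MapsOnto P S := by
  refine mapsOnto_of_generates hS.toIsCompactGrp hS.conn f hf hker hγ hgen hE fun L hEL hbr => ?_
  have h := hL (L ⊓ hS.lie) ⟨fun X hX => hS.isSkewLie.skew X hX.2, fun X hX Y hY =>
    ⟨hbr X hX.1 Y hY.1, hS.isSkewLie.bracket X hX.2 Y hY.2⟩⟩ fun i => ⟨hEL i, hE i⟩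
  exact fun X hX => (h hX).1

theorem IsRotGrp.mapsOnto_punit (hS : IsRotGrp S) (h : ∀ X ∈ hS.lie, X = 0) :
    MapsOnto PUnit S := by
  refine hS.mapsOnto (f := 1) (ι := Empty) (γ := fun i => i.elim) (E := fun i => i.elim)
    continuous_const (Set.toFinite _) (fun i => i.elim) (fun T _ p => ?_) (fun i => i.elim)
    fun L _ _ X hX => ?_
  · exact T.one_mem
  · rw [h X hX]; exact L.zero_mem

theorem IsRotGrp.mapsOnto_circle (hS : IsRotGrp S) {p q : ℤ} (hpq : p ≠ 0 ∨ q ≠ 0)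
    (hE : skewMat p q 0 0 0 0 0 0 0 0 ∈ hS.lie)
    (h : ∀ X ∈ hS.lie, ∃ c, X = skewMat (c * p) (c * q) 0 0 0 0 0 0 0 0) :
    MapsOnto Circle S := by
  refine hS.mapsOnto (continuous_homC p q) (finite_ker_homC hpq) (hasVelocity_homC p q)
    generates_circle (fun _ => hE) fun L _ hL X hX => ?_
  obtain ⟨c, rfl⟩ := h X hX
  simpa using IsSkewLie.smul_mem c (hL ())

theorem IsRotGrp.mapsOnto_su_w (hS : IsRotGrp S) (hT : skewMat 1 0 0 0 0 0 0 0 0 0 ∈ hS.lie)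
    (hE : skewMat 0 0 0 1 0 0 0 0 0 0 ∈ hS.lie)
    (h : ∀ X ∈ hS.lie, ∃ a x y, X = skewMat a 0 x y 0 0 0 0 0 0) : MapsOnto (SUgrp 2 ℂ) S := by
  refine hS.mapsOnto continuous_homW finite_ker_homW hasVelocity_homW generates_su
    (Bool.forall_bool.2 ⟨?_, ?_⟩) fun L hLie hL X hX => ?_
  · simpa using IsSkewLie.smul_mem 2 hT
  · simpa using IsSkewLie.smul_mem (-2) hE
  obtain ⟨a, x, y, rfl⟩ := h X hX
  have hD : skewMat 2 0 0 0 0 0 0 0 0 0 ∈ L := hL false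
  have hR : skewMat 0 0 0 (-2) 0 0 0 0 0 0 ∈ L := hL true
  have h1 := IsSkewLie.smul_mem (a / 2) hD
  have h2 := IsSkewLie.smul_mem (x / 4) (hLie.torus_bracket_mem hD hR)
  have h3 := IsSkewLie.smul_mem (-(y / 2)) hR
  convert IsSkewLie.add_mem (IsSkewLie.add_mem h1 h2) h3 using 1
  congr 1 <;> ring

theorem IsRotGrp.mapsOnto_su_q (hS : IsRotGrp S) (hT : skewMat 1 1 0 0 0 0 0 0 0 0 ∈ hS.lie)
    (hE : skewMat 0 0 0 0 0 0 0 0 1 0 ∈ hS.lie)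
    (h : ∀ X ∈ hS.lie, ∃ a x y, X = skewMat a a 0 0 0 0 0 0 x y) : MapsOnto (SUgrp 2 ℂ) S := by
  refine hS.mapsOnto continuous_homQ finite_ker_homQ hasVelocity_homQ generates_su
    (Bool.forall_bool.2 ⟨hT, hE⟩) fun L hLie hL X hX => ?_
  obtain ⟨a, x, y, rfl⟩ := h X hX
  have hD : skewMat 1 1 0 0 0 0 0 0 0 0 ∈ L := hL false
  have hR : skewMat 0 0 0 0 0 0 0 0 1 0 ∈ L := hL true
  have h1 := IsSkewLie.smul_mem a hD
  have h2 := IsSkewLie.smul_mem (y / 2) (hLie.torus_bracket_mem hD hR)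
  have h3 := IsSkewLie.smul_mem x hR
  convert IsSkewLie.add_mem (IsSkewLie.add_mem h1 h2) h3 using 1
  congr 1 <;> ring

theorem IsRotGrp.mapsOnto_su_zp (hS : IsRotGrp S) (hT : skewMat 2 1 0 0 0 0 0 0 0 0 ∈ hS.lie)
    (hE : skewMat 0 0 0 0 0 √3 0 1 0 0 ∈ hS.lie)
    (h : ∀ X ∈ hS.lie, ∃ a x y, X = skewMat (2 * a) a 0 0 (√3 * x) (√3 * y) x y 0 0) :
    MapsOnto (SUgrp 2 ℂ) S := by
  refine hS.mapsOnto continuous_homV finite_ker_homV hasVelocity_homV generates_su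
    (Bool.forall_bool.2 ⟨?_, ?_⟩) fun L hLie hL X hX => ?_
  · convert IsSkewLie.smul_mem 2 hT using 1
    rw [Bool.cond_false]
    congr 1 <;> ring
  · convert IsSkewLie.smul_mem (-2) hE using 1
    rw [Bool.cond_true]
    congr 1 <;> ring
  obtain ⟨a, x, y, rfl⟩ := h X hX
  have hD : skewMat 4 2 0 0 0 0 0 0 0 0 ∈ L := hL false
  have hR : skewMat 0 0 0 0 0 (-2 * √3) 0 (-2) 0 0 ∈ L := hL true
  have h1 := IsSkewLie.smul_mem (a / 2) hD
  have h2 := IsSkewLie.smul_mem (x / 4) (hLie.torus_bracket_mem hD hR)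
  have h3 := IsSkewLie.smul_mem (-(y / 2)) hR
  convert IsSkewLie.add_mem (IsSkewLie.add_mem h1 h2) h3 using 1
  congr 1 <;> ring

section FullTorus

variable (hS : IsRotGrp S) (h₁ : skewMat 1 0 0 0 0 0 0 0 0 0 ∈ hS.lie)
  (h₂ : skewMat 0 1 0 0 0 0 0 0 0 0 ∈ hS.lie)
include h₁ h₂

theorem IsRotGrp.mapsOnto_torus (h : ∀ X ∈ hS.lie, ∃ a b, X = skewMat a b 0 0 0 0 0 0 0 0) :
    MapsOnto (Circle × Circle) S := by
  refine hS.mapsOnto (continuous_noncommCoprod (continuous_homC 1 0) (continuous_homC 0 1) _)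
    finite_ker_torus ((hasVelocity_homC 1 0).prod (hasVelocity_homC 0 1) _)
    (generates_circle.prod generates_circle) (Sum.forall.2 ⟨?_, ?_⟩) fun L hLie hL X hX => ?_
  · simpa using h₁
  · simpa using h₂
  obtain ⟨a, b, rfl⟩ := h X hX
  exact hLie.torus_mem (by simpa using hL (.inl ())) (by simpa using hL (.inr ())) a b

theorem IsRotGrp.mapsOnto_circle_su_w (hE : skewMat 0 0 1 0 0 0 0 0 0 0 ∈ hS.lie)
    (h : ∀ X ∈ hS.lie, ∃ a b x y, X = skewMat a b x y 0 0 0 0 0 0) :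
    MapsOnto (Circle × SUgrp 2 ℂ) S := by
  refine hS.mapsOnto (continuous_noncommCoprod (continuous_homC 0 1) continuous_homW _)
    finite_ker_homC_homW ((hasVelocity_homC 0 1).prod hasVelocity_homW _)
    (generates_circle.prod generates_su)
    (Sum.forall.2 ⟨?_, Bool.forall_bool.2 ⟨?_, ?_⟩⟩) fun L hLie hL X hX => ?_
  · simpa using h₂
  · simpa using IsSkewLie.smul_mem 2 h₁
  · exact hS.isSkewLie.w_mem h₁ h₂ hE (by simp) _ _
  obtain ⟨a, b, x, y, rfl⟩ := h X hX
  have hC : skewMat 0 1 0 0 0 0 0 0 0 0 ∈ L := by simpa using hL (.inl ())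
  have hD : skewMat 2 0 0 0 0 0 0 0 0 0 ∈ L := hL (.inr false)
  have hR : skewMat 0 0 0 (-2) 0 0 0 0 0 0 ∈ L := hL (.inr true)
  have hT : skewMat 1 0 0 0 0 0 0 0 0 0 ∈ L := by simpa using IsSkewLie.smul_mem 2⁻¹ hD
  simpa using IsSkewLie.add_mem (hLie.torus_mem hT hC a b) (hLie.w_mem hT hC hR (by simp) x y)

theorem IsRotGrp.mapsOnto_circle_su_p (hE : skewMat 0 0 0 0 0 0 1 0 0 0 ∈ hS.lie)
    (h : ∀ X ∈ hS.lie, ∃ a b x y, X = skewMat a b 0 0 0 0 x y 0 0) :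
    MapsOnto (Circle × SUgrp 2 ℂ) S := by
  refine hS.mapsOnto (continuous_noncommCoprod (continuous_homC 1 1) continuous_homP _)
    finite_ker_homC_homP ((hasVelocity_homC 1 1).prod hasVelocity_homP _)
    (generates_circle.prod generates_su)
    (Sum.forall.2 ⟨?_, Bool.forall_bool.2 ⟨?_, ?_⟩⟩) fun L hLie hL X hX => ?_
  · simpa using hS.isSkewLie.torus_mem h₁ h₂ 1 1
  · exact hS.isSkewLie.torus_mem h₁ h₂ 1 (-1)
  · exact hE
  obtain ⟨a, b, x, y, rfl⟩ := h X hX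
  have hC : skewMat 1 1 0 0 0 0 0 0 0 0 ∈ L := by simpa using hL (.inl ())
  have hD : skewMat 1 (-1) 0 0 0 0 0 0 0 0 ∈ L := hL (.inr false)
  have hR : skewMat 0 0 0 0 0 0 1 0 0 0 ∈ L := hL (.inr true)
  have hT : ∀ s t : ℝ, skewMat s t 0 0 0 0 0 0 0 0 ∈ L := fun s t => by
    convert IsSkewLie.add_mem (IsSkewLie.smul_mem ((s + t) / 2) hC)
      (IsSkewLie.smul_mem ((s - t) / 2) hD) using 1
    congr 1 <;> ring
  simpa using IsSkewLie.add_mem (hT a b) (hLie.p_mem (hT 1 0) (hT 0 1) hR (by simp) x y)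

theorem IsRotGrp.mapsOnto_su_su (hE : skewMat 0 0 0 0 0 0 1 0 0 0 ∈ hS.lie)
    (hF : skewMat 0 0 0 0 0 0 0 0 1 0 ∈ hS.lie)
    (h : ∀ X ∈ hS.lie, ∃ a b x y u v, X = skewMat a b 0 0 0 0 x y u v) :
    MapsOnto (SUgrp 2 ℂ × SUgrp 2 ℂ) S := by
  refine hS.mapsOnto (continuous_noncommCoprod continuous_homP continuous_homQ _)
    finite_ker_homP_homQ (hasVelocity_homP.prod hasVelocity_homQ _)
    (generates_su.prod generates_su)
    (Sum.forall.2 ⟨Bool.forall_bool.2 ⟨?_, hE⟩, Bool.forall_bool.2 ⟨?_, hF⟩⟩)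
    fun L hLie hL X hX => ?_
  · exact hS.isSkewLie.torus_mem h₁ h₂ 1 (-1)
  · exact hS.isSkewLie.torus_mem h₁ h₂ 1 1
  obtain ⟨a, b, x, y, u, v, rfl⟩ := h X hX
  have hD : skewMat 1 (-1) 0 0 0 0 0 0 0 0 ∈ L := hL (.inl false)
  have hR : skewMat 0 0 0 0 0 0 1 0 0 0 ∈ L := hL (.inl true)
  have hC : skewMat 1 1 0 0 0 0 0 0 0 0 ∈ L := hL (.inr false)
  have hQ : skewMat 0 0 0 0 0 0 0 0 1 0 ∈ L := hL (.inr true)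
  have hT : ∀ s t : ℝ, skewMat s t 0 0 0 0 0 0 0 0 ∈ L := fun s t => by
    convert IsSkewLie.add_mem (IsSkewLie.smul_mem ((s + t) / 2) hC)
      (IsSkewLie.smul_mem ((s - t) / 2) hD) using 1
    congr 1 <;> ring
  simpa using IsSkewLie.add_mem (IsSkewLie.add_mem (hT a b)
    (hLie.p_mem (hT 1 0) (hT 0 1) hR (by simp) x y))
    (hLie.q_mem (hT 1 0) (hT 0 1) hQ (by simp) u v)

end FullTorus

/-- Exchange of the first two coordinate planes. -/
def swapMat : Matrix (Fin 5) (Fin 5) ℝ :=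
  !![0, 0, 1, 0, 0;
     0, 0, 0, 1, 0;
     1, 0, 0, 0, 0;
     0, 1, 0, 0, 0;
     0, 0, 0, 0, 1]

theorem swapMat_orth : swapMat.transpose * swapMat = 1 := by
  ext i j; fin_cases i <;> fin_cases j <;> simp [swapMat, Matrix.mul_apply, Fin.sum_univ_five]

theorem swapMat_conj (a b w₁ w₂ z₁ z₂ p₁ p₂ q₁ q₂ : ℝ) :
    swapMat * skewMat a b w₁ w₂ z₁ z₂ p₁ p₂ q₁ q₂ * swapMat.transpose =
      skewMat b a z₁ z₂ w₁ w₂ (-p₁) p₂ (-q₁) (-q₂) := by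
  ext i j
  fin_cases i <;> fin_cases j <;>
    simp [swapMat, skewMat, Matrix.mul_apply, Fin.sum_univ_five] <;> ring

/-- Reflection in the fourth coordinate. -/
def reflMat : Matrix (Fin 5) (Fin 5) ℝ := Matrix.diagonal ![1, 1, 1, -1, 1]

theorem reflMat_orth : reflMat.transpose * reflMat = 1 := by
  rw [reflMat, Matrix.diagonal_transpose, Matrix.diagonal_mul_diagonal, ← Matrix.diagonal_one]
  congr 1
  ext i
  fin_cases i <;> simp

theorem reflMat_conj (a b w₁ w₂ z₁ z₂ p₁ p₂ q₁ q₂ : ℝ) :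
    reflMat * skewMat a b w₁ w₂ z₁ z₂ p₁ p₂ q₁ q₂ * reflMat.transpose =
      skewMat a (-b) w₁ w₂ z₁ (-z₂) q₁ q₂ p₁ p₂ := by
  ext i j
  rw [reflMat, Matrix.diagonal_transpose, Matrix.mul_diagonal, Matrix.diagonal_mul]
  fin_cases i <;> fin_cases j <;> simp [skewMat] <;> ring

/-- Groups containing a two-dimensional torus. -/
theorem IsRotGrp.isClassified_of_torus (hS : IsRotGrp S)
    (h₁ : skewMat 1 0 0 0 0 0 0 0 0 0 ∈ hS.lie) (h₂ : skewMat 0 1 0 0 0 0 0 0 0 0 ∈ hS.lie) :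
    IsClassified S := by
  rcases hS.isSkewLie.rank_two_classification h₁ h₂ with h | ⟨hE, h⟩ | ⟨hE, h⟩ | ⟨hE, h⟩ |
    ⟨hE, h⟩ | ⟨hE, hF, h⟩ | h
  · exact .inl (.inr (.inr (.inr (.inl (hS.mapsOnto_torus h₁ h₂ h)))))
  · exact .inl (.inr (.inr (.inr (.inr (.inl (hS.mapsOnto_circle_su_w h₁ h₂ hE h))))))
  · refine .conj swapMat_orth (.inl (.inr (.inr (.inr (.inr (.inl
      ((hS.conj swapMat_orth).mapsOnto_circle_su_w ?_ ?_ ?_ fun X hX => ?_)))))))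
    · simpa [swapMat_conj] using hS.conj_mem_lie swapMat_orth h₂
    · simpa [swapMat_conj] using hS.conj_mem_lie swapMat_orth h₁
    · simpa [swapMat_conj] using hS.conj_mem_lie swapMat_orth hE
    · obtain ⟨Y, hY, rfl⟩ := hS.exists_of_mem_lie_conj swapMat_orth hX
      obtain ⟨a, b, x, y, rfl⟩ := h Y hY
      exact ⟨b, a, x, y, by simp [swapMat_conj]⟩
  · exact .inl (.inr (.inr (.inr (.inr (.inl (hS.mapsOnto_circle_su_p h₁ h₂ hE h))))))
  · refine .conj reflMat_orth (.inl (.inr (.inr (.inr (.inr (.inl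
      ((hS.conj reflMat_orth).mapsOnto_circle_su_p ?_ ?_ ?_ fun X hX => ?_)))))))
    · simpa [reflMat_conj] using hS.conj_mem_lie reflMat_orth h₁
    · simpa [reflMat_conj] using hS.conj_mem_lie reflMat_orth (IsSkewLie.smul_mem (-1) h₂)
    · simpa [reflMat_conj] using hS.conj_mem_lie reflMat_orth hE
    · obtain ⟨Y, hY, rfl⟩ := hS.exists_of_mem_lie_conj reflMat_orth hX
      obtain ⟨a, b, x, y, rfl⟩ := h Y hY
      exact ⟨a, -b, x, y, by simp [reflMat_conj]⟩
  · exact .inl (.inr (.inr (.inr (.inr (.inr (hS.mapsOnto_su_su h₁ h₂ hE hF h))))))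
  · refine .inr fun X hX => ?_
    obtain ⟨a, b, w₁, w₂, z₁, z₂, p₁, p₂, q₁, q₂, rfl⟩ := exists_skewMat hX
    exact h a b w₁ w₂ z₁ z₂ p₁ p₂ q₁ q₂

end ModelTheorems

section CommonPlane

open scoped InnerProductSpace

variable {E : Type*} [NormedAddCommGroup E] [InnerProductSpace ℝ E]

theorem exists_plane_of_eigenvector {A B : E →ₗ[ℝ] E} (hA : ∀ x y, ⟪A x, y⟫_ℝ = -⟪x, A y⟫_ℝ)
    (hAB : ∀ x, A (B x) = B (A x)) {u : E} (hu : ‖u‖ = 1) {α γ : ℝ} (hα : A (A u) = α • u)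
    (hγ : A (B u) = γ • u) (h0 : A u ≠ 0) :
    ∃ v : E, ∃ a b : ℝ, ‖v‖ = 1 ∧ ⟪u, v⟫_ℝ = 0 ∧ A u = a • v ∧ A v = -a • u ∧ B u = b • v ∧
      B v = -b • u := by
  have hn : ‖A u‖ ≠ 0 := norm_ne_zero_iff.2 h0
  have huA : ⟪u, A u⟫_ℝ = 0 := by
    have := hA u u
    rw [real_inner_comm] at this
    linarith
  have hα' : α = -‖A u‖ ^ 2 := by
    have := hA (A u) u
    rw [hα, inner_smul_left, real_inner_self_eq_norm_sq, real_inner_self_eq_norm_sq, hu] at this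
    simpa using this
  have hAv : A (‖A u‖⁻¹ • A u) = -‖A u‖ • u := by
    rw [map_smul, hα, hα', smul_smul]
    congr 1
    field_simp
  have hy : B u + (γ / ‖A u‖) • ‖A u‖⁻¹ • A u = 0 := by
    have h1 : A (B u + (γ / ‖A u‖) • ‖A u‖⁻¹ • A u) = 0 := by
      rw [map_add, map_smul, hAv, hγ, smul_smul, ← add_smul]
      rw [show γ + γ / ‖A u‖ * -‖A u‖ = 0 by field_simp; ring, zero_smul]
    have h2 : A (A (B u + (γ / ‖A u‖) • ‖A u‖⁻¹ • A u)) =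
        α • (B u + (γ / ‖A u‖) • ‖A u‖⁻¹ • A u) := by
      simp only [map_add, map_smul, hAB, hα]
      module
    rw [h1, map_zero] at h2
    refine (smul_eq_zero.1 h2.symm).resolve_left ?_
    rw [hα']
    exact neg_ne_zero.2 (pow_ne_zero 2 hn)
  refine ⟨‖A u‖⁻¹ • A u, ‖A u‖, -(γ / ‖A u‖), ?_, ?_, ?_, hAv, ?_, ?_⟩
  · rw [norm_smul, norm_inv, norm_norm, inv_mul_cancel₀ hn]
  · rw [inner_smul_right, huA, mul_zero]
  · rw [smul_smul, mul_inv_cancel₀ hn, one_smul]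
  · rw [neg_smul]; exact eq_neg_of_add_eq_zero_left hy
  · rw [map_smul, ← hAB, hγ, smul_smul, neg_neg]
    congr 1
    field_simp

theorem exists_common_plane [FiniteDimensional ℝ E] (hE : 2 ≤ Module.finrank ℝ E)
    {A B : E →ₗ[ℝ] E} (hA : ∀ x y, ⟪A x, y⟫_ℝ = -⟪x, A y⟫_ℝ)
    (hB : ∀ x y, ⟪B x, y⟫_ℝ = -⟪x, B y⟫_ℝ) (hAB : ∀ x, A (B x) = B (A x)) :
    ∃ u v : E, ∃ a b : ℝ, ‖u‖ = 1 ∧ ‖v‖ = 1 ∧ ⟪u, v⟫_ℝ = 0 ∧ A u = a • v ∧ A v = -a • u ∧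
      B u = b • v ∧ B v = -b • u := by
  by_cases h : ∃ (u : E) (α β γ : ℝ), A (A u) = α • u ∧ B (B u) = β • u ∧ A (B u) = γ • u ∧
      (A u ≠ 0 ∨ B u ≠ 0)
  · obtain ⟨u, α, β, γ, hα, hβ, hγ, h0⟩ := h
    have hu0 : u ≠ 0 := by rintro rfl; simp at h0
    have hu : ‖‖u‖⁻¹ • u‖ = 1 := by
      rw [norm_smul, norm_inv, norm_norm, inv_mul_cancel₀ (norm_ne_zero_iff.2 hu0)]
    have hc : ‖u‖⁻¹ ≠ 0 := inv_ne_zero (norm_ne_zero_iff.2 hu0)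
    have hα' : A (A (‖u‖⁻¹ • u)) = α • ‖u‖⁻¹ • u := by simp only [map_smul, hα]; module
    have hβ' : B (B (‖u‖⁻¹ • u)) = β • ‖u‖⁻¹ • u := by simp only [map_smul, hβ]; module
    have hγ' : A (B (‖u‖⁻¹ • u)) = γ • ‖u‖⁻¹ • u := by simp only [map_smul, hγ]; module
    rcases h0 with h0 | h0
    · obtain ⟨v, a, b, h⟩ := exists_plane_of_eigenvector hA hAB hu hα' hγ'
        (by rw [map_smul]; exact smul_ne_zero hc h0)
      exact ⟨_, v, a, b, hu, h⟩
    · obtain ⟨v, b, a, h1, h2, h3, h4, h5, h6⟩ := exists_plane_of_eigenvector hB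
        (fun x => (hAB x).symm) hu hβ' (by rw [← hAB, hγ'])
        (by rw [map_smul]; exact smul_ne_zero hc h0)
      exact ⟨_, v, a, b, hu, h1, h2, h5, h6, h3, h4⟩
  · push Not at h
    have hA0 : ∀ x, A x = 0 ∧ B x = 0 := by
      let T : Fin 3 → E →ₗ[ℝ] E := ![A ∘ₗ A, B ∘ₗ B, A ∘ₗ B]
      have hT : ∀ i, (T i).IsSymmetric := by
        intro i x y
        fin_cases i <;> simp [T, hA, hB, hAB]
      have hTc : Pairwise (Function.onFun Commute T) := by
        intro i j _
        refine LinearMap.ext fun x => ?_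
        fin_cases i <;> fin_cases j <;> simp [T, hAB]
      have htop := LinearMap.IsSymmetric.iSup_iInf_eq_top_of_commute hT hTc
      have hle : (⊤ : Submodule ℝ E) ≤ LinearMap.ker A ⊓ LinearMap.ker B := by
        rw [← htop]
        refine iSup_le fun χ u hu => ?_
        simp only [Submodule.mem_iInf, Module.End.mem_eigenspace_iff] at hu
        exact h u (χ 0) (χ 1) (χ 2) (hu 0) (hu 1) (hu 2)
      exact fun x => hle (Submodule.mem_top (x := x))
    let b := stdOrthonormalBasis ℝ E
    let i : Fin (Module.finrank ℝ E) := ⟨0, by omega⟩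
    let j : Fin (Module.finrank ℝ E) := ⟨1, by omega⟩
    refine ⟨b i, b j, 0, 0, b.norm_eq_one i, b.norm_eq_one j, ?_, ?_⟩
    · rw [b.inner_eq_ite, if_neg (by simp [i, j])]
    · simp [hA0]

theorem exists_orthonormal_four [FiniteDimensional ℝ E] (hE : 4 ≤ Module.finrank ℝ E)
    {A B : E →ₗ[ℝ] E} (hA : ∀ x y, ⟪A x, y⟫_ℝ = -⟪x, A y⟫_ℝ)
    (hB : ∀ x y, ⟪B x, y⟫_ℝ = -⟪x, B y⟫_ℝ) (hAB : ∀ x, A (B x) = B (A x)) :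
    ∃ v : Fin 4 → E, ∃ a b c d : ℝ, Orthonormal ℝ v ∧
      (A (v 0) = a • v 1 ∧ A (v 1) = -a • v 0 ∧ A (v 2) = b • v 3 ∧ A (v 3) = -b • v 2) ∧
      B (v 0) = c • v 1 ∧ B (v 1) = -c • v 0 ∧ B (v 2) = d • v 3 ∧ B (v 3) = -d • v 2 := by
  obtain ⟨u, v, a, c, hu, hv, huv, h1, h2, h3, h4⟩ :=
    exists_common_plane (by omega) hA hB hAB
  have hvu : ⟪v, u⟫_ℝ = 0 := by rwa [real_inner_comm]
  let W : Submodule ℝ E := (Submodule.span ℝ {u, v})ᗮ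
  have hW : ∀ x, x ∈ W ↔ ⟪u, x⟫_ℝ = 0 ∧ ⟪v, x⟫_ℝ = 0 := fun x => by
    simp only [W, Submodule.mem_orthogonal, Submodule.mem_span_pair]
    constructor
    · exact fun h => ⟨h u ⟨1, 0, by simp⟩, h v ⟨0, 1, by simp⟩⟩
    · rintro ⟨h, h'⟩ _ ⟨s, t, rfl⟩
      simp [inner_add_left, inner_smul_left, h, h']
  have hAW : ∀ x ∈ W, A x ∈ W := fun x hx => by
    rw [hW] at hx ⊢
    constructor
    · rw [real_inner_comm, hA, h1, inner_smul_right, real_inner_comm, hx.2]; simp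
    · rw [real_inner_comm, hA, h2, inner_smul_right, real_inner_comm, hx.1]; simp
  have hBW : ∀ x ∈ W, B x ∈ W := fun x hx => by
    rw [hW] at hx ⊢
    constructor
    · rw [real_inner_comm, hB, h3, inner_smul_right, real_inner_comm, hx.2]; simp
    · rw [real_inner_comm, hB, h4, inner_smul_right, real_inner_comm, hx.1]; simp
  have hdim : 2 ≤ Module.finrank ℝ W := by
    have e1 := (Submodule.span ℝ {u, v}).finrank_add_finrank_orthogonal
    have e2 : Module.finrank ℝ (Submodule.span ℝ ({u, v} : Set E)) ≤ 2 := by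
      classical
      have := finrank_span_finset_le_card (R := ℝ) ({u, v} : Finset E)
      rw [Finset.coe_pair] at this
      exact this.trans Finset.card_le_two
    change 2 ≤ Module.finrank ℝ (Submodule.span ℝ {u, v})ᗮ
    omega
  obtain ⟨u', v', b, d, hu', hv', huv', h1', h2', h3', h4'⟩ :=
    exists_common_plane hdim (A := A.restrict hAW) (B := B.restrict hBW)
      (fun x y => hA x y) (fun x y => hB x y) (fun x => Subtype.ext (hAB x))
  have hu'W := (hW _).1 u'.2
  have hv'W := (hW _).1 v'.2
  have huv'E : ⟪(u' : E), (v' : E)⟫_ℝ = 0 := huv'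
  refine ⟨![u, v, u', v'], a, b, c, d, ?_, ⟨h1, h2, congrArg Subtype.val h1',
    congrArg Subtype.val h2'⟩, h3, h4, congrArg Subtype.val h3', congrArg Subtype.val h4'⟩
  have e : ∀ x y : E, ⟪x, y⟫_ℝ = 0 → ⟪y, x⟫_ℝ = 0 := fun x y h => by rwa [real_inner_comm]
  refine ⟨fun i => ?_, fun i j hij => ?_⟩
  · fin_cases i
    exacts [hu, hv, hu', hv']
  · fin_cases i <;> fin_cases j <;> first
      | exact absurd rfl hij
      | assumption
      | exact hu'W.1 | exact hu'W.2 | exact hv'W.1 | exact hv'W.2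
      | exact e _ _ hu'W.1 | exact e _ _ hu'W.2 | exact e _ _ hv'W.1 | exact e _ _ hv'W.2
      | exact e _ _ huv'E

end CommonPlane

section NormalForm

open scoped InnerProductSpace

/-- The matrix whose rows are an orthonormal basis. -/
noncomputable def rowMat (b : OrthonormalBasis (Fin 5) ℝ (EuclideanSpace ℝ (Fin 5))) :
    Matrix (Fin 5) (Fin 5) ℝ := Matrix.of fun i k => b i k

theorem rowMat_orth (b : OrthonormalBasis (Fin 5) ℝ (EuclideanSpace ℝ (Fin 5))) :
    (rowMat b).transpose * rowMat b = 1 := by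
  rw [mul_eq_one_comm]
  ext i j
  have h := b.inner_eq_ite j i
  rw [EuclideanSpace.inner_eq_star_dotProduct] at h
  rw [Matrix.one_apply, Matrix.mul_apply]
  simp only [eq_comm (a := i)]
  exact h

theorem rowMat_mulVec (b : OrthonormalBasis (Fin 5) ℝ (EuclideanSpace ℝ (Fin 5))) (j : Fin 5) :
    (rowMat b).mulVec (b j).ofLp = Pi.single j 1 := by
  ext i
  have h := b.inner_eq_ite j i
  rw [EuclideanSpace.inner_eq_star_dotProduct] at h
  rw [Pi.single_apply]
  simp only [eq_comm (a := i)]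
  exact h

theorem rowMat_conj_apply (b : OrthonormalBasis (Fin 5) ℝ (EuclideanSpace ℝ (Fin 5)))
    (A : Matrix (Fin 5) (Fin 5) ℝ) (i j : Fin 5) :
    (rowMat b * A * (rowMat b).transpose) i j = ⟪b i, Matrix.toEuclideanLin A (b j)⟫_ℝ := by
  rw [EuclideanSpace.inner_eq_star_dotProduct, dotProduct_comm, Matrix.mul_assoc]
  rfl

theorem inner_toEuclideanLin {A : Matrix (Fin 5) (Fin 5) ℝ} (hA : A.transpose = -A)
    (x y : EuclideanSpace ℝ (Fin 5)) :
    ⟪Matrix.toEuclideanLin A x, y⟫_ℝ = -⟪x, Matrix.toEuclideanLin A y⟫_ℝ := by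
  rw [EuclideanSpace.inner_eq_star_dotProduct, EuclideanSpace.inner_eq_star_dotProduct]
  change y.ofLp ⬝ᵥ (A.mulVec x.ofLp) = -((A.mulVec y.ofLp) ⬝ᵥ x.ofLp)
  rw [Matrix.dotProduct_mulVec, ← Matrix.mulVec_transpose, hA, Matrix.neg_mulVec, neg_dotProduct]

/-- Commuting skew-symmetric matrices have a common normal form. -/
theorem exists_torus_form {A B : Matrix (Fin 5) (Fin 5) ℝ} (hA : A.transpose = -A)
    (hB : B.transpose = -B) (hAB : A * B = B * A) :
    ∃ O : Matrix (Fin 5) (Fin 5) ℝ, O.transpose * O = 1 ∧ ∃ a b c d : ℝ,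
      O * A * O.transpose = skewMat a b 0 0 0 0 0 0 0 0 ∧
      O * B * O.transpose = skewMat c d 0 0 0 0 0 0 0 0 := by
  obtain ⟨v, a, b, c, d, hv, h1, h2⟩ := exists_orthonormal_four (E := EuclideanSpace ℝ (Fin 5))
    (by simp) (inner_toEuclideanLin hA) (inner_toEuclideanLin hB) (fun x => by
      apply (WithLp.equiv 2 _).injective
      change A.mulVec (B.mulVec x.ofLp) = B.mulVec (A.mulVec x.ofLp)
      rw [Matrix.mulVec_mulVec, Matrix.mulVec_mulVec, hAB])
  let w : Fin 5 → EuclideanSpace ℝ (Fin 5) := ![v 0, v 1, v 2, v 3, 0]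
  have hw : Orthonormal ℝ (({4}ᶜ : Set (Fin 5)).domRestrict w) := by
    refine ⟨?_, ?_⟩
    · rintro ⟨i, hi⟩
      fin_cases i
      exacts [hv.1 0, hv.1 1, hv.1 2, hv.1 3, absurd rfl hi]
    · rintro ⟨i, hi⟩ ⟨j, hj⟩ hij
      fin_cases i <;> fin_cases j <;> first
        | exact absurd rfl hi
        | exact absurd rfl hj
        | exact absurd rfl hij
        | exact hv.2 (by decide)
  obtain ⟨e, he⟩ := hw.exists_orthonormalBasis_extension_of_card_eq (by simp)
  have e0 : e 0 = v 0 := he 0 (by simp)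
  have e1 : e 1 = v 1 := he 1 (by simp)
  have e2 : e 2 = v 2 := he 2 (by simp)
  have e3 : e 3 = v 3 := he 3 (by simp)
  rw [← e0, ← e1, ← e2, ← e3] at h1 h2
  have key : ∀ (M : Matrix (Fin 5) (Fin 5) ℝ) (s t : ℝ), M.transpose = -M →
      (Matrix.toEuclideanLin M (e 0) = s • e 1 ∧ Matrix.toEuclideanLin M (e 1) = -s • e 0 ∧
        Matrix.toEuclideanLin M (e 2) = t • e 3 ∧ Matrix.toEuclideanLin M (e 3) = -t • e 2) →
      rowMat e * M * (rowMat e).transpose = skewMat s t 0 0 0 0 0 0 0 0 := by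
    rintro M s t hM ⟨k0, k1, k2, k3⟩
    have hflip : ∀ i, ⟪e i, Matrix.toEuclideanLin M (e 4)⟫_ℝ =
        -⟪e 4, Matrix.toEuclideanLin M (e i)⟫_ℝ := fun i => by
      rw [real_inner_comm, inner_toEuclideanLin hM]
    have h44 : ⟪e 4, Matrix.toEuclideanLin M (e 4)⟫_ℝ = 0 := by linarith [hflip 4]
    ext i j
    rw [rowMat_conj_apply]
    fin_cases j
    · change ⟪e i, Matrix.toEuclideanLin M (e 0)⟫_ℝ = _
      rw [k0, inner_smul_right, e.inner_eq_ite]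
      fin_cases i <;> simp [skewMat]
    · change ⟪e i, Matrix.toEuclideanLin M (e 1)⟫_ℝ = _
      rw [k1, inner_smul_right, e.inner_eq_ite]
      fin_cases i <;> simp [skewMat]
    · change ⟪e i, Matrix.toEuclideanLin M (e 2)⟫_ℝ = _
      rw [k2, inner_smul_right, e.inner_eq_ite]
      fin_cases i <;> simp [skewMat]
    · change ⟪e i, Matrix.toEuclideanLin M (e 3)⟫_ℝ = _
      rw [k3, inner_smul_right, e.inner_eq_ite]
      fin_cases i <;> simp [skewMat]
    · change ⟪e i, Matrix.toEuclideanLin M (e 4)⟫_ℝ = _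
      fin_cases i
      · exact (hflip 0).trans (by rw [k0, inner_smul_right, e.inner_eq_ite]; simp [skewMat])
      · exact (hflip 1).trans (by rw [k1, inner_smul_right, e.inner_eq_ite]; simp [skewMat])
      · exact (hflip 2).trans (by rw [k2, inner_smul_right, e.inner_eq_ite]; simp [skewMat])
      · exact (hflip 3).trans (by rw [k3, inner_smul_right, e.inner_eq_ite]; simp [skewMat])
      · simpa [skewMat] using h44
  exact ⟨rowMat e, rowMat_orth e, a, b, c, d, key A a b hA h1, key B c d hB h2⟩

/-- A unit vector in the span of the last three coordinates can be moved to the last coordinate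
vector by an orthogonal matrix fixing the first two. -/
theorem exists_orth_fixing {x y z : ℝ} (h : x ^ 2 + y ^ 2 + z ^ 2 = 1) :
    ∃ O : Matrix (Fin 5) (Fin 5) ℝ, O.transpose * O = 1 ∧
      O.mulVec ![1, 0, 0, 0, 0] = ![1, 0, 0, 0, 0] ∧
      O.mulVec ![0, 1, 0, 0, 0] = ![0, 1, 0, 0, 0] ∧
      O.mulVec ![0, 0, x, y, z] = ![0, 0, 0, 0, 1] := by
  let w : Fin 5 → EuclideanSpace ℝ (Fin 5) :=
    ![!₂[1, 0, 0, 0, 0], !₂[0, 1, 0, 0, 0], 0, 0, !₂[0, 0, x, y, z]]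
  have hw : Orthonormal ℝ (({0, 1, 4} : Set (Fin 5)).domRestrict w) := by
    refine ⟨?_, ?_⟩
    · rintro ⟨i, hi⟩
      fin_cases i <;> simp [w, EuclideanSpace.norm_eq, Fin.sum_univ_five] at hi ⊢
      linarith
    · rintro ⟨i, hi⟩ ⟨j, hj⟩ hij
      fin_cases i <;> fin_cases j <;>
        simp [w, EuclideanSpace.inner_eq_star_dotProduct, Fin.sum_univ_five, dotProduct]
          at hi hj hij ⊢
  obtain ⟨e, he⟩ := hw.exists_orthonormalBasis_extension_of_card_eq (by simp)
  have e0 : (e 0).ofLp = ![1, 0, 0, 0, 0] := by rw [he 0 (by simp)]; rfl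
  have e1 : (e 1).ofLp = ![0, 1, 0, 0, 0] := by rw [he 1 (by simp)]; rfl
  have e4 : (e 4).ofLp = ![0, 0, x, y, z] := by rw [he 4 (by simp)]; rfl
  refine ⟨rowMat e, rowMat_orth e, ?_, ?_, ?_⟩
  · rw [← e0, rowMat_mulVec, e0]
    ext i; fin_cases i <;> simp
  · rw [← e1, rowMat_mulVec, e1]
    ext i; fin_cases i <;> simp
  · rw [← e4, rowMat_mulVec]
    ext i; fin_cases i <;> simp

end NormalForm

section FullRotations

open scoped Matrix.Norms.Operator InnerProductSpace
open NormedSpace (exp)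

theorem isSymm_of_trace_skew_mul {B : Matrix (Fin 5) (Fin 5) ℝ}
    (h : ∀ X : Matrix (Fin 5) (Fin 5) ℝ, X.transpose = -X → (X * B).trace = 0) :
    B.transpose = B := by
  have h1 := h (B.transpose - B) (by simp)
  have h2 : ((B.transpose - B) * B.transpose).trace = 0 := by
    rw [← Matrix.trace_transpose, Matrix.transpose_mul, Matrix.trace_mul_comm]
    simp only [Matrix.transpose_sub, Matrix.transpose_transpose]
    rw [← neg_sub, Matrix.neg_mul, Matrix.trace_neg, h1, neg_zero]
  have h3 : ((B.transpose - B).conjTranspose * (B.transpose - B)).trace = 0 := by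
    rw [Matrix.conjTranspose_eq_transpose_of_trivial]
    simp only [Matrix.transpose_sub, Matrix.transpose_transpose]
    rw [← neg_sub, Matrix.neg_mul, Matrix.trace_neg, mul_sub, Matrix.trace_sub, h1, h2]
    simp
  exact sub_eq_zero.1 (Matrix.trace_conjTranspose_mul_self_eq_zero_iff.1 h3)

/-- A symmetric orthogonal matrix of determinant one other than the identity has two orthogonal
eigenvectors of eigenvalue `-1`. -/
theorem exists_neg_eigenvectors {B : Matrix (Fin 5) (Fin 5) ℝ} (hs : B.transpose = B)
    (ho : B.transpose * B = 1) (hd : B.det = 1) (h1 : B ≠ 1) :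
    ∃ e : OrthonormalBasis (Fin 5) ℝ (EuclideanSpace ℝ (Fin 5)),
      Matrix.toEuclideanLin B (e 0) = -e 0 ∧ Matrix.toEuclideanLin B (e 1) = -e 1 := by
  have hH : B.IsHermitian := by
    rwa [Matrix.IsHermitian, Matrix.conjTranspose_eq_transpose_of_trivial]
  have hBB : B * B = 1 := by rwa [hs] at ho
  have hv := hH.mulVec_eigenvectorBasis
  have hsq : ∀ i, hH.eigenvalues i ^ 2 = 1 := fun i => by
    have e1 : B.mulVec (B.mulVec (hH.eigenvectorBasis i).ofLp) =
        hH.eigenvalues i ^ 2 • (hH.eigenvectorBasis i).ofLp := by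
      rw [hv, Matrix.mulVec_smul, hv, smul_smul, sq]
    rw [Matrix.mulVec_mulVec, hBB, Matrix.one_mulVec] at e1
    have e2 : (hH.eigenvalues i ^ 2 - 1) • hH.eigenvectorBasis i = 0 := by
      rw [sub_smul, one_smul, sub_eq_zero]
      exact (WithLp.equiv 2 _).injective e1.symm
    rcases smul_eq_zero.1 e2 with h | h
    · linarith
    · exact absurd h (hH.eigenvectorBasis.orthonormal.ne_zero i)
  have hprod : ∏ i, hH.eigenvalues i = 1 := by
    have := hH.det_eq_prod_eigenvalues
    rw [hd] at this
    exact_mod_cast this.symm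
  have hpm : ∀ i, hH.eigenvalues i = 1 ∨ hH.eigenvalues i = -1 := fun i =>
    sq_eq_one_iff.1 (hsq i)
  obtain ⟨i, hi⟩ : ∃ i, hH.eigenvalues i = -1 := by
    by_contra! h
    apply h1
    have hone : hH.eigenvalues = fun _ => 1 := funext fun i => (hpm i).resolve_right (h i)
    have := hH.spectral_theorem
    rw [hone] at this
    rw [this]
    have hdiag : Matrix.diagonal ((RCLike.ofReal : ℝ → ℝ) ∘ fun _ : Fin 5 => (1 : ℝ)) = 1 := by
      ext i j; simp [Matrix.diagonal_apply, Matrix.one_apply]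
    rw [hdiag, map_one]
  obtain ⟨j, hij, hj⟩ : ∃ j, j ≠ i ∧ hH.eigenvalues j = -1 := by
    by_contra! h
    have : ∏ k, hH.eigenvalues k = -1 := by
      rw [← Finset.mul_prod_erase _ _ (Finset.mem_univ i), hi, Finset.prod_eq_one, mul_one]
      exact fun k hk => (hpm k).resolve_right (h k (Finset.ne_of_mem_erase hk))
    linarith
  let w : Fin 5 → EuclideanSpace ℝ (Fin 5) :=
    ![hH.eigenvectorBasis i, hH.eigenvectorBasis j, 0, 0, 0]
  have hw : Orthonormal ℝ (({0, 1} : Set (Fin 5)).domRestrict w) := by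
    have ho := hH.eigenvectorBasis.orthonormal
    refine ⟨?_, ?_⟩
    · rintro ⟨k, rfl | rfl⟩
      exacts [ho.1 i, ho.1 j]
    · rintro ⟨k, rfl | rfl⟩ ⟨l, rfl | rfl⟩ hkl
      exacts [absurd rfl hkl, ho.2 hij.symm, ho.2 hij, absurd rfl hkl]
  obtain ⟨e, he⟩ := hw.exists_orthonormalBasis_extension_of_card_eq (by simp)
  have e0 : e 0 = hH.eigenvectorBasis i := he 0 (by simp)
  have e1 : e 1 = hH.eigenvectorBasis j := he 1 (by simp)
  refine ⟨e, ?_, ?_⟩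
  · rw [e0]
    apply (WithLp.equiv 2 _).injective
    exact (hv i).trans (by rw [hi, neg_one_smul]; rfl)
  · rw [e1]
    apply (WithLp.equiv 2 _).injective
    exact (hv j).trans (by rw [hj, neg_one_smul]; rfl)

theorem exp_pi_skewMat : exp (Real.pi • skewMat 1 0 0 0 0 0 0 0 0 0) = rotTwo (-1) 0 1 0 := by
  have h : homC 1 0 (Circle.exp Real.pi) =
      exp (Real.pi • skewMat ((1 : ℤ) : ℝ) ((0 : ℤ) : ℝ) 0 0 0 0 0 0 0 0) :=
    hasVelocity_homC 1 0 () Real.pi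
  rw [homC_apply] at h
  simpa using h.symm

/-- A compact group of rotations whose Lie algebra contains all skew-symmetric matrices contains
every rotation. -/
theorem mem_of_full {S : Submonoid (Matrix (Fin 5) (Fin 5) ℝ)} (hS : IsCompactGrp S)
    (horth : ∀ A ∈ S, A.transpose * A = 1) (hdet : ∀ A ∈ S, A.det = 1)
    (hfull : ∀ X : Matrix (Fin 5) (Fin 5) ℝ, X.transpose = -X → ∀ t : ℝ, exp (t • X) ∈ S)
    {A : Matrix (Fin 5) (Fin 5) ℝ} (hA : A.transpose * A = 1) (hA1 : A.det = 1) : A ∈ S := by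
  have hcont : Continuous fun k : Matrix (Fin 5) (Fin 5) ℝ => (k * A).trace := by
    fun_prop
  obtain ⟨k, hk, hmax⟩ := hS.compact.exists_isMaxOn ⟨1, S.one_mem⟩ hcont.continuousOn
  have hmax' : ∀ g ∈ S, (g * (k * A)).trace ≤ (k * A).trace := fun g hg => by
    rw [← mul_assoc]
    exact hmax (S.mul_mem hg hk)
  have hBo : (k * A).transpose * (k * A) = 1 := by
    rw [Matrix.transpose_mul]
    calc A.transpose * k.transpose * (k * A) = A.transpose * ((k.transpose * k) * A) := by
          simp only [mul_assoc]
      _ = 1 := by rw [horth k hk, one_mul, hA]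
  have hBd : (k * A).det = 1 := by rw [Matrix.det_mul, hdet k hk, hA1, one_mul]
  generalize hB : k * A = B at *
  have hsym : B.transpose = B := by
    refine isSymm_of_trace_skew_mul fun X hX => ?_
    let φ : Matrix (Fin 5) (Fin 5) ℝ →L[ℝ] ℝ := LinearMap.toContinuousLinearMap
      (Matrix.traceLinearMap (Fin 5) ℝ ℝ ∘ₗ LinearMap.mulRight ℝ B)
    have hd : HasDerivAt (fun t : ℝ => φ (exp (t • X))) (φ X) 0 :=
      φ.hasFDerivAt.comp_hasDerivAt (0 : ℝ) (hasDerivAt_exp_smul_zero X)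
    refine IsLocalMax.hasDerivAt_eq_zero (Filter.Eventually.of_forall fun t => ?_) hd
    have h1 : φ (exp ((0 : ℝ) • X)) = B.trace := by
      simp [φ]
    change φ (exp (t • X)) ≤ φ (exp ((0 : ℝ) • X))
    rw [h1]
    exact hmax' _ (hfull X hX t)
  by_cases h1 : B = 1
  · exact hS.inv_mem hk (hB.trans h1)
  obtain ⟨e, he0, he1⟩ := exists_neg_eigenvectors hsym hBo hBd h1
  have ho := rowMat_orth e
  have ho' := mul_eq_one_comm.1 ho
  have hmem : (rowMat e).transpose * rotTwo (-1) 0 1 0 * rowMat e ∈ S := by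
    have hsk : ((rowMat e).transpose * skewMat 1 0 0 0 0 0 0 0 0 0 * rowMat e).transpose =
        -((rowMat e).transpose * skewMat 1 0 0 0 0 0 0 0 0 0 * rowMat e) := by
      have : (skewMat 1 0 0 0 0 0 0 0 0 0).transpose = -skewMat 1 0 0 0 0 0 0 0 0 0 := by
        ext i j; fin_cases i <;> fin_cases j <;> simp [skewMat]
      simp [Matrix.transpose_mul, this, mul_assoc]
    have h2 := hfull _ hsk Real.pi
    have h3 := conjHom_exp (O := (rowMat e).transpose) (P := rowMat e) ho'
      (skewMat 1 0 0 0 0 0 0 0 0 0) Real.pi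
    rw [← h3, conjHom_apply] at h2
    have h4 := exp_pi_skewMat
    exact h4 ▸ h2
  have h5 := hmax' _ hmem
  have h6 : ((rowMat e).transpose * rotTwo (-1) 0 1 0 * rowMat e * B).trace =
      (rotTwo (-1) 0 1 0 * (rowMat e * B * (rowMat e).transpose)).trace := by
    rw [mul_assoc, mul_assoc, Matrix.trace_mul_comm, mul_assoc]
  have h7 : B.trace = (rowMat e * B * (rowMat e).transpose).trace := by
    rw [Matrix.trace_mul_comm, ← mul_assoc, ho, one_mul]
  have h00 : (rowMat e * B * (rowMat e).transpose) 0 0 = -1 := by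
    rw [rowMat_conj_apply, he0, inner_neg_right, e.inner_eq_ite, if_pos rfl]
  have h11 : (rowMat e * B * (rowMat e).transpose) 1 1 = -1 := by
    rw [rowMat_conj_apply, he1, inner_neg_right, e.inner_eq_ite, if_pos rfl]
  rw [h6, h7] at h5
  generalize rowMat e * B * (rowMat e).transpose = M at h5 h00 h11
  have hd : rotTwo (-1) 0 1 0 = Matrix.diagonal ![-1, -1, 1, 1, 1] := by
    ext i j; fin_cases i <;> fin_cases j <;> simp [rotTwo]
  rw [hd] at h5
  simp only [Matrix.trace, Matrix.diag_apply, Fin.sum_univ_five, Matrix.diagonal_mul, h00,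
    h11] at h5
  have h5' : -1 * -1 + -1 * -1 + 1 * M 2 2 + 1 * M 3 3 + 1 * M 4 4 ≤
    -1 + -1 + M 2 2 + M 3 3 + M 4 4 := h5
  linarith

end FullRotations

section RankOne

variable {L : Submodule ℝ (Matrix (Fin 5) (Fin 5) ℝ)}

theorem skewMat_inj {a b w₁ w₂ z₁ z₂ p₁ p₂ q₁ q₂ a' b' w₁' w₂' z₁' z₂' p₁' p₂' q₁' q₂' : ℝ}
    (h : skewMat a b w₁ w₂ z₁ z₂ p₁ p₂ q₁ q₂ = skewMat a' b' w₁' w₂' z₁' z₂' p₁' p₂' q₁' q₂') :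
    a = a' ∧ b = b' ∧ w₁ = w₁' ∧ w₂ = w₂' ∧ z₁ = z₁' ∧ z₂ = z₂' ∧ p₁ = p₁' ∧ p₂ = p₂' ∧
      q₁ = q₁' ∧ q₂ = q₂' := by
  have h10 : a = a' := congrFun (congrFun h 1) 0
  have h32 : b = b' := congrFun (congrFun h 3) 2
  have h04 : w₁ = w₁' := congrFun (congrFun h 0) 4
  have h14 : w₂ = w₂' := congrFun (congrFun h 1) 4
  have h24 : z₁ = z₁' := congrFun (congrFun h 2) 4
  have h34 : z₂ = z₂' := congrFun (congrFun h 3) 4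
  have h02 : p₁ + q₁ = p₁' + q₁' := congrFun (congrFun h 0) 2
  have h03 : -p₂ + q₂ = -p₂' + q₂' := congrFun (congrFun h 0) 3
  have h12 : p₂ + q₂ = p₂' + q₂' := congrFun (congrFun h 1) 2
  have h13 : p₁ - q₁ = p₁' - q₁' := congrFun (congrFun h 1) 3
  refine ⟨h10, h32, h04, h14, h24, h34, ?_, ?_, ?_, ?_⟩ <;> linarith

theorem skewMat_zero : skewMat 0 0 0 0 0 0 0 0 0 0 = 0 := by
  ext i j; fin_cases i <;> fin_cases j <;> simp [skewMat]

/-- Commuting elements of `L` are proportional. -/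
def IsRankOne (L : Submodule ℝ (Matrix (Fin 5) (Fin 5) ℝ)) : Prop :=
  ∀ X ∈ L, ∀ Y ∈ L, X ≠ 0 → X * Y = Y * X → ∃ c : ℝ, Y = c • X

/-- The centralizer of a torus element in a Lie algebra of rank one. -/
theorem IsRankOne.centralizer (hr : IsRankOne L) {a b : ℝ} (ha : a ≠ 0)
    (hZ : skewMat a b 0 0 0 0 0 0 0 0 ∈ L) {α β w₁ w₂ z₁ z₂ p₁ p₂ q₁ q₂ : ℝ}
    (h : skewMat α β w₁ w₂ z₁ z₂ p₁ p₂ q₁ q₂ ∈ L) (hw₁ : a * w₁ = 0) (hw₂ : a * w₂ = 0)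
    (hz₁ : b * z₁ = 0) (hz₂ : b * z₂ = 0) (hp₁ : (a - b) * p₁ = 0) (hp₂ : (a - b) * p₂ = 0)
    (hq₁ : (a + b) * q₁ = 0) (hq₂ : (a + b) * q₂ = 0) :
    ∃ c, α = c * a ∧ β = c * b ∧ w₁ = 0 ∧ w₂ = 0 ∧ z₁ = 0 ∧ z₂ = 0 ∧ p₁ = 0 ∧ p₂ = 0 ∧
      q₁ = 0 ∧ q₂ = 0 := by
  obtain ⟨c, hc⟩ := hr _ hZ _ h (fun h0 => ha (skewMat_inj (h0.trans skewMat_zero.symm)).1) (by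
    rw [← sub_eq_zero, skewMat_bracket, ← skewMat_zero]
    congr 1 <;> linarith)
  simp only [skewMat_smul, mul_zero] at hc
  exact ⟨c, skewMat_inj hc⟩

section General

variable (hL : IsSkewLie L) (hr : IsRankOne L) {a b : ℝ} (ha : a ≠ 0)
  (hZ : skewMat a b 0 0 0 0 0 0 0 0 ∈ L)
include hL hr ha hZ

theorem IsRankOne.w_eq_zero (hb : b ≠ 0) {x y : ℝ} (h : skewMat 0 0 x y 0 0 0 0 0 0 ∈ L) :
    x = 0 ∧ y = 0 := by
  have h1 := hL.bracket _ h _ (hL.torus_bracket_mem hZ h)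
  rw [skewMat_bracket] at h1
  obtain ⟨c, h2, h3, -⟩ := hr.centralizer ha hZ h1 (by ring) (by ring) (by ring) (by ring)
    (by ring) (by ring) (by ring) (by ring)
  have hc : c = 0 := by
    have : c * b = 0 := by rw [← h3]; ring
    exact (mul_eq_zero.1 this).resolve_right hb
  subst hc
  have h4 : a * (x ^ 2 + y ^ 2) = 0 := by linear_combination h2
  have h5 := (mul_eq_zero.1 h4).resolve_left ha
  constructor <;> nlinarith

theorem IsRankOne.z_eq_zero (hb : b ≠ 0) {x y : ℝ} (h : skewMat 0 0 0 0 x y 0 0 0 0 ∈ L) :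
    x = 0 ∧ y = 0 := by
  have h1 := hL.bracket _ h _ (hL.torus_bracket_mem hZ h)
  rw [skewMat_bracket] at h1
  obtain ⟨c, h2, h3, -⟩ := hr.centralizer ha hZ h1 (by ring) (by ring) (by ring) (by ring)
    (by ring) (by ring) (by ring) (by ring)
  have hc : c = 0 := by
    have : c * a = 0 := by rw [← h2]; ring
    exact (mul_eq_zero.1 this).resolve_right ha
  subst hc
  have h4 : b * (x ^ 2 + y ^ 2) = 0 := by linear_combination h3
  have h5 := (mul_eq_zero.1 h4).resolve_left hb
  constructor <;> nlinarith

theorem IsRankOne.p_eq_zero (hab : a - b ≠ 0) (hab' : a + b ≠ 0) {x y : ℝ}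
    (h : skewMat 0 0 0 0 0 0 x y 0 0 ∈ L) : x = 0 ∧ y = 0 := by
  have h1 := hL.bracket _ h _ (hL.torus_bracket_mem hZ h)
  rw [skewMat_bracket] at h1
  obtain ⟨c, h2, h3, -⟩ := hr.centralizer ha hZ h1 (by ring) (by ring) (by ring) (by ring)
    (by ring) (by ring) (by ring) (by ring)
  have hc : c = 0 := by
    have : c * (a + b) = 0 := by linear_combination -h2 - h3
    exact (mul_eq_zero.1 this).resolve_right hab'
  subst hc
  have h4 : (a - b) * (x ^ 2 + y ^ 2) = 0 := by linear_combination h2 / 2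
  have h5 := (mul_eq_zero.1 h4).resolve_left hab
  constructor <;> nlinarith

theorem IsRankOne.q_eq_zero (hab : a - b ≠ 0) (hab' : a + b ≠ 0) {x y : ℝ}
    (h : skewMat 0 0 0 0 0 0 0 0 x y ∈ L) : x = 0 ∧ y = 0 := by
  have h1 := hL.bracket _ h _ (hL.torus_bracket_mem hZ h)
  rw [skewMat_bracket] at h1
  obtain ⟨c, h2, h3, -⟩ := hr.centralizer ha hZ h1 (by ring) (by ring) (by ring) (by ring)
    (by ring) (by ring) (by ring) (by ring)
  have hc : c = 0 := by
    have : c * (a - b) = 0 := by linear_combination -h2 + h3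
    exact (mul_eq_zero.1 this).resolve_right hab
  subst hc
  have h4 : (a + b) * (x ^ 2 + y ^ 2) = 0 := by linear_combination h2 / 2
  have h5 := (mul_eq_zero.1 h4).resolve_left hab'
  constructor <;> nlinarith

end General

/-- Twice bracketing with a torus element. -/
theorem IsSkewLie.torus_sq_mem (hL : IsSkewLie L) {a b : ℝ}
    (hZ : skewMat a b 0 0 0 0 0 0 0 0 ∈ L) {α β w₁ w₂ z₁ z₂ p₁ p₂ q₁ q₂ : ℝ}
    (h : skewMat α β w₁ w₂ z₁ z₂ p₁ p₂ q₁ q₂ ∈ L) :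
    skewMat 0 0 (a ^ 2 * w₁) (a ^ 2 * w₂) (b ^ 2 * z₁) (b ^ 2 * z₂) ((a - b) ^ 2 * p₁)
      ((a - b) ^ 2 * p₂) ((a + b) ^ 2 * q₁) ((a + b) ^ 2 * q₂) ∈ L := by
  convert IsSkewLie.smul_mem (-1) (hL.torus_bracket_mem hZ (hL.torus_bracket_mem hZ h)) using 1
  congr 1 <;> ring

/-- Removing the root space on which twice bracketing acts by `μ`. -/
theorem IsSkewLie.torus_shift_mem (hL : IsSkewLie L) {a b : ℝ}
    (hZ : skewMat a b 0 0 0 0 0 0 0 0 ∈ L) (μ : ℝ) {w₁ w₂ z₁ z₂ p₁ p₂ q₁ q₂ : ℝ}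
    (h : skewMat 0 0 w₁ w₂ z₁ z₂ p₁ p₂ q₁ q₂ ∈ L) :
    skewMat 0 0 ((a ^ 2 - μ) * w₁) ((a ^ 2 - μ) * w₂) ((b ^ 2 - μ) * z₁) ((b ^ 2 - μ) * z₂)
      (((a - b) ^ 2 - μ) * p₁) (((a - b) ^ 2 - μ) * p₂) (((a + b) ^ 2 - μ) * q₁)
      (((a + b) ^ 2 - μ) * q₂) ∈ L := by
  convert IsSkewLie.add_mem (hL.torus_sq_mem hZ h) (IsSkewLie.smul_mem (-μ) h) using 1
  congr 1 <;> ring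

/-- Two distinct nonzero slopes: only the `z` and `p` planes can occur. -/
theorem IsRankOne.w_q_eq_zero (hL : IsSkewLie L) (hr : IsRankOne L) {a b : ℝ} (hb : 0 < b)
    (hab : b < a) (hZ : skewMat a b 0 0 0 0 0 0 0 0 ∈ L) {α β w₁ w₂ z₁ z₂ p₁ p₂ q₁ q₂ : ℝ}
    (h : skewMat α β w₁ w₂ z₁ z₂ p₁ p₂ q₁ q₂ ∈ L) :
    w₁ = 0 ∧ w₂ = 0 ∧ q₁ = 0 ∧ q₂ = 0 := by
  have ha : 0 < a := hb.trans hab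
  have h0 := hL.torus_shift_mem hZ ((a - b) ^ 2) (hL.torus_shift_mem hZ (b ^ 2)
    (hL.torus_sq_mem hZ h))
  have n1 : a ^ 2 - b ^ 2 ≠ 0 := by nlinarith
  have n2 : a ^ 2 - (a - b) ^ 2 ≠ 0 := by nlinarith
  have n3 : a ^ 2 - (a + b) ^ 2 ≠ 0 := by nlinarith
  have n4 : (a + b) ^ 2 - b ^ 2 ≠ 0 := by nlinarith
  have n5 : (a + b) ^ 2 - (a - b) ^ 2 ≠ 0 := by nlinarith
  have n6 : (a + b) ^ 2 - a ^ 2 ≠ 0 := by nlinarith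
  have n7 : a - b ≠ 0 := by linarith
  have n8 : a + b ≠ 0 := by linarith
  have h1 := hL.torus_shift_mem hZ ((a + b) ^ 2) h0
  have h2 := hL.torus_shift_mem hZ (a ^ 2) h0
  simp only [sub_self, zero_mul, mul_zero] at h1 h2
  have h3 := hr.w_eq_zero hL ha.ne' hZ hb.ne' h1
  have h4 := hr.q_eq_zero hL ha.ne' hZ n7 n8 h2
  simpa [n1, n2, n3, n4, n5, n6, n8, ha.ne', and_assoc] using And.intro h3 h4

theorem IsRankOne.eq_smul_of_generic (hL : IsSkewLie L) (hr : IsRankOne L) {a b : ℝ} (hb : 0 < b)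
    (hab : b < a) (hab2 : a ≠ 2 * b) (hZ : skewMat a b 0 0 0 0 0 0 0 0 ∈ L)
    {X : Matrix (Fin 5) (Fin 5) ℝ} (hX : X ∈ L) : ∃ c : ℝ, X = c • skewMat a b 0 0 0 0 0 0 0 0 := by
  obtain ⟨α, β, w₁, w₂, z₁, z₂, p₁, p₂, q₁, q₂, rfl⟩ := exists_skewMat (hL.skew X hX)
  obtain ⟨rfl, rfl, rfl, rfl⟩ := hr.w_q_eq_zero hL hb hab hZ hX
  have ha : 0 < a := hb.trans hab
  have n1 : (a - b) ^ 2 - b ^ 2 ≠ 0 := by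
    have : (a - b) ^ 2 - b ^ 2 = a * (a - 2 * b) := by ring
    rw [this]
    exact mul_ne_zero ha.ne' (sub_ne_zero.2 hab2)
  have n2 : b ^ 2 - (a - b) ^ 2 ≠ 0 := fun h => n1 (by linarith)
  have n7 : a - b ≠ 0 := by linarith
  have n8 : a + b ≠ 0 := by linarith
  have h0 := hL.torus_sq_mem hZ hX
  have h1 := hL.torus_shift_mem hZ ((a - b) ^ 2) h0
  have h2 := hL.torus_shift_mem hZ (b ^ 2) h0
  simp only [sub_self, zero_mul, mul_zero] at h1 h2
  have h3 := hr.z_eq_zero hL ha.ne' hZ hb.ne' h1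
  have h4 := hr.p_eq_zero hL ha.ne' hZ n7 n8 h2
  simp only [mul_eq_zero, n1, n2, n7, hb.ne', pow_eq_zero_iff, ne_eq, OfNat.ofNat_ne_zero,
    not_false_eq_true, false_or] at h3 h4
  obtain ⟨rfl, rfl⟩ := h3
  obtain ⟨rfl, rfl⟩ := h4
  obtain ⟨c, rfl, rfl, -⟩ := hr.centralizer ha.ne' hZ hX (by simp) (by simp) (by simp) (by simp)
    (by simp) (by simp) (by simp) (by simp)
  exact ⟨c, by simp [skewMat_smul]⟩

theorem IsRankOne.form_of_diag (hL : IsSkewLie L) (hr : IsRankOne L)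
    (hZ : skewMat 1 1 0 0 0 0 0 0 0 0 ∈ L) {X : Matrix (Fin 5) (Fin 5) ℝ} (hX : X ∈ L) :
    ∃ c x y, X = skewMat c c 0 0 0 0 0 0 x y := by
  obtain ⟨α, β, w₁, w₂, z₁, z₂, p₁, p₂, q₁, q₂, rfl⟩ := exists_skewMat (hL.skew X hX)
  have h0 := hL.torus_sq_mem hZ hX
  have h1 := hL.torus_shift_mem hZ 4 h0
  have h2 : skewMat 0 0 w₁ w₂ z₁ z₂ 0 0 0 0 ∈ L := by
    convert IsSkewLie.smul_mem (-1 / 3) h1 using 1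
    congr 1 <;> ring
  have h3 := hL.bracket _ h2 _ (hL.torus_bracket_mem hZ h2)
  rw [skewMat_bracket] at h3
  obtain ⟨c, k1, k2, -, -, -, -, k3, k4, -⟩ := hr.centralizer one_ne_zero hZ h3 (by ring)
    (by ring) (by ring) (by ring) (by ring) (by ring) (by ring) (by ring)
  have k5 : w₁ ^ 2 + w₂ ^ 2 = z₁ ^ 2 + z₂ ^ 2 := by linear_combination k1 - k2
  have k6 : w₁ * z₂ - w₂ * z₁ = 0 := by linear_combination k3
  have k7 : w₁ * z₁ + w₂ * z₂ = 0 := by linear_combination k4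
  have k8 : (w₁ ^ 2 + w₂ ^ 2) ^ 2 = 0 := by
    linear_combination (w₁ ^ 2 + w₂ ^ 2) * k5 + (w₁ * z₂ - w₂ * z₁) * k6 +
      (w₁ * z₁ + w₂ * z₂) * k7
  have k9 := pow_eq_zero_iff two_ne_zero |>.1 k8
  obtain rfl : w₁ = 0 := by nlinarith
  obtain rfl : w₂ = 0 := by nlinarith
  obtain rfl : z₁ = 0 := by nlinarith
  obtain rfl : z₂ = 0 := by nlinarith
  have h4 : skewMat α β 0 0 0 0 p₁ p₂ 0 0 ∈ L := by
    convert IsSkewLie.add_mem hX (IsSkewLie.smul_mem (-1 / 4) h0) using 1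
    congr 1 <;> ring
  obtain ⟨c, rfl, rfl, -, -, -, -, rfl, rfl, -⟩ := hr.centralizer one_ne_zero hZ h4 (by simp)
    (by simp) (by simp) (by simp) (by simp) (by simp) (by simp) (by simp)
  exact ⟨c * 1, q₁, q₂, rfl⟩

theorem IsRankOne.form_of_double (hL : IsSkewLie L) (hr : IsRankOne L)
    (hZ : skewMat 2 1 0 0 0 0 0 0 0 0 ∈ L) {X : Matrix (Fin 5) (Fin 5) ℝ} (hX : X ∈ L) :
    ∃ c z₁ z₂ p₁ p₂, X = skewMat (2 * c) c 0 0 z₁ z₂ p₁ p₂ 0 0 ∧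
      skewMat 0 0 0 0 z₁ z₂ p₁ p₂ 0 0 ∈ L ∧ z₁ ^ 2 + z₂ ^ 2 = 3 * (p₁ ^ 2 + p₂ ^ 2) := by
  obtain ⟨α, β, w₁, w₂, z₁, z₂, p₁, p₂, q₁, q₂, rfl⟩ := exists_skewMat (hL.skew X hX)
  obtain ⟨rfl, rfl, rfl, rfl⟩ := hr.w_q_eq_zero hL one_pos one_lt_two hZ hX
  have h0 : skewMat 0 0 0 0 z₁ z₂ p₁ p₂ 0 0 ∈ L := by
    convert hL.torus_sq_mem hZ hX using 1
    congr 1 <;> ring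
  have h1 : skewMat α β 0 0 0 0 0 0 0 0 ∈ L := by
    convert IsSkewLie.add_mem hX (IsSkewLie.smul_mem (-1) h0) using 1
    congr 1 <;> ring
  obtain ⟨c, rfl, rfl, -⟩ := hr.centralizer two_ne_zero hZ h1 (by simp)
    (by simp) (by simp) (by simp) (by simp) (by simp) (by simp) (by simp)
  have h3 := hL.bracket _ h0 _ (hL.torus_bracket_mem hZ h0)
  rw [skewMat_bracket] at h3
  obtain ⟨d, k1, k2, -⟩ := hr.centralizer two_ne_zero hZ h3 (by ring)
    (by ring) (by ring) (by ring) (by ring) (by ring) (by ring) (by ring)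
  refine ⟨c, z₁, z₂, p₁, p₂, by congr 1 <;> ring, h0, ?_⟩
  linear_combination k2 - k1 / 2

theorem IsRankOne.form_of_single (hL : IsSkewLie L) (hr : IsRankOne L)
    (hZ : skewMat 1 0 0 0 0 0 0 0 0 0 ∈ L) {X : Matrix (Fin 5) (Fin 5) ℝ} (hX : X ∈ L) :
    ∃ a w₁ w₂ p₁ p₂ q₁ q₂, X = skewMat a 0 w₁ w₂ 0 0 p₁ p₂ q₁ q₂ ∧
      skewMat 0 0 w₁ w₂ 0 0 p₁ p₂ q₁ q₂ ∈ L ∧ (p₁ + q₁) * w₂ = (p₂ + q₂) * w₁ ∧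
      (-p₂ + q₂) * w₂ = (p₁ - q₁) * w₁ ∧ p₁ ^ 2 + p₂ ^ 2 = q₁ ^ 2 + q₂ ^ 2 := by
  obtain ⟨α, β, w₁, w₂, z₁, z₂, p₁, p₂, q₁, q₂, rfl⟩ := exists_skewMat (hL.skew X hX)
  have h0 := hL.torus_sq_mem hZ hX
  have h1 : skewMat 0 0 w₁ w₂ 0 0 p₁ p₂ q₁ q₂ ∈ L := by
    convert h0 using 1
    congr 1 <;> ring
  have h2 : skewMat α β 0 0 z₁ z₂ 0 0 0 0 ∈ L := by
    convert IsSkewLie.add_mem hX (IsSkewLie.smul_mem (-1) h1) using 1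
    congr 1 <;> ring
  obtain ⟨c, -, k1, -, -, rfl, rfl, -⟩ := hr.centralizer one_ne_zero hZ h2 (by simp)
    (by simp) (by simp) (by simp) (by simp) (by simp) (by simp) (by simp)
  obtain rfl : β = 0 := by simpa using k1
  have h3 := hL.bracket _ h1 _ (hL.torus_bracket_mem hZ h1)
  rw [skewMat_bracket] at h3
  obtain ⟨d, k1, k2, -, -, k3, k4, -⟩ := hr.centralizer one_ne_zero hZ h3 (by ring)
    (by ring) (by ring) (by ring) (by ring) (by ring) (by ring) (by ring)
  refine ⟨α, w₁, w₂, p₁, p₂, q₁, q₂, rfl, h1, ?_, ?_, ?_⟩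
  · linear_combination k3 / 2
  · linear_combination k4 / 2
  · linear_combination -k2 / 2

end RankOne

section RankOneGroups

open scoped Matrix.Norms.Operator
open NormedSpace (exp)

variable {S : Submonoid (Matrix (Fin 5) (Fin 5) ℝ)}

/-- A one-parameter group of irrational slope is dense in the standard torus. -/
theorem IsRotGrp.mem_lie_of_irrational (hS : IsRotGrp S) {r : ℝ} (hr : Irrational r)
    (hZ : skewMat 1 r 0 0 0 0 0 0 0 0 ∈ hS.lie) : skewMat 0 1 0 0 0 0 0 0 0 0 ∈ hS.lie := by
  have e1 : exp ((2 * Real.pi) • skewMat 1 0 0 0 0 0 0 0 0 0) = 1 := by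
    have h : homC 1 0 (Circle.exp (2 * Real.pi)) =
        exp ((2 * Real.pi) • skewMat ((1 : ℤ) : ℝ) ((0 : ℤ) : ℝ) 0 0 0 0 0 0 0 0) :=
      hasVelocity_homC 1 0 () (2 * Real.pi)
    rw [Circle.exp_two_pi, map_one, Int.cast_one, Int.cast_zero] at h
    exact h.symm
  have e2 : exp ((2 * Real.pi) • skewMat 0 1 0 0 0 0 0 0 0 0) = 1 := by
    have h : homC 0 1 (Circle.exp (2 * Real.pi)) =
        exp ((2 * Real.pi) • skewMat ((0 : ℤ) : ℝ) ((1 : ℤ) : ℝ) 0 0 0 0 0 0 0 0) :=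
      hasVelocity_homC 0 1 () (2 * Real.pi)
    rw [Circle.exp_two_pi, map_one, Int.cast_one, Int.cast_zero] at h
    exact h.symm
  have hcomm : Commute ((2 * Real.pi) • skewMat 1 0 0 0 0 0 0 0 0 0)
      ((2 * Real.pi * r) • skewMat 0 1 0 0 0 0 0 0 0 0) := by
    rw [Commute, SemiconjBy, ← sub_eq_zero, skewMat_smul, skewMat_smul, skewMat_bracket,
      ← skewMat_zero]
    congr 1 <;> ring
  have hsum : (2 * Real.pi) • skewMat 1 0 0 0 0 0 0 0 0 0 +
      (2 * Real.pi * r) • skewMat 0 1 0 0 0 0 0 0 0 0 =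
      (2 * Real.pi) • skewMat 1 r 0 0 0 0 0 0 0 0 := by
    rw [skewMat_smul, skewMat_smul, skewMat_smul, skewMat_add]
    congr 1 <;> ring
  have e3 : exp ((2 * Real.pi * r) • skewMat 0 1 0 0 0 0 0 0 0 0) ∈ S := by
    have h := Matrix.exp_add_of_commute _ _ hcomm
    have h1 : exp ((2 * Real.pi) • skewMat 1 r 0 0 0 0 0 0 0 0) ∈ S := hZ (2 * Real.pi)
    have h2 : exp ((2 * Real.pi) • skewMat 1 r 0 0 0 0 0 0 0 0) =
        exp ((2 * Real.pi * r) • skewMat 0 1 0 0 0 0 0 0 0 0) := by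
      refine (congrArg exp hsum.symm).trans (h.trans ?_)
      exact (congrArg (· * _) e1).trans (one_mul _)
    exact h2 ▸ h1
  let G : AddSubgroup ℝ :=
    { carrier := {t | exp (t • skewMat 0 1 0 0 0 0 0 0 0 0) ∈ S}
      zero_mem' := by
        change exp ((0 : ℝ) • skewMat 0 1 0 0 0 0 0 0 0 0) ∈ S
        simp
      add_mem' := fun {s t} hs ht => by
        have h : exp ((s + t) • skewMat 0 1 0 0 0 0 0 0 0 0) = _ := exp_add_smul _ s t
        exact (congrArg (· ∈ S) h).mpr (S.mul_mem hs ht)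
      neg_mem' := fun {t} ht => hS.inv_mem ht (exp_mul_neg_smul _ t) }
  have hG : IsClosed (G : Set ℝ) := by
    refine hS.compact.isClosed.preimage (f := fun t : ℝ =>
      exp (t • skewMat 0 1 0 0 0 0 0 0 0 0)) ?_
    exact continuous_exp_real_algebra.comp (continuous_id.smul continuous_const)
  have hle : AddSubgroup.closure {2 * Real.pi * r, 2 * Real.pi} ≤ G := by
    rw [AddSubgroup.closure_le]
    rintro x (rfl | rfl)
    · exact e3
    · change exp ((2 * Real.pi) • skewMat 0 1 0 0 0 0 0 0 0 0) ∈ S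
      exact e2 ▸ S.one_mem
  have hd : Dense (G : Set ℝ) := by
    refine Dense.mono hle (dense_addSubgroupClosure_pair_iff.2 ?_)
    rwa [mul_comm, mul_div_cancel_right₀ _ Real.two_pi_pos.ne']
  intro t
  have : t ∈ (G : Set ℝ) := by rw [← hG.closure_eq, hd.closure_eq]; trivial
  exact this

theorem IsRotGrp.isClassified_of_line (hS : IsRotGrp S) {a b : ℝ} (ha : a ≠ 0)
    (hZ : skewMat a b 0 0 0 0 0 0 0 0 ∈ hS.lie)
    (h : ∀ X ∈ hS.lie, ∃ c : ℝ, X = c • skewMat a b 0 0 0 0 0 0 0 0) : IsClassified S := by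
  have hZ' : skewMat 1 (b / a) 0 0 0 0 0 0 0 0 ∈ hS.lie := by
    convert IsSkewLie.smul_mem a⁻¹ hZ using 1
    congr 1 <;> field_simp <;> simp
  have hrat : ¬Irrational (b / a) := fun hr => by
    obtain ⟨c, hc⟩ := h _ (hS.mem_lie_of_irrational hr hZ')
    rw [skewMat_smul] at hc
    obtain ⟨h1, h2, -⟩ := skewMat_inj hc
    obtain rfl : c = 0 := (mul_eq_zero.1 h1.symm).resolve_right ha
    simp at h2
  rw [Irrational, not_not] at hrat
  obtain ⟨r, hr⟩ := hrat
  have hn : (r.den : ℝ) ≠ 0 := by exact_mod_cast r.den_ne_zero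
  have hb : b * r.den = a * r.num := by
    rw [Rat.cast_def] at hr
    field_simp at hr
    linarith
  refine .inl (.inr (.inl (hS.mapsOnto_circle (p := r.den) (q := r.num)
    (.inl (by exact_mod_cast r.den_ne_zero)) ?_ fun X hX => ?_)))
  · convert IsSkewLie.smul_mem (r.den / a) hZ using 1
    congr 1
    · push_cast; field_simp
    · field_simp; linarith
    all_goals simp
  · obtain ⟨c, rfl⟩ := h X hX
    refine ⟨c * a / r.den, ?_⟩
    rw [skewMat_smul]
    congr 1
    · push_cast; field_simp
    · field_simp; linear_combination c * hb
    all_goals simp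

theorem IsRotGrp.isClassified_of_diag (hS : IsRotGrp S) (hr : IsRankOne hS.lie)
    (hZ : skewMat 1 1 0 0 0 0 0 0 0 0 ∈ hS.lie) : IsClassified S := by
  by_cases h : ∀ X ∈ hS.lie, ∃ c : ℝ, X = c • skewMat 1 1 0 0 0 0 0 0 0 0
  · exact hS.isClassified_of_line one_ne_zero hZ h
  push Not at h
  obtain ⟨X, hX, hne⟩ := h
  obtain ⟨c, x, y, rfl⟩ := hr.form_of_diag hS.isSkewLie hZ hX
  have hxy : x ^ 2 + y ^ 2 ≠ 0 := fun h0 => by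
    obtain rfl : x = 0 := by nlinarith
    obtain rfl : y = 0 := by nlinarith
    exact hne c (by simp [skewMat_smul])
  refine .inl (.inr (.inr (.inl (hS.mapsOnto_su_q hZ ?_ fun Y hY =>
    hr.form_of_diag hS.isSkewLie hZ hY))))
  have h1 := hS.isSkewLie.torus_bracket_mem hZ hX
  have h2 := hS.isSkewLie.torus_bracket_mem hZ h1
  convert IsSkewLie.add_mem (IsSkewLie.smul_mem (-(x / (4 * (x ^ 2 + y ^ 2)))) h2)
    (IsSkewLie.smul_mem (-(y / (2 * (x ^ 2 + y ^ 2)))) h1) using 1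
  congr 1 <;> field_simp <;> ring

theorem rotTwo_orth {x y u v : ℝ} (h : x ^ 2 + y ^ 2 = 1) (h' : u ^ 2 + v ^ 2 = 1) :
    (rotTwo x y u v).transpose * rotTwo x y u v = 1 := by
  have ht : (rotTwo x y u v).transpose = rotTwo x (-y) u (-v) := by
    ext i j; fin_cases i <;> fin_cases j <;> simp [rotTwo]
  rw [ht, rotTwo_mul, ← rotTwo_one]
  congr 1 <;> linarith

theorem rotTwo_conj {x y : ℝ} (h : x ^ 2 + y ^ 2 = 1) (a b z₁ z₂ p₁ p₂ : ℝ) :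
    rotTwo x y x y * skewMat a b 0 0 z₁ z₂ p₁ p₂ 0 0 * (rotTwo x y x y).transpose =
      skewMat a b 0 0 (x * z₁ - y * z₂) (y * z₁ + x * z₂) p₁ p₂ 0 0 := by
  have ho := mul_eq_one_comm.1 (rotTwo_orth h h)
  have hc : rotTwo x y x y * skewMat a b 0 0 z₁ z₂ p₁ p₂ 0 0 =
      skewMat a b 0 0 (x * z₁ - y * z₂) (y * z₁ + x * z₂) p₁ p₂ 0 0 * rotTwo x y x y := by
    ext i j
    fin_cases i <;> fin_cases j <;> simp [rotTwo, skewMat] <;>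
      first | ring1 | linear_combination (-z₁) * h | linear_combination (-z₂) * h |
        linear_combination z₁ * h | linear_combination z₂ * h
  rw [hc, mul_assoc, ho, mul_one]

theorem conjHom_eq_zero {O X : Matrix (Fin 5) (Fin 5) ℝ} (h : O.transpose * O = 1)
    (h0 : O * X * O.transpose = 0) : X = 0 := by
  calc X = (O.transpose * O) * X * (O.transpose * O) := by rw [h, one_mul, mul_one]
    _ = O.transpose * (O * X * O.transpose) * O := by simp only [mul_assoc]
    _ = 0 := by rw [h0, mul_zero, zero_mul]

theorem IsRankOne.conj (hS : IsRotGrp S) (hr : IsRankOne hS.lie) {O : Matrix (Fin 5) (Fin 5) ℝ}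
    (h : O.transpose * O = 1) : IsRankOne (hS.conj h).lie := by
  intro X hX Y hY hX0 hXY
  obtain ⟨X, hX', rfl⟩ := hS.exists_of_mem_lie_conj h hX
  obtain ⟨Y, hY', rfl⟩ := hS.exists_of_mem_lie_conj h hY
  obtain ⟨c, rfl⟩ := hr X hX' Y hY' (by rintro rfl; simp at hX0) (by
    have h1 : ∀ A B : Matrix (Fin 5) (Fin 5) ℝ,
        O.transpose * (O * A * O.transpose * (O * B * O.transpose)) * O = A * B := fun A B => by
      calc _ = (O.transpose * O) * A * (O.transpose * O) * B * (O.transpose * O) := by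
            simp only [mul_assoc]
        _ = A * B := by simp [h]
    rw [← h1 X Y, hXY, h1])
  exact ⟨c, by simp⟩

theorem IsRotGrp.isClassified_of_double (hS : IsRotGrp S) (hr : IsRankOne hS.lie)
    (hZ : skewMat 2 1 0 0 0 0 0 0 0 0 ∈ hS.lie) : IsClassified S := by
  by_cases h : ∀ X ∈ hS.lie, ∃ c : ℝ, X = c • skewMat 2 1 0 0 0 0 0 0 0 0
  · exact hS.isClassified_of_line two_ne_zero hZ h
  push Not at h
  obtain ⟨X, hX, hne⟩ := h
  obtain ⟨c, z₁, z₂, p₁, p₂, rfl, h0, hzp⟩ := hr.form_of_double hS.isSkewLie hZ hX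
  have hp : p₁ ^ 2 + p₂ ^ 2 ≠ 0 := fun hp => by
    obtain rfl : p₁ = 0 := by nlinarith
    obtain rfl : p₂ = 0 := by nlinarith
    obtain rfl : z₁ = 0 := by nlinarith
    obtain rfl : z₂ = 0 := by nlinarith
    exact hne c (by rw [skewMat_smul]; congr 1 <;> ring)
  obtain ⟨x, y, hV⟩ : ∃ x y, skewMat 0 0 0 0 x y 0 1 0 0 ∈ hS.lie := by
    refine ⟨(p₂ * z₁ - p₁ * z₂) / (p₁ ^ 2 + p₂ ^ 2), (p₂ * z₂ + p₁ * z₁) / (p₁ ^ 2 + p₂ ^ 2), ?_⟩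
    convert IsSkewLie.add_mem (IsSkewLie.smul_mem (p₂ / (p₁ ^ 2 + p₂ ^ 2)) h0)
      (IsSkewLie.smul_mem (p₁ / (p₁ ^ 2 + p₂ ^ 2)) (hS.isSkewLie.torus_bracket_mem hZ h0)) using 1
    congr 1 <;> field_simp <;> ring
  have hxy : x ^ 2 + y ^ 2 = 3 := by
    obtain ⟨c, z₁, z₂, p₁, p₂, he, -, hzp⟩ := hr.form_of_double hS.isSkewLie hZ hV
    obtain ⟨-, -, -, -, rfl, rfl, rfl, rfl, -⟩ := skewMat_inj he
    linarith
  have h3 : √3 ^ 2 = (3 : ℝ) := Real.sq_sqrt (by norm_num)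
  have h3' : √3 ≠ (0 : ℝ) := by positivity
  have hn : (y / √3) ^ 2 + (x / √3) ^ 2 = 1 := by
    rw [div_pow, div_pow, h3]; linarith
  have hO := rotTwo_orth hn hn
  refine .conj hO (.inl (.inr (.inr (.inl ?_))))
  have hZ1 : skewMat 2 1 0 0 0 0 0 0 0 0 ∈ (hS.conj hO).lie := by
    convert hS.conj_mem_lie hO hZ using 1
    rw [rotTwo_conj hn]
    congr 1 <;> ring
  have hV1 : skewMat 0 0 0 0 0 √3 0 1 0 0 ∈ (hS.conj hO).lie := by
    convert hS.conj_mem_lie hO hV using 1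
    rw [rotTwo_conj hn]
    congr 1
    · ring
    · field_simp; linarith
  refine (hS.conj hO).mapsOnto_su_zp hZ1 hV1 fun Y hY => ?_
  have hL := (hS.conj hO).isSkewLie
  obtain ⟨c, z₁, z₂, p₁, p₂, rfl, h0, -⟩ := (hr.conj hS hO).form_of_double hL hZ1 hY
  have h1 : skewMat 0 0 0 0 (z₁ - √3 * p₁) (z₂ - √3 * p₂) 0 0 0 0 ∈ (hS.conj hO).lie := by
    convert IsSkewLie.add_mem h0 (IsSkewLie.add_mem (IsSkewLie.smul_mem (-p₂) hV1)
      (IsSkewLie.smul_mem p₁ (hL.torus_bracket_mem hZ1 hV1))) using 1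
    congr 1 <;> ring
  obtain ⟨h2, h3⟩ := (hr.conj hS hO).z_eq_zero hL two_ne_zero hZ1 one_ne_zero h1
  exact ⟨c, p₁, p₂, by congr 1 <;> linarith⟩

theorem conj_vecMulVec_sub (O : Matrix (Fin 5) (Fin 5) ℝ) (u v : Fin 5 → ℝ) :
    O * (Matrix.vecMulVec u v - Matrix.vecMulVec v u) * O.transpose =
      Matrix.vecMulVec (O.mulVec u) (O.mulVec v) - Matrix.vecMulVec (O.mulVec v) (O.mulVec u) := by
  simp only [mul_sub, sub_mul, Matrix.mul_vecMulVec, Matrix.vecMulVec_mul, Matrix.vecMul_transpose]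

end RankOneGroups

section SphereGroups

open scoped Matrix.Norms.Operator
open NormedSpace (exp)

variable {S : Submonoid (Matrix (Fin 5) (Fin 5) ℝ)}

theorem unit_mem_of_proportional {L : Submodule ℝ (Matrix (Fin 5) (Fin 5) ℝ)} {U V w τ : ℝ}
    (hN : U ^ 2 + V ^ 2 + w ^ 2 ≠ 0)
    (h : skewMat 0 0 w (τ * w) 0 0 ((U + τ * V) / 2) ((τ * U - V) / 2) ((U - τ * V) / 2)
      ((τ * U + V) / 2) ∈ L)
    (h' : skewMat 0 0 (-(τ * w)) w 0 0 (-((τ * U - V) / 2)) ((U + τ * V) / 2)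
      (-((τ * U + V) / 2)) ((U - τ * V) / 2) ∈ L) :
    ∃ x y z : ℝ, x ^ 2 + y ^ 2 + z ^ 2 = 1 ∧
      skewMat 0 0 z 0 0 0 (x / 2) (-(y / 2)) (x / 2) (y / 2) ∈ L := by
  have hN1 : 0 < U ^ 2 + V ^ 2 + w ^ 2 := lt_of_le_of_ne (by positivity) hN.symm
  have hN0 : √(U ^ 2 + V ^ 2 + w ^ 2) ≠ 0 := (Real.sqrt_pos.2 hN1).ne'
  have hN2 := Real.sq_sqrt hN1.le
  generalize √(U ^ 2 + V ^ 2 + w ^ 2) = N at hN0 hN2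
  refine ⟨U / N, V / N, w / N, by field_simp; exact hN2.symm, ?_⟩
  have ht : 1 + τ ^ 2 ≠ 0 := by positivity
  convert IsSkewLie.add_mem (IsSkewLie.smul_mem (1 / (N * (1 + τ ^ 2))) h)
    (IsSkewLie.smul_mem (τ / (N * (1 + τ ^ 2))) (IsSkewLie.smul_mem (-1) h')) using 1
  congr 1 <;> field_simp <;> ring

theorem IsRankOne.exists_unit_of_single {L : Submodule ℝ (Matrix (Fin 5) (Fin 5) ℝ)}
    (hL : IsSkewLie L) (hr : IsRankOne L) (hZ : skewMat 1 0 0 0 0 0 0 0 0 0 ∈ L)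
    {w₁ w₂ p₁ p₂ q₁ q₂ : ℝ} (h : skewMat 0 0 w₁ w₂ 0 0 p₁ p₂ q₁ q₂ ∈ L)
    (h' : skewMat 0 0 (-w₂) w₁ 0 0 (-p₂) p₁ (-q₂) q₁ ∈ L)
    (hne : (p₁ + q₁) ^ 2 + (-p₂ + q₂) ^ 2 + w₁ ^ 2 ≠ 0) :
    ∃ x y z : ℝ, x ^ 2 + y ^ 2 + z ^ 2 = 1 ∧
      skewMat 0 0 z 0 0 0 (x / 2) (-(y / 2)) (x / 2) (y / 2) ∈ L := by
  obtain ⟨_, _, _, _, _, _, _, he, -, h1, h2, h3⟩ := hr.form_of_single hL hZ h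
  obtain ⟨-, -, rfl, rfl, -, -, rfl, rfl, rfl, rfl⟩ := skewMat_inj he
  obtain ⟨U, hU⟩ : ∃ U, U = p₁ + q₁ := ⟨_, rfl⟩
  obtain ⟨V, hV⟩ : ∃ V, V = -p₂ + q₂ := ⟨_, rfl⟩
  rw [← hU, ← hV] at hne
  rw [← hU] at h1
  rw [← hV] at h2
  obtain ⟨τ, t1, t2, t3⟩ : ∃ τ, p₂ + q₂ = τ * U ∧ p₁ - q₁ = τ * V ∧ w₂ = τ * w₁ := by
    have h4 : U * (p₁ - q₁) = V * (p₂ + q₂) := by rw [hU, hV]; linear_combination h3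
    refine ⟨(U * (p₂ + q₂) + V * (p₁ - q₁) + w₁ * w₂) / (U ^ 2 + V ^ 2 + w₁ ^ 2), ?_, ?_, ?_⟩
    · field_simp
      linear_combination -V * h4 - w₁ * h1
    · field_simp
      linear_combination U * h4 - w₁ * h2
    · field_simp
      linear_combination U * h1 + V * h2
  have e1 : p₁ = (U + τ * V) / 2 := by linarith
  have e2 : p₂ = (τ * U - V) / 2 := by linarith
  have e3 : q₁ = (U - τ * V) / 2 := by linarith
  have e4 : q₂ = (τ * U + V) / 2 := by linarith
  rw [e1, e2, e3, e4, t3] at h h'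
  exact unit_mem_of_proportional hne h h'

theorem IsRankOne.exists_unit_mem {L : Submodule ℝ (Matrix (Fin 5) (Fin 5) ℝ)}
    (hL : IsSkewLie L) (hr : IsRankOne L) (hZ : skewMat 1 0 0 0 0 0 0 0 0 0 ∈ L)
    {X : Matrix (Fin 5) (Fin 5) ℝ} (hX : X ∈ L)
    (hne : ∀ c : ℝ, X ≠ c • skewMat 1 0 0 0 0 0 0 0 0 0) :
    ∃ x y z : ℝ, x ^ 2 + y ^ 2 + z ^ 2 = 1 ∧
      skewMat 0 0 z 0 0 0 (x / 2) (-(y / 2)) (x / 2) (y / 2) ∈ L := by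
  obtain ⟨a, w₁, w₂, p₁, p₂, q₁, q₂, rfl, h, -⟩ := hr.form_of_single hL hZ hX
  have h' : skewMat 0 0 (-w₂) w₁ 0 0 (-p₂) p₁ (-q₂) q₁ ∈ L := by
    convert hL.torus_bracket_mem hZ h using 1
    congr 1 <;> ring
  by_cases h1 : (p₁ + q₁) ^ 2 + (-p₂ + q₂) ^ 2 + w₁ ^ 2 = 0
  · refine hr.exists_unit_of_single hL hZ h' ?_ fun h2 => hne a ?_
    · convert IsSkewLie.smul_mem (-1) h using 1
      congr 1 <;> ring
    · obtain rfl : w₁ = 0 := by nlinarith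
      obtain rfl : w₂ = 0 := by nlinarith
      have k1 : p₁ + q₁ = 0 := by nlinarith
      have k2 : -p₂ + q₂ = 0 := by nlinarith
      have k3 : -p₂ + -q₂ = 0 := by nlinarith
      have k4 : -p₁ + q₁ = 0 := by nlinarith
      rw [skewMat_smul]
      congr 1 <;> linarith
  · exact hr.exists_unit_of_single hL hZ h h' h1

theorem IsRankOne.form_of_sphere {L : Submodule ℝ (Matrix (Fin 5) (Fin 5) ℝ)}
    (hL : IsSkewLie L) (hr : IsRankOne L) (hZ : skewMat 1 0 0 0 0 0 0 0 0 0 ∈ L)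
    (hE : skewMat 0 0 1 0 0 0 0 0 0 0 ∈ L) (hF : skewMat 0 0 0 1 0 0 0 0 0 0 ∈ L)
    {Y : Matrix (Fin 5) (Fin 5) ℝ} (hY : Y ∈ L) :
    ∃ a x y, Y = skewMat a 0 x y 0 0 0 0 0 0 := by
  obtain ⟨a, w₁, w₂, p₁, p₂, q₁, q₂, rfl, h, -⟩ := hr.form_of_single hL hZ hY
  have key : ∀ s t : ℝ, (p₁ + q₁) * t = (p₂ + q₂) * s ∧ (-p₂ + q₂) * t = (p₁ - q₁) * s := by
    intro s t
    have h1 : skewMat 0 0 s t 0 0 p₁ p₂ q₁ q₂ ∈ L := by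
      convert IsSkewLie.add_mem h (IsSkewLie.add_mem (IsSkewLie.smul_mem (s - w₁) hE)
        (IsSkewLie.smul_mem (t - w₂) hF)) using 1
      congr 1 <;> ring
    obtain ⟨_, _, _, _, _, _, _, he, -, h2, h3, -⟩ := hr.form_of_single hL hZ h1
    obtain ⟨-, -, rfl, rfl, -, -, rfl, rfl, rfl, rfl⟩ := skewMat_inj he
    exact ⟨h2, h3⟩
  obtain ⟨k1, k2⟩ := key 1 0
  obtain ⟨k3, k4⟩ := key 0 1
  exact ⟨a, w₁, w₂, by congr 1 <;> linarith⟩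

theorem IsRotGrp.isClassified_of_single (hS : IsRotGrp S) (hr : IsRankOne hS.lie)
    (hZ : skewMat 1 0 0 0 0 0 0 0 0 0 ∈ hS.lie) : IsClassified S := by
  by_cases h : ∀ X ∈ hS.lie, ∃ c : ℝ, X = c • skewMat 1 0 0 0 0 0 0 0 0 0
  · exact hS.isClassified_of_line one_ne_zero hZ h
  push Not at h
  obtain ⟨X, hX, hne⟩ := h
  obtain ⟨x, y, z, hn, hE⟩ := hr.exists_unit_mem hS.isSkewLie hZ hX hne
  obtain ⟨O, hO, hO0, hO1, hO4⟩ := exists_orth_fixing hn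
  refine .conj hO (.inl (.inr (.inr (.inl ?_))))
  have hZ1 : skewMat 1 0 0 0 0 0 0 0 0 0 ∈ (hS.conj hO).lie := by
    have h1 : skewMat 1 0 0 0 0 0 0 0 0 0 =
        Matrix.vecMulVec ![0, 1, 0, 0, 0] ![1, 0, 0, 0, 0] -
          Matrix.vecMulVec ![1, 0, 0, 0, 0] ![0, 1, 0, 0, 0] := by
      ext i j; fin_cases i <;> fin_cases j <;> simp [skewMat]
    have h2 := hS.conj_mem_lie hO hZ
    rwa [h1, conj_vecMulVec_sub, hO0, hO1, ← h1] at h2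
  have hE1 : skewMat 0 0 1 0 0 0 0 0 0 0 ∈ (hS.conj hO).lie := by
    have h1 : skewMat 0 0 z 0 0 0 (x / 2) (-(y / 2)) (x / 2) (y / 2) =
        Matrix.vecMulVec ![1, 0, 0, 0, 0] ![0, 0, x, y, z] -
          Matrix.vecMulVec ![0, 0, x, y, z] ![1, 0, 0, 0, 0] := by
      ext i j; fin_cases i <;> fin_cases j <;> simp [skewMat]
    have h2 : skewMat 0 0 1 0 0 0 0 0 0 0 =
        Matrix.vecMulVec ![1, 0, 0, 0, 0] ![0, 0, 0, 0, 1] -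
          Matrix.vecMulVec ![0, 0, 0, 0, 1] ![1, 0, 0, 0, 0] := by
      ext i j; fin_cases i <;> fin_cases j <;> simp [skewMat]
    have h3 := hS.conj_mem_lie hO hE
    rwa [h1, conj_vecMulVec_sub, hO0, hO4, ← h2] at h3
  have hL1 := (hS.conj hO).isSkewLie
  have hF1 : skewMat 0 0 0 1 0 0 0 0 0 0 ∈ (hS.conj hO).lie := by
    simpa using hL1.torus_bracket_mem hZ1 hE1
  exact (hS.conj hO).mapsOnto_su_w hZ1 hF1 fun Y hY =>
    (hr.conj hS hO).form_of_sphere hL1 hZ1 hE1 hF1 hY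

/-- Groups of rank one containing a torus in normal form. -/
theorem IsRotGrp.isClassified_of_slope (hS : IsRotGrp S) (hr : IsRankOne hS.lie) {a b : ℝ}
    (hb : 0 ≤ b) (hab : b ≤ a) (ha : 0 < a) (hZ : skewMat a b 0 0 0 0 0 0 0 0 ∈ hS.lie) :
    IsClassified S := by
  have hZ' : ∀ c, skewMat (c * a) (c * b) 0 0 0 0 0 0 0 0 ∈ hS.lie := fun c => by
    simpa using IsSkewLie.smul_mem c hZ
  rcases hb.eq_or_lt with rfl | hb
  · exact hS.isClassified_of_single hr (by simpa [ha.ne'] using hZ' a⁻¹)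
  rcases hab.eq_or_lt with rfl | hab
  · exact hS.isClassified_of_diag hr (by simpa [ha.ne'] using hZ' b⁻¹)
  by_cases h2 : a = 2 * b
  · refine hS.isClassified_of_double hr ?_
    convert hZ' b⁻¹ using 1
    congr 1
    · rw [h2]; field_simp
    · field_simp
  · exact hS.isClassified_of_line ha.ne' hZ fun X hX =>
      hr.eq_smul_of_generic hS.isSkewLie hb hab h2 hZ hX

theorem IsRotGrp.isClassified_of_abs_le (hS : IsRotGrp S) (hr : IsRankOne hS.lie) {a b : ℝ}
    (hab : |b| ≤ |a|) (ha : a ≠ 0) (hZ : skewMat a b 0 0 0 0 0 0 0 0 ∈ hS.lie) :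
    IsClassified S := by
  wlog ha' : 0 < a generalizing a b
  · refine this (a := -a) (b := -b) (by simpa using hab) (by simpa using ha) ?_ ?_
    · simpa using IsSkewLie.smul_mem (-1) hZ
    · exact neg_pos.2 (lt_of_le_of_ne (not_lt.1 ha') ha)
  rw [abs_of_pos ha', abs_le] at hab
  rcases le_total 0 b with hb | hb
  · exact hS.isClassified_of_slope hr hb hab.2 ha' hZ
  · refine .conj reflMat_orth ((hS.conj reflMat_orth).isClassified_of_slope
      (hr.conj hS reflMat_orth) (b := -b) (by linarith) (by linarith) ha' ?_)
    simpa [reflMat_conj] using hS.conj_mem_lie reflMat_orth hZ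

theorem IsRotGrp.isClassified_of_rankOne (hS : IsRotGrp S) (hr : IsRankOne hS.lie) :
    IsClassified S := by
  by_cases h : ∀ X ∈ hS.lie, X = 0
  · exact .inl (.inl (hS.mapsOnto_punit h))
  push Not at h
  obtain ⟨X, hX, hX0⟩ := h
  have hsk := hS.isSkewLie.skew X hX
  obtain ⟨O, hO, a, b, -, -, hZ, -⟩ := exists_torus_form hsk hsk rfl
  refine .conj hO ?_
  have hZ1 := hS.conj_mem_lie hO hX
  rw [hZ] at hZ1
  have hr1 := hr.conj hS hO
  rcases le_total |b| |a| with hab | hab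
  · refine (hS.conj hO).isClassified_of_abs_le hr1 hab ?_ hZ1
    rintro rfl
    obtain rfl : b = 0 := by simpa using hab
    exact hX0 (conjHom_eq_zero hO (hZ.trans skewMat_zero))
  · refine .conj swapMat_orth (((hS.conj hO).conj swapMat_orth).isClassified_of_abs_le
      (hr1.conj _ swapMat_orth) (a := b) (b := a) hab ?_ ?_)
    · rintro rfl
      obtain rfl : a = 0 := by simpa using hab
      exact hX0 (conjHom_eq_zero hO (hZ.trans skewMat_zero))
    · simpa [swapMat_conj] using (hS.conj hO).conj_mem_lie swapMat_orth hZ1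

/-- Every compact connected group of orthogonal `5 × 5` matrices is classified. -/
theorem IsRotGrp.isClassified (hS : IsRotGrp S) : IsClassified S := by
  by_cases hr : IsRankOne hS.lie
  · exact hS.isClassified_of_rankOne hr
  unfold IsRankOne at hr
  push Not at hr
  obtain ⟨X, hX, Y, hY, hX0, hXY, hne⟩ := hr
  obtain ⟨O, hO, a, b, c, d, h1, h2⟩ :=
    exists_torus_form (hS.isSkewLie.skew X hX) (hS.isSkewLie.skew Y hY) hXY
  have hX1 := hS.conj_mem_lie hO hX
  have hY1 := hS.conj_mem_lie hO hY
  rw [h1] at hX1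
  rw [h2] at hY1
  have hdet : a * d - b * c ≠ 0 := fun h0 => by
    have hab : ¬(a = 0 ∧ b = 0) := by
      rintro ⟨rfl, rfl⟩
      exact hX0 (conjHom_eq_zero hO (h1.trans skewMat_zero))
    obtain ⟨k, hk1, hk2⟩ : ∃ k, c = k * a ∧ d = k * b := by
      by_cases ha : a = 0
      · have hb : b ≠ 0 := fun hb => hab ⟨ha, hb⟩
        subst ha
        have : b * c = 0 := by linarith
        exact ⟨d / b, by simpa [hb] using this, by field_simp⟩
      · exact ⟨c / a, by field_simp, by field_simp; linarith⟩
    refine hne k (sub_eq_zero.1 (conjHom_eq_zero hO ?_))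
    rw [mul_sub, sub_mul, h2, Matrix.mul_smul, Matrix.smul_mul, h1, skewMat_smul, hk1, hk2]
    simp
  obtain ⟨D, hD⟩ : ∃ D, D = a * d - b * c := ⟨_, rfl⟩
  rw [← hD] at hdet
  refine .conj hO ((hS.conj hO).isClassified_of_torus ?_ ?_)
  · convert IsSkewLie.add_mem (IsSkewLie.smul_mem (d / D) hX1)
      (IsSkewLie.smul_mem (-b / D) hY1) using 1
    congr 1 <;> field_simp <;> linarith
  · convert IsSkewLie.add_mem (IsSkewLie.smul_mem (-c / D) hX1)
      (IsSkewLie.smul_mem (a / D) hY1) using 1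
    congr 1 <;> field_simp <;> linarith

end SphereGroups

section Embedding

/-- The inclusion of the special orthogonal group into matrices. -/
def specialOrthogonalVal : SUgrp 5 ℝ →* Matrix (Fin 5) (Fin 5) ℝ :=
  (Submonoid.subtype (Matrix.unitaryGroup (Fin 5) ℝ)).comp (SUgrp 5 ℝ).subtype

theorem specialOrthogonalVal_injective : Function.Injective specialOrthogonalVal :=
  Subtype.val_injective.comp Subtype.val_injective

theorem isInducing_specialOrthogonalVal : Topology.IsInducing specialOrthogonalVal :=
  Topology.IsInducing.subtypeVal.comp Topology.IsInducing.subtypeVal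

theorem transpose_mul_specialOrthogonalVal (g : SUgrp 5 ℝ) :
    (specialOrthogonalVal g).transpose * specialOrthogonalVal g = 1 := by
  have h := Matrix.UnitaryGroup.star_mul_self g.1
  rwa [Matrix.star_eq_conjTranspose, Matrix.conjTranspose_eq_transpose_of_trivial] at h

theorem det_specialOrthogonalVal (g : SUgrp 5 ℝ) : (specialOrthogonalVal g).det = 1 := g.2

variable {K : Subgroup (SUgrp 5 ℝ)}

theorem isRotGrp_map (hclosed : IsClosed (K : Set (SUgrp 5 ℝ)))
    (hconn : IsConnected (K : Set (SUgrp 5 ℝ))) :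
    IsRotGrp (K.toSubmonoid.map specialOrthogonalVal) where
  compact := by
    have _ := compactSpace_SUgrp 5 ℝ
    exact hclosed.isCompact.image isInducing_specialOrthogonalVal.continuous
  inv := by
    rintro _ ⟨g, hg, rfl⟩
    exact ⟨specialOrthogonalVal g⁻¹, ⟨g⁻¹, K.inv_mem hg, rfl⟩, by simp [← map_mul],
      by simp [← map_mul]⟩
  conn := hconn.isPreconnected.image _ isInducing_specialOrthogonalVal.continuous.continuousOn
  orth := by
    rintro _ ⟨g, -, rfl⟩
    exact transpose_mul_specialOrthogonalVal g

theorem MapsOnto.finitelyCovers {P : Type} [Group P] [TopologicalSpace P]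
    (h : MapsOnto P (K.toSubmonoid.map specialOrthogonalVal)) : FinitelyCovers P K := by
  obtain ⟨f, hf, hrange, hker⟩ := h
  have hmem : ∀ p, ∃ k : K, specialOrthogonalVal k = f p := fun p => by
    have h1 : f p ∈ K.toSubmonoid.map specialOrthogonalVal := hrange.subset ⟨p, rfl⟩
    obtain ⟨g, hg, h2⟩ := h1
    exact ⟨⟨g, hg⟩, h2⟩
  choose φ hφ using hmem
  have hinj : Function.Injective fun k : K => specialOrthogonalVal k :=
    specialOrthogonalVal_injective.comp Subtype.val_injective
  have hind : Topology.IsInducing fun k : K => specialOrthogonalVal k :=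
    isInducing_specialOrthogonalVal.comp Topology.IsInducing.subtypeVal
  let F : P →* K := MonoidHom.mk' φ fun p q => hinj (by simp [hφ])
  refine ⟨F, hind.continuous_iff.2 (hf.congr fun p => (hφ p).symm), fun k => ?_, ?_⟩
  · obtain ⟨p, hp⟩ := hrange.superset ⟨k, k.2, rfl⟩
    exact ⟨p, hinj ((hφ p).trans hp)⟩
  · refine (hker.subset fun p hp => ?_).to_subtype
    have h1 : φ p = 1 := hp
    change f p = 1
    rw [← hφ p, h1]
    simp

theorem FinitelyCovers.punit {H : Type*} [Group H] [TopologicalSpace H]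
    (h : FinitelyCovers PUnit H) : FinitelyCovers PUnit H := by
  obtain ⟨f, -, hf, -⟩ := h
  refine ⟨1, continuous_const, fun x => ⟨PUnit.unit, ?_⟩, inferInstance⟩
  obtain ⟨p, rfl⟩ := hf x
  exact (map_one f).symm

end Embedding

/-- Let `K` be a closed connected subgroup of `SO(5)`
(`= SUgrp 5 ℝ`) with `K ≠ SO(5)`.  Then `K` is finitely covered by a product of at
most two factors, each of which is the circle group `S¹` or `SU(2)`: one of the
compact groups `{1}`, `S¹`, `SU(2)`, `S¹ × S¹`, `S¹ × SU(2)`, `SU(2) × SU(2)` admits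
a continuous surjective homomorphism onto `K` with finite kernel. -/
theorem stmt18
    (K : Subgroup (SUgrp 5 ℝ))
    (hclosed : IsClosed (K : Set (SUgrp 5 ℝ)))
    (hconn : IsConnected (K : Set (SUgrp 5 ℝ)))
    (hne : K ≠ ⊤) :
    FinitelyCovers PUnit K ∨
    FinitelyCovers Circle K ∨
    FinitelyCovers (SUgrp 2 ℂ) K ∨
    FinitelyCovers (Circle × Circle) K ∨
    FinitelyCovers (Circle × SUgrp 2 ℂ) K ∨
    FinitelyCovers (SUgrp 2 ℂ × SUgrp 2 ℂ) K := by
  have hS := isRotGrp_map hclosed hconn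
  rcases hS.isClassified with h | h
  · exact h.imp (·.finitelyCovers.punit) <| Or.imp (·.finitelyCovers) <|
      Or.imp (·.finitelyCovers) <| Or.imp (·.finitelyCovers) <|
      Or.imp (·.finitelyCovers) (·.finitelyCovers)
  · refine (hne ((Subgroup.eq_top_iff' K).2 fun g => ?_)).elim
    have hdet : ∀ A ∈ K.toSubmonoid.map specialOrthogonalVal, A.det = 1 := by
      rintro _ ⟨g, -, rfl⟩
      exact det_specialOrthogonalVal g
    obtain ⟨k, hk, hkg⟩ := mem_of_full hS.toIsCompactGrp hS.orth hdet h
      (transpose_mul_specialOrthogonalVal g) (det_specialOrthogonalVal g)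
    rwa [← specialOrthogonalVal_injective hkg]
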